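/- arXiv:2112.00159 — 2 statements merged into one kernel-verified Lean document; each statement's English description precedes it below -/
import Mathlib

section
/- For every fixed t > 0 and every nonnegative Lipschitz continuous function φ : ℝ → ℝ with compact support, the chain (Z̄_k)_{k≥0} associated with semi-Baxter permutations satisfies, as n → ∞: E[φ(Z̄_{⌊nt⌋}/(σ'√n)) · 1_{Z̄_{⌊nt⌋} > 0}] → (1/2) ∫_0^∞ φ(y) · (2 e^{−y²/(2t)}/√(2πt)) dy, and E[φ(Z̄_{⌊nt⌋}/(σ√n)) · 1_{Z̄_{⌊nt⌋} < 0}] → (1/2) ∫_{−∞}^0 φ(y) · (2 e^{−y²/(2t)}/√(2πt)) dy; that is, the rescaled one-dimensional marginals converge to those of a standard Brownian motion (a skew Brownian motion of parameter q = 1/2). -/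
attribute [local instance] Classical.propDecidable

noncomputable section

open MeasureTheory

/-- `α = √5 - 2`. -/
def semiα : ℝ := Real.sqrt 5 - 2

/-- `γ = (√5 - 1)/2`. -/
def semiγ : ℝ := (Real.sqrt 5 - 1) / 2

/-- `σ = √(2(2+√5))`. -/
def semiσ : ℝ := Real.sqrt (2 * (2 + Real.sqrt 5))

/-- `σ' = √(1+√5)`. -/
def semiσ' : ℝ := Real.sqrt (1 + Real.sqrt 5)

/-- The step distribution `μ_sb`. -/
def wSemi (d : ℤ × ℤ) : ℝ :=
  if d.1 ≤ 0 ∧ d.2 = 1 then semiα * semiγ ^ (-d.1).toNat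
  else if 1 ≤ d.1 ∧ d.2 = 1 - d.1 then semiα * semiγ ^ d.1.toNat
  else 0

/-- One step of the coalescent chain for semi-Baxter permutations. -/
def zStep (z : ℤ) (d : ℤ × ℤ) : ℤ :=
  if 0 ≤ z ∧ 0 < z + d.2 then z + d.2
  else if (0 ≤ z ∧ z + d.2 ≤ 0) ∨ (z < 0 ∧ z - d.1 < 0) then z - d.1
  else 1

/-- The chain `Z̄`, driven by the sequence of increments `f` of the walk `W̄`. -/
def zbar (f : ℕ → ℤ × ℤ) : ℕ → ℤ
  | 0 => 0
  | ℓ + 1 => zStep (zbar f ℓ) (f ℓ)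

/-- Extension of a finite tuple of increments by a dummy value. -/
def extFin {m : ℕ} (g : Fin m → ℤ × ℤ) : ℕ → ℤ × ℤ :=
  fun i => if h : i < m then g ⟨i, h⟩ else (0, 0)

/-- `E[φ(Z̄_{⌊nt⌋}/(σ'√n)) · 1_{Z̄_{⌊nt⌋} > 0}]`. -/
def EplusSemi (t : ℝ) (φ : ℝ → ℝ) (n : ℕ) : ℝ :=
  ∑' g : Fin ⌊(n : ℝ) * t⌋₊ → ℤ × ℤ,
    (∏ i, wSemi (g i)) *
      (if 0 < zbar (extFin g) ⌊(n : ℝ) * t⌋₊ then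
        φ ((zbar (extFin g) ⌊(n : ℝ) * t⌋₊ : ℝ) / (semiσ' * Real.sqrt n)) else 0)

/-- `E[φ(Z̄_{⌊nt⌋}/(σ√n)) · 1_{Z̄_{⌊nt⌋} < 0}]`. -/
def EminusSemi (t : ℝ) (φ : ℝ → ℝ) (n : ℕ) : ℝ :=
  ∑' g : Fin ⌊(n : ℝ) * t⌋₊ → ℤ × ℤ,
    (∏ i, wSemi (g i)) *
      (if zbar (extFin g) ⌊(n : ℝ) * t⌋₊ < 0 then
        φ ((zbar (extFin g) ⌊(n : ℝ) * t⌋₊ : ℝ) / (semiσ * Real.sqrt n)) else 0)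

/-! ### Elementary facts on the constants -/

lemma sg_pos : 0 < semiγ := by
  unfold semiγ
  have : (1:ℝ) < Real.sqrt 5 := by
    rw [Real.lt_sqrt] <;> norm_num
  linarith

lemma sg_lt : semiγ < 1 := by
  unfold semiγ
  have : Real.sqrt 5 < 3 := by
    rw [Real.sqrt_lt'] <;> norm_num
  linarith

lemma sg_sq : semiγ ^ 2 = 1 - semiγ := by
  unfold semiγ
  have : Real.sqrt 5 ^ 2 = 5 := Real.sq_sqrt (by norm_num)
  nlinarith

lemma sa_eq : semiα = 2 * semiγ - 1 := by
  unfold semiγ semiα; ring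

lemma s5_eq : Real.sqrt 5 = 2 * semiγ + 1 := by
  unfold semiγ; ring

lemma sa_pos : 0 < semiα := by
  unfold semiα
  have : (2:ℝ) < Real.sqrt 5 := by
    rw [Real.lt_sqrt] <;> norm_num
  linarith

lemma ss_pos : 0 < semiσ' := by
  unfold semiσ'; positivity

lemma ss_sq : semiσ' ^ 2 = 2 + 2 * semiγ := by
  unfold semiσ'
  rw [Real.sq_sqrt (by positivity), s5_eq]; ring

lemma ss_eq : semiσ' = semiγ * semiσ := by
  have h1 : 0 ≤ semiγ * semiσ := mul_nonneg sg_pos.le (Real.sqrt_nonneg _)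
  rw [← Real.sqrt_sq h1, semiσ', mul_pow, semiσ, Real.sq_sqrt (by positivity), s5_eq]
  congr 1
  have := sg_sq
  linear_combination (-2 - 4*semiγ) * this

/-! ### Sums -/

lemma hasSum_poly (a b c : ℝ) :
    HasSum (fun i : ℕ => semiγ ^ i * (a + b * i + c * (i:ℝ)^2))
      (a * (2 + semiγ) + b * (3 + 2 * semiγ) + c * (13 + 8 * semiγ)) := by
  have hg : ‖semiγ‖ < 1 := by
    rw [Real.norm_of_nonneg sg_pos.le]; exact sg_lt
  have q := sg_sq
  have hne : 1 - semiγ ≠ 0 := by linarith [sg_lt]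
  have h0 := hasSum_choose_mul_geometric_of_norm_lt_one 0 hg
  have h1 := hasSum_choose_mul_geometric_of_norm_lt_one 1 hg
  have h2 := hasSum_choose_mul_geometric_of_norm_lt_one 2 hg
  have e1 : (1 : ℝ) / (1 - semiγ) ^ (0+1) = 2 + semiγ := by
    rw [div_eq_iff (by positivity)]
    linear_combination q
  have e2 : (1 : ℝ) / (1 - semiγ) ^ (1+1) = (2 + semiγ)^2 := by
    rw [← e1, div_pow, one_pow, ← pow_mul]
  have e3 : (1 : ℝ) / (1 - semiγ) ^ (2+1) = (2 + semiγ)^3 := by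
    rw [← e1, div_pow, one_pow, ← pow_mul]
  rw [e1] at h0
  rw [e2] at h1
  rw [e3] at h2
  have := ((h0.mul_left (a - b + c)).add (h1.mul_left (b - 3 * c))).add (h2.mul_left (2 * c))
  convert! this using 1
  · funext i
    have : (((i + 2).choose 2 : ℕ) : ℝ) = (i + 2) * (i + 1) / 2 := by
      rw [Nat.cast_choose_two]; push_cast; ring
    rw [this]
    simp
    ring
  · have q3 : semiγ ^ 3 = 2 * semiγ - 1 := by linear_combination (semiγ - 1) * q
    ring_nf
    rw [q3, q]
    ring

lemma hasSum_wSemi (F : ℤ × ℤ → ℝ) {a b : ℝ}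
    (ha : HasSum (fun i : ℕ => semiγ ^ i * F (-(i:ℤ), 1)) a)
    (hb : HasSum (fun i : ℕ => semiγ ^ i * F ((i:ℤ) + 1, -(i:ℤ))) b) :
    HasSum (fun d => wSemi d * F d) (semiα * a + semiα * semiγ * b) := by
  let j : ℕ ⊕ ℕ → ℤ × ℤ := Sum.elim (fun i => (-(i:ℤ), 1)) (fun i => ((i:ℤ) + 1, -(i:ℤ)))
  have hj : Function.Injective j := by
    rintro (x | x) (y | y) h <;> simp [j] at h ⊢ <;> omega
  rw [← hj.hasSum_iff]
  · have := HasSum.sum (f := (fun d => wSemi d * F d) ∘ j) (a := semiα * a) (b := semiα * semiγ * b) ?_ ?_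
    · exact this
    · convert! ha.mul_left semiα using 1
      funext i
      simp [j, wSemi]
      ring
    · convert! hb.mul_left (semiα * semiγ) using 1
      funext i
      have h1 : ¬ ((i:ℤ) + 1 ≤ 0) := by omega
      have h2 : (1:ℤ) ≤ (i:ℤ) + 1 := by omega
      have h3 : ((i:ℤ) + 1).toNat = i + 1 := by omega
      simp [j, wSemi, h1, h3]
      ring
  · rintro ⟨x, y⟩ hx
    have : wSemi (x, y) = 0 := by
      unfold wSemi
      rw [if_neg, if_neg]
      · rintro ⟨h1, h2⟩
        simp only at h1 h2
        exact hx ⟨Sum.inr (x - 1).toNat, by simp [j]; omega⟩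
      · rintro ⟨h1, h2⟩
        simp only at h1 h2
        exact hx ⟨Sum.inl (-x).toNat, by simp [j]; omega⟩
    simp [this]

lemma hasSum_tail {u : ℕ → ℝ} (m : ℕ) (hu : ∀ i < m, u i = 0) {a : ℝ}
    (h : HasSum (fun l => semiγ ^ l * u (l + m)) a) :
    HasSum (fun i => semiγ ^ i * u i) (semiγ ^ m * a) := by
  rw [← hasSum_nat_add_iff' m, Finset.sum_eq_zero, sub_zero]
  · convert! h.mul_left (semiγ ^ m) using 1
    funext l
    ring
  · intro i hi
    rw [hu i (Finset.mem_range.1 hi), mul_zero]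

lemma hasSum_pos (f : ℤ → ℝ) (a b c a' b' c' : ℝ)
    (h1 : ∀ x : ℤ, 0 < x → f x = a + b * x + c * (x:ℝ)^2)
    (h2 : ∀ x : ℤ, x < 0 → f x = a' + b' * x + c' * (x:ℝ)^2) (m : ℕ) :
    HasSum (fun d => wSemi d * f (zStep m d))
      (semiα * ((a + b * (m+1) + c * (m+1)^2) * (2 + semiγ)) + semiα * semiγ *
        (((a + b * m + c * m^2) * (2 + semiγ) + (-b - 2 * c * m) * (3 + 2 * semiγ) + c * (13 + 8 * semiγ))
        + semiγ ^ m * ((a' - b' + c' - a) * (2 + semiγ) + (- b' + 2 * c' + b) * (3 + 2 * semiγ) +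
          (c' - c) * (13 + 8 * semiγ)))) := by
  apply hasSum_wSemi
  · convert! hasSum_poly (a + b * (m+1) + c * (m+1)^2) 0 0 using 1
    · funext i
      have : zStep m (-(i:ℤ), 1) = m + 1 := by
        unfold zStep; rw [if_pos]; constructor <;> simp <;> omega
      rw [this, h1 _ (by omega)]
      push_cast
      ring
    · ring
  · have := (hasSum_poly (a + b * m + c * m^2) (-b - 2 * c * m) c).add
      (hasSum_tail (u := fun i => f (zStep m ((i:ℤ)+1, -(i:ℤ))) - (a + b * (m - i) + c * ((m:ℝ) - i)^2)) m ?_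
        (a := (a' - b' + c' - a) * (2 + semiγ) + (- b' + 2 * c' + b) * (3 + 2 * semiγ) +
          (c' - c) * (13 + 8 * semiγ)) ?_)
    · convert! this using 1
      funext i
      ring
    · intro i hi
      have : zStep m ((i:ℤ)+1, -(i:ℤ)) = m - i := by
        unfold zStep; rw [if_pos]
        · simp; ring
        · constructor <;> simp <;> omega
      simp only [this]
      rw [h1 _ (by omega)]
      push_cast
      ring
    · convert! hasSum_poly (a' - b' + c' - a) (- b' + 2 * c' + b) (c' - c) using 1
      funext l
      have : zStep m (((l + m : ℕ):ℤ)+1, -((l + m : ℕ):ℤ)) = - l - 1 := by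
        unfold zStep; rw [if_neg, if_pos]
        · simp; ring
        · left; constructor <;> simp
        · simp
      simp only [this]
      rw [h2 _ (by omega)]
      push_cast
      ring

lemma hasSum_neg' (f : ℤ → ℝ) (a b c a' b' c' : ℝ)
    (h1 : ∀ x : ℤ, 0 < x → f x = a + b * x + c * (x:ℝ)^2)
    (h2 : ∀ x : ℤ, x < 0 → f x = a' + b' * x + c' * (x:ℝ)^2) (m : ℕ) (hm : 0 < m) :
    HasSum (fun d => wSemi d * f (zStep (-(m:ℤ)) d))
      (semiα * (((a' - b' * m + c' * m^2) * (2 + semiγ) + (b' - 2 * c' * m) * (3 + 2 * semiγ) + c' * (13 + 8 * semiγ))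
        + semiγ ^ m * ((a + b + c - a') * (2 + semiγ) + (- b') * (3 + 2 * semiγ) +
          (- c') * (13 + 8 * semiγ))) + semiα * semiγ *
        ((a' - b' * (m + 1) + c' * (m+1)^2) * (2 + semiγ) + (-b' + 2 * c' * (m + 1)) * (3 + 2 * semiγ) + c' * (13 + 8 * semiγ))) := by
  apply hasSum_wSemi
  · have := (hasSum_poly (a' - b' * m + c' * m^2) (b' - 2 * c' * m) c').add
      (hasSum_tail (u := fun i => f (zStep (-(m:ℤ)) (-(i:ℤ), 1)) - (a' + b' * (i - m) + c' * ((i:ℝ) - m)^2)) m ?_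
        (a := (a + b + c - a') * (2 + semiγ) + (- b') * (3 + 2 * semiγ) +
          (- c') * (13 + 8 * semiγ)) ?_)
    · convert! this using 1
      funext i
      ring
    · intro i hi
      have : zStep (-(m:ℤ)) (-(i:ℤ), 1) = i - m := by
        unfold zStep; rw [if_neg, if_pos]
        · simp; ring
        · right; constructor <;> simp <;> omega
        · simp; omega
      simp only [this]
      rw [h2 _ (by omega)]
      push_cast
      ring
    · convert! hasSum_poly (a + b + c - a') (- b') (- c') using 1
      funext l
      have : zStep (-(m:ℤ)) (-((l + m : ℕ):ℤ), 1) = 1 := by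
        unfold zStep; rw [if_neg, if_neg]
        · simp
        · simp; omega
      simp only [this]
      rw [h1 _ (by omega)]
      push_cast
      ring
  · convert! hasSum_poly (a' - b' * (m + 1) + c' * (m+1)^2) (-b' + 2 * c' * (m + 1)) c' using 1
    funext i
    have : zStep (-(m:ℤ)) ((i:ℤ)+1, -(i:ℤ)) = -m - i - 1 := by
      unfold zStep; rw [if_neg, if_pos]
      · simp; ring
      · right; constructor <;> simp <;> omega
      · simp
    rw [this, h2 _ (by omega)]
    push_cast
    ring

/-- The harmonic function of the chain. -/
def hh (z : ℤ) : ℝ := if 0 ≤ z then (z:ℝ) else semiγ * z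

lemma hh_pos {z : ℤ} (h : 0 < z) : hh z = z := if_pos h.le
lemma hh_nn (m : ℕ) : hh (m:ℤ) = m := by
  rw [hh, if_pos (by omega)]; simp
lemma hh_neg {z : ℤ} (h : z < 0) : hh z = semiγ * z := if_neg (by omega)

lemma int_cases (z : ℤ) : (∃ m : ℕ, z = m) ∨ ∃ m : ℕ, 0 < m ∧ z = -(m:ℤ) := by
  rcases le_or_gt 0 z with h | h
  · exact Or.inl ⟨z.toNat, by omega⟩
  · exact Or.inr ⟨(-z).toNat, by omega, by omega⟩

lemma q3 : semiγ ^ 3 = 2 * semiγ - 1 := by linear_combination (semiγ - 1) * sg_sq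
lemma q4 : semiγ ^ 4 = 2 - 3 * semiγ := by linear_combination (semiγ^2 - semiγ + 2) * sg_sq
lemma q5 : semiγ ^ 5 = 5 * semiγ - 3 := by linear_combination (semiγ) * q4 - 3 * sg_sq

lemma hasSum_h (z : ℤ) : HasSum (fun d => wSemi d * hh (zStep z d)) (hh z) := by
  rcases int_cases z with ⟨m, rfl⟩ | ⟨m, hm, rfl⟩
  · convert! hasSum_pos hh 0 1 0 0 semiγ 0 (fun x hx => by rw [hh_pos hx]; ring)
      (fun x hx => by rw [hh_neg hx]; ring) m using 1
    rw [hh_nn, sa_eq]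
    ring_nf
    simp only [q3, q4, sg_sq]
    ring
  · convert! hasSum_neg' hh 0 1 0 0 semiγ 0 (fun x hx => by rw [hh_pos hx]; ring)
      (fun x hx => by rw [hh_neg hx]; ring) m hm using 1
    rw [hh_neg (by omega), sa_eq]
    push_cast
    ring_nf
    simp only [q3, q4, sg_sq]
    ring

lemma hasSum_abs (z : ℤ) : HasSum (fun d => wSemi d * |hh (zStep z d)|)
    (|hh z| + 2 * semiγ * semiγ ^ z.natAbs) := by
  have e1 : ∀ x : ℤ, 0 < x → |hh x| = 0 + 1 * (x:ℝ) + 0 * (x:ℝ)^2 := fun x hx => by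
    rw [hh_pos hx, abs_of_pos (by exact_mod_cast hx)]; ring
  have e2 : ∀ x : ℤ, x < 0 → |hh x| = 0 + (-semiγ) * (x:ℝ) + 0 * (x:ℝ)^2 := fun x hx => by
    have : (x:ℝ) < 0 := by exact_mod_cast hx
    rw [hh_neg hx, abs_of_neg (mul_neg_of_pos_of_neg sg_pos this)]; ring
  rcases int_cases z with ⟨m, rfl⟩ | ⟨m, hm, rfl⟩
  · convert! hasSum_pos (fun z => |hh z|) _ _ _ _ _ _ e1 e2 m using 1
    rw [hh_nn, sa_eq, abs_of_nonneg (by positivity)]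
    simp only [Int.natAbs_natCast]
    ring_nf
    simp only [q3, q4, sg_sq]
    ring
  · convert! hasSum_neg' (fun z => |hh z|) _ _ _ _ _ _ e1 e2 m hm using 1
    rw [e2 _ (by omega), sa_eq]
    simp only [Int.natAbs_natCast, Int.natAbs_neg]
    push_cast
    ring_nf
    simp only [q3, q4, sg_sq]
    ring

lemma hasSum_sq (z : ℤ) : HasSum (fun d => wSemi d * hh (zStep z d) ^ 2)
    (hh z ^ 2 + semiσ' ^ 2 - semiγ ^ z.natAbs) := by
  have e1 : ∀ x : ℤ, 0 < x → hh x ^ 2 = 0 + 0 * (x:ℝ) + 1 * (x:ℝ)^2 := fun x hx => by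
    rw [hh_pos hx]; ring
  have e2 : ∀ x : ℤ, x < 0 → hh x ^ 2 = 0 + 0 * (x:ℝ) + (semiγ^2) * (x:ℝ)^2 := fun x hx => by
    rw [hh_neg hx]; ring
  rw [ss_sq]
  rcases int_cases z with ⟨m, rfl⟩ | ⟨m, hm, rfl⟩
  · convert! hasSum_pos (fun z => hh z ^ 2) _ _ _ _ _ _ e1 e2 m using 1
    rw [hh_nn, sa_eq]
    simp only [Int.natAbs_natCast]
    ring_nf
    simp only [q3, q4, q5, sg_sq]
    ring
  · convert! hasSum_neg' (fun z => hh z ^ 2) _ _ _ _ _ _ e1 e2 m hm using 1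
    rw [e2 _ (by omega), sa_eq]
    simp only [Int.natAbs_natCast, Int.natAbs_neg]
    push_cast
    ring_nf
    simp only [q3, q4, q5, sg_sq]
    ring

lemma hasSum_one : HasSum wSemi 1 := by
  convert! hasSum_wSemi (fun _ => 1) (a := 2 + semiγ) (b := 2 + semiγ) ?_ ?_ using 1
  · simp
  · rw [sa_eq]
    ring_nf
    simp only [q3, q4, sg_sq]
    ring
  · convert! hasSum_poly 1 0 0 using 1 <;> simp
  · convert! hasSum_poly 1 0 0 using 1 <;> simp

lemma wSemi_nonneg (d : ℤ × ℤ) : 0 ≤ wSemi d := by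
  have := sg_pos
  have := sa_pos
  unfold wSemi; split_ifs <;> positivity

/-- Bound on the jump size. -/
def RR (d : ℤ × ℤ) : ℝ := 1 + |(d.1:ℝ)| + |(d.2:ℝ)|

lemma summable_R3 : Summable (fun d => wSemi d * RR d ^ 3) := by
  have hg : ‖semiγ‖ < 1 := by
    rw [Real.norm_of_nonneg sg_pos.le]; exact sg_lt
  have key : ∀ a b : ℝ, Summable (fun i : ℕ => semiγ ^ i * (a + b * i) ^ 3) := by
    intro a b
    have h3 := (summable_pow_mul_geometric_of_norm_lt_one 3 hg).mul_left (b^3)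
    have h := (hasSum_poly (a^3) (3*a^2*b) (3*a*b^2)).summable
    refine (h.add h3).congr fun i => ?_
    ring
  refine (hasSum_wSemi _ (a := _) (b := _) (Summable.hasSum ?_) (Summable.hasSum ?_)).summable
  · refine (key 2 1).congr fun i => ?_
    simp [RR]
    left; ring
  · refine (key 2 2).congr fun i => ?_
    simp only [RR]
    push_cast
    rw [abs_of_nonneg (by positivity : (0:ℝ) ≤ (i:ℝ) + 1), abs_neg, abs_of_nonneg (by positivity : (0:ℝ) ≤ (i:ℝ))]
    ring

lemma abs_zStep (z : ℤ) (d : ℤ × ℤ) : |zStep z d - z| ≤ 1 + |d.1| + |d.2| := by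
  unfold zStep
  split_ifs <;> (rcases abs_cases d.1 with h | h <;> rcases abs_cases d.2 with h' | h' <;> rw [abs_le] <;> constructor <;> omega)

lemma hh_lip (x y : ℤ) : |hh x - hh y| ≤ |(x:ℝ) - y| := by
  have h1 := sg_pos
  have h2 := sg_lt
  unfold hh
  split_ifs with hx hy hy
  · rfl
  · have hx' : (0:ℝ) ≤ x := by exact_mod_cast hx
    have hy' : (y:ℝ) < 0 := by exact_mod_cast (not_le.1 hy)
    rw [abs_of_nonneg (by nlinarith), abs_of_nonneg (by linarith)]
    nlinarith
  · have hx' : (0:ℝ) ≤ y := by exact_mod_cast hy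
    have hy' : (x:ℝ) < 0 := by exact_mod_cast (not_le.1 hx)
    rw [abs_of_nonpos (by nlinarith), abs_of_nonpos (by linarith)]
    nlinarith
  · rw [← mul_sub, abs_mul, abs_of_pos h1]
    nlinarith [abs_nonneg ((x:ℝ) - y)]

lemma abs_delta (z : ℤ) (d : ℤ × ℤ) : |hh (zStep z d) - hh z| ≤ RR d := by
  refine (hh_lip _ _).trans ?_
  have := abs_zStep z d
  unfold RR
  exact_mod_cast this

/-! ### Measures -/

/-- The step law as a measure. -/
def muS : Measure (ℤ × ℤ) := Measure.sum fun d => ENNReal.ofReal (wSemi d) • Measure.dirac d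

lemma lintegral_muS (F : ℤ × ℤ → ENNReal) :
    ∫⁻ d, F d ∂muS = ∑' d, ENNReal.ofReal (wSemi d) * F d := by
  unfold muS
  rw [lintegral_sum_measure]
  congr 1
  funext d
  rw [lintegral_smul_measure, lintegral_dirac, smul_eq_mul]

lemma lintegral_muS_of_hasSum {F : ℤ × ℤ → ℝ} (hF : ∀ d, 0 ≤ F d) {a : ℝ}
    (h : HasSum (fun d => wSemi d * F d) a) :
    ∫⁻ d, ENNReal.ofReal (F d) ∂muS = ENNReal.ofReal a := by
  rw [lintegral_muS, ← h.tsum_eq, ENNReal.ofReal_tsum_of_nonneg _ h.summable]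
  · congr 1
    funext d
    rw [ENNReal.ofReal_mul (wSemi_nonneg d)]
  · intro d
    exact mul_nonneg (wSemi_nonneg d) (hF d)

instance : IsProbabilityMeasure muS := by
  constructor
  rw [← lintegral_one]
  have := lintegral_muS_of_hasSum (F := fun _ => 1) (fun _ => zero_le_one) (a := 1)
    (by simpa using hasSum_one)
  simpa using this

lemma muS_real (d : ℤ × ℤ) : muS.real {d} = wSemi d := by
  rw [Measure.real, ← lintegral_indicator_one (measurableSet_singleton d), lintegral_muS,
    tsum_eq_single d]
  · simp [wSemi_nonneg]
  · intro e he
    simp [he]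

lemma integrable_muS {F : ℤ × ℤ → ℝ} (h : Summable (fun d => wSemi d * F d)) :
    Integrable F muS := by
  refine ⟨Measurable.aestronglyMeasurable (measurable_of_countable _), ?_⟩
  rw [hasFiniteIntegral_iff_norm]
  have h' : HasSum (fun d => wSemi d * ‖F d‖) (∑' d, wSemi d * ‖F d‖) := by
    refine Summable.hasSum (h.norm.congr fun d => ?_)
    rw [norm_mul, Real.norm_of_nonneg (wSemi_nonneg d)]
  rw [lintegral_muS_of_hasSum (fun _ => norm_nonneg _) h']
  exact ENNReal.ofReal_lt_top

lemma integral_muS {F : ℤ × ℤ → ℝ} {a : ℝ} (h : HasSum (fun d => wSemi d * F d) a) :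
    ∫ d, F d ∂muS = a := by
  rw [integral_countable (integrable_muS h.summable), ← h.tsum_eq]
  simp [muS_real]

/-- The law of the chain. -/
def nuS : ℕ → Measure ℤ
  | 0 => Measure.dirac 0
  | N + 1 => ((nuS N).prod muS).map (fun p => zStep p.1 p.2)

lemma meas_step : Measurable (fun p : ℤ × (ℤ × ℤ) => zStep p.1 p.2) := measurable_of_countable _

instance (N : ℕ) : IsProbabilityMeasure (nuS N) := by
  induction N with
  | zero => unfold nuS; infer_instance
  | succ N ih =>
    unfold nuS
    exact Measure.isProbabilityMeasure_map meas_step.aemeasurable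

lemma lintegral_nuS_succ (N : ℕ) (F : ℤ → ENNReal) :
    ∫⁻ z, F z ∂(nuS (N+1)) = ∫⁻ z, ∫⁻ d, F (zStep z d) ∂muS ∂(nuS N) := by
  rw [nuS, lintegral_map (measurable_of_countable _) meas_step, lintegral_prod]
  exact (measurable_of_countable _).aemeasurable

lemma integral_nuS_succ (N : ℕ) (f : ℤ → ℂ) (C : ℝ) (hf : ∀ z, ‖f z‖ ≤ C) :
    ∫ z, f z ∂(nuS (N+1)) = ∫ z, ∫ d, f (zStep z d) ∂muS ∂(nuS N) := by
  rw [nuS, integral_map meas_step.aemeasurable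
    (Measurable.aestronglyMeasurable (measurable_of_countable _)), integral_prod]
  refine Integrable.of_bound (Measurable.aestronglyMeasurable (measurable_of_countable _)) C ?_
  exact Filter.Eventually.of_forall fun p => hf _

lemma zbar_congr (f f' : ℕ → ℤ × ℤ) (N : ℕ) (h : ∀ i < N, f i = f' i) : zbar f N = zbar f' N := by
  induction N with
  | zero => rfl
  | succ N ih =>
    simp only [zbar]
    rw [ih (fun i hi => h i (by omega)), h N (by omega)]

lemma zbar_snoc (N : ℕ) (g : Fin N → ℤ × ℤ) (d : ℤ × ℤ) :
    zbar (extFin (Fin.snoc g d : Fin (N+1) → ℤ × ℤ)) (N+1) = zStep (zbar (extFin g) N) d := by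
  simp only [zbar]
  congr 1
  · apply zbar_congr
    intro i hi
    simp [extFin, Fin.snoc, hi, Nat.lt_succ_of_lt hi]
  · simp [extFin, Fin.snoc]

lemma lintegral_nuS (N : ℕ) (F : ℤ → ENNReal) :
    ∫⁻ z, F z ∂(nuS N) = ∑' g : Fin N → ℤ × ℤ,
      (∏ i, ENNReal.ofReal (wSemi (g i))) * F (zbar (extFin g) N) := by
  induction N generalizing F with
  | zero => simp [nuS, zbar]
  | succ N ih =>
    rw [lintegral_nuS_succ, ih]
    rw [← (Fin.snocEquiv (fun _ => ℤ × ℤ)).tsum_eq, ENNReal.tsum_prod', ENNReal.tsum_comm]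
    congr 1
    funext g
    rw [lintegral_muS, ← ENNReal.tsum_mul_left]
    congr 1
    funext d
    simp only [Fin.snocEquiv, Equiv.coe_fn_mk]
    rw [zbar_snoc, Fin.prod_univ_castSucc]
    simp only [Fin.snoc_castSucc, Fin.snoc_last]
    rw [mul_assoc]

lemma tsum_eq_integral (N : ℕ) (F : ℤ → ℝ) (hF : ∀ z, 0 ≤ F z) :
    ∑' g : Fin N → ℤ × ℤ, (∏ i, wSemi (g i)) * F (zbar (extFin g) N) = ∫ z, F z ∂(nuS N) := by
  rw [integral_eq_lintegral_of_nonneg_ae (Filter.Eventually.of_forall hF)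
    (Measurable.aestronglyMeasurable (measurable_of_countable _)), lintegral_nuS,
    ENNReal.tsum_toReal_eq]
  · congr 1
    funext g
    rw [ENNReal.toReal_mul, ENNReal.toReal_ofReal (hF _), ENNReal.toReal_prod]
    congr 1
    refine Finset.prod_congr rfl fun i _ => ?_
    rw [ENNReal.toReal_ofReal (wSemi_nonneg _)]
  · intro g
    refine ENNReal.mul_ne_top (ENNReal.prod_ne_top fun i _ => ENNReal.ofReal_ne_top) ENNReal.ofReal_ne_top

/-! ### Moments and occupation time -/

lemma second_moment (N : ℕ) :
    ∫⁻ z, ENNReal.ofReal (hh z ^ 2) ∂(nuS N) ≤ ENNReal.ofReal (N * semiσ' ^ 2) := by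
  induction N with
  | zero => simp [nuS, hh]
  | succ N ih =>
    rw [lintegral_nuS_succ]
    calc _ ≤ ∫⁻ z, (ENNReal.ofReal (hh z ^ 2) + ENNReal.ofReal (semiσ' ^ 2)) ∂(nuS N) := by
          refine lintegral_mono fun z => ?_
          simp only
          rw [lintegral_muS_of_hasSum (fun _ => sq_nonneg _) (hasSum_sq z),
            ← ENNReal.ofReal_add (sq_nonneg _) (sq_nonneg _)]
          apply ENNReal.ofReal_le_ofReal
          have := pow_pos sg_pos z.natAbs
          linarith
      _ ≤ ENNReal.ofReal (N * semiσ' ^ 2) + ENNReal.ofReal (semiσ' ^ 2) := by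
          rw [lintegral_add_right _ (measurable_of_countable _)]
          gcongr
          simp
      _ = _ := by
          rw [← ENNReal.ofReal_add (by positivity) (sq_nonneg _)]
          congr 1
          push_cast
          ring

lemma abs_moment (N : ℕ) :
    ∫⁻ z, ENNReal.ofReal |hh z| ∂(nuS N) =
      ∑ k ∈ Finset.range N, ∫⁻ z, ENNReal.ofReal (2 * semiγ * semiγ ^ z.natAbs) ∂(nuS k) := by
  induction N with
  | zero => simp [nuS, hh]
  | succ N ih =>
    rw [lintegral_nuS_succ, Finset.sum_range_succ, ← ih,
      ← lintegral_add_right _ (measurable_of_countable _)]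
    refine lintegral_congr fun z => ?_
    have := sg_pos
    rw [lintegral_muS_of_hasSum (fun _ => abs_nonneg _) (hasSum_abs z),
      ENNReal.ofReal_add (abs_nonneg _) (by positivity)]

/-- occupation near zero -/
def occ (k : ℕ) : ℝ := ∫ z, semiγ ^ z.natAbs ∂(nuS k)

lemma gpow_le (m : ℕ) : semiγ ^ m ≤ 1 := pow_le_one₀ sg_pos.le sg_lt.le

lemma integrable_gpow (k : ℕ) : Integrable (fun z : ℤ => semiγ ^ z.natAbs) (nuS k) := by
  refine Integrable.of_bound (Measurable.aestronglyMeasurable (measurable_of_countable _)) 1 ?_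
  refine Filter.Eventually.of_forall fun z => ?_
  rw [Real.norm_of_nonneg (pow_nonneg sg_pos.le _)]
  exact gpow_le _

lemma occ_le (N : ℕ) (hN : 0 < N) :
    2 * semiγ * ∑ k ∈ Finset.range N, occ k ≤ (semiσ' ^ 2 + 1) * Real.sqrt N := by
  have hg := sg_pos
  have hN' : (0:ℝ) < N := by exact_mod_cast hN
  have hs : 0 < Real.sqrt N := Real.sqrt_pos.2 hN'
  have hss : Real.sqrt N * Real.sqrt N = N := Real.mul_self_sqrt hN'.le
  have h1 : ENNReal.ofReal (2 * semiγ * ∑ k ∈ Finset.range N, occ k)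
      = ∫⁻ z, ENNReal.ofReal |hh z| ∂(nuS N) := by
    rw [abs_moment, Finset.mul_sum, ENNReal.ofReal_sum_of_nonneg]
    · refine Finset.sum_congr rfl fun k _ => ?_
      rw [occ, ← integral_const_mul, ofReal_integral_eq_lintegral_ofReal]
      · exact (integrable_gpow k).const_mul _
      · exact Filter.Eventually.of_forall fun z => by simp only [Pi.zero_apply]; positivity
    · intro k _
      have : 0 ≤ occ k := integral_nonneg fun z => by simp only [Pi.zero_apply]; positivity
      positivity
  have h2 : ∫⁻ z, ENNReal.ofReal |hh z| ∂(nuS N) ≤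
      ENNReal.ofReal ((semiσ' ^ 2 + 1) * Real.sqrt N) := by
    calc _ ≤ ∫⁻ z, (ENNReal.ofReal (1 / Real.sqrt N) * ENNReal.ofReal (hh z ^ 2) +
          ENNReal.ofReal (Real.sqrt N)) ∂(nuS N) := by
          refine lintegral_mono fun z => ?_
          simp only
          rw [← ENNReal.ofReal_mul (by positivity), ← ENNReal.ofReal_add (by positivity) (by positivity)]
          apply ENNReal.ofReal_le_ofReal
          rw [← sq_abs]
          have e : 1 / Real.sqrt N * |hh z| ^ 2 + Real.sqrt N = (|hh z|^2 + N) / Real.sqrt N := by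
            field_simp
            linear_combination hss
          rw [e, le_div_iff₀ hs]
          nlinarith [sq_nonneg (|hh z| - Real.sqrt N), sq_nonneg (|hh z|)]
      _ ≤ ENNReal.ofReal (1 / Real.sqrt N) * ENNReal.ofReal (N * semiσ' ^ 2) +
          ENNReal.ofReal (Real.sqrt N) := by
          rw [lintegral_add_right _ (measurable_of_countable _),
            lintegral_const_mul _ (measurable_of_countable _)]
          gcongr
          · exact second_moment N
          · simp
      _ = _ := by
          rw [← ENNReal.ofReal_mul (by positivity), ← ENNReal.ofReal_add (by positivity) (by positivity)]
          congr 1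
          have : 1 / Real.sqrt N * N = Real.sqrt N := by
            rw [one_div, inv_mul_eq_iff_eq_mul₀ hs.ne', hss]
          rw [← mul_assoc, this]
          ring
  rw [← h1] at h2
  exact (ENNReal.ofReal_le_ofReal_iff (by positivity)).1 h2

/-! ### Characteristic function -/

lemma exp_bound (x : ℝ) :
    ‖Complex.exp (x * Complex.I) - (1 + x * Complex.I - x ^ 2 / 2)‖ ≤ 4 * |x| ^ 3 := by
  rcases le_total |x| 1 with h | h
  · have := Complex.norm_exp_sub_sum_le_norm_mul_exp (x * Complex.I) 3
    have e : ∑ m ∈ Finset.range 3, ((x:ℂ) * Complex.I) ^ m / (m.factorial : ℂ)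
        = 1 + x * Complex.I - x ^ 2 / 2 := by
      simp [Finset.sum_range_succ, mul_pow, Nat.factorial]
      ring
    rw [e] at this
    have hn : ‖(x:ℂ) * Complex.I‖ = |x| := by simp
    rw [hn] at this
    refine this.trans ?_
    have : Real.exp |x| ≤ 4 := by
      have h1 := Real.exp_le_exp.2 h
      have h2 := Real.exp_one_lt_d9
      linarith
    nlinarith [pow_nonneg (abs_nonneg x) 3]
  · have h1 : ‖Complex.exp (x * Complex.I)‖ = 1 := Complex.norm_exp_ofReal_mul_I x
    have h2 : ‖(x:ℂ) * Complex.I‖ = |x| := by simp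
    have h3 : ‖(x:ℂ)^2/2‖ = |x|^2/2 := by simp
    calc _ ≤ ‖Complex.exp (x * Complex.I)‖ + ‖1 + x * Complex.I - (x:ℂ) ^ 2 / 2‖ := norm_sub_le _ _
      _ ≤ 1 + (1 + |x| + |x|^2/2) := by
        rw [h1]
        gcongr
        refine (norm_sub_le _ _).trans ?_
        rw [h3]
        gcongr
        refine (norm_add_le _ _).trans ?_
        rw [h2]
        simp
      _ ≤ _ := by nlinarith [sq_nonneg (|x|), mul_nonneg (sub_nonneg.2 h) (sq_nonneg |x|)]

/-- Third moment bound. -/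
def C3 : ℝ := ∫ d, RR d ^ 3 ∂muS

lemma RR_nonneg (d : ℤ × ℤ) : 1 ≤ RR d := by
  unfold RR
  have := abs_nonneg (d.1:ℝ)
  have := abs_nonneg (d.2:ℝ)
  linarith

lemma C3_nonneg : 0 ≤ C3 := integral_nonneg fun d => by
  have := RR_nonneg d
  simp only [Pi.zero_apply]; positivity

lemma integrable_R3 : Integrable (fun d => RR d ^ 3) muS := integrable_muS summable_R3

lemma integral_delta (z : ℤ) :
    Integrable (fun d => hh (zStep z d) - hh z) muS ∧ ∫ d, (hh (zStep z d) - hh z) ∂muS = 0 := by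
  have h := (hasSum_h z).sub (hasSum_one.mul_right (hh z))
  have h' : HasSum (fun d => wSemi d * (hh (zStep z d) - hh z)) 0 := by
    convert! h using 1
    · funext d; ring
    · ring
  exact ⟨integrable_muS h'.summable, integral_muS h'⟩

lemma integral_delta_sq (z : ℤ) :
    Integrable (fun d => (hh (zStep z d) - hh z) ^ 2) muS ∧
      ∫ d, (hh (zStep z d) - hh z) ^ 2 ∂muS = semiσ' ^ 2 - semiγ ^ z.natAbs := by
  have h := ((hasSum_sq z).sub ((hasSum_h z).mul_right (2 * hh z))).add (hasSum_one.mul_right (hh z ^ 2))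
  have h' : HasSum (fun d => wSemi d * (hh (zStep z d) - hh z) ^ 2) (semiσ' ^ 2 - semiγ ^ z.natAbs) := by
    convert! h using 1
    · funext d; ring
    · ring
  exact ⟨integrable_muS h'.summable, integral_muS h'⟩

lemma char_step (a : ℝ) (z : ℤ) :
    ‖∫ d, Complex.exp (((a * hh (zStep z d) : ℝ) : ℂ) * Complex.I) ∂muS
      - ((1 - a ^ 2 * semiσ' ^ 2 / 2 : ℝ) : ℂ) * Complex.exp (((a * hh z : ℝ) : ℂ) * Complex.I)‖ ≤
      4 * C3 * |a| ^ 3 + a ^ 2 * semiγ ^ z.natAbs := by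
  set D : ℤ × ℤ → ℝ := fun d => hh (zStep z d) - hh z with hD
  obtain ⟨i1, e1⟩ := integral_delta z
  obtain ⟨i2, e2⟩ := integral_delta_sq z
  have hE : Integrable (fun d => Complex.exp (((a * D d : ℝ) : ℂ) * Complex.I)) muS := by
    refine Integrable.of_bound (Measurable.aestronglyMeasurable (measurable_of_countable _)) 1 ?_
    exact Filter.Eventually.of_forall fun d => (Complex.norm_exp_ofReal_mul_I _).le
  have hT : Integrable (fun d => (1 + ((a * D d : ℝ) : ℂ) * Complex.I - ((a * D d : ℝ) : ℂ) ^ 2 / 2)) muS := by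
    have j1 : Integrable (fun d => ((a * D d : ℝ) : ℂ) * Complex.I) muS :=
      ((i1.const_mul a).ofReal).mul_const _
    have j2 : Integrable (fun d => ((a * D d : ℝ) : ℂ) ^ 2 / 2) muS := by
      have : Integrable (fun d => ((a ^ 2 / 2 * (hh (zStep z d) - hh z) ^ 2 : ℝ) : ℂ)) muS :=
        (i2.const_mul (a^2/2)).ofReal
      refine this.congr (Filter.Eventually.of_forall fun d => ?_)
      simp only [hD]
      push_cast
      ring
    exact ((integrable_const _).add j1).sub j2
  have hTe : ∫ d, (1 + ((a * D d : ℝ) : ℂ) * Complex.I - ((a * D d : ℝ) : ℂ) ^ 2 / 2) ∂muS =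
      1 - ((a ^ 2 / 2 * (semiσ' ^ 2 - semiγ ^ z.natAbs) : ℝ) : ℂ) := by
    have j1 : Integrable (fun d => ((a * D d : ℝ) : ℂ) * Complex.I) muS :=
      ((i1.const_mul a).ofReal).mul_const _
    have j2' : Integrable (fun d => ((a ^ 2 / 2 * (hh (zStep z d) - hh z) ^ 2 : ℝ) : ℂ)) muS :=
      (i2.const_mul (a^2/2)).ofReal
    have j0 : Integrable (fun d => (1:ℂ) + ((a * D d : ℝ) : ℂ) * Complex.I) muS :=
      (integrable_const _).add j1
    have : (fun d => (1 + ((a * D d : ℝ) : ℂ) * Complex.I - ((a * D d : ℝ) : ℂ) ^ 2 / 2)) =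
      (fun d => (1 + ((a * D d : ℝ) : ℂ) * Complex.I - ((a ^ 2 / 2 * (hh (zStep z d) - hh z) ^ 2 : ℝ) : ℂ))) := by
      funext d
      simp only [hD]
      push_cast
      ring
    rw [this, integral_sub j0 j2', integral_add (integrable_const _) j1,
      integral_mul_const, integral_complex_ofReal, integral_complex_ofReal, integral_const_mul,
      integral_const_mul, e2, hD, e1]
    simp
  have hfac : ∀ d, Complex.exp (((a * hh (zStep z d) : ℝ) : ℂ) * Complex.I) =
      Complex.exp (((a * hh z : ℝ) : ℂ) * Complex.I) * Complex.exp (((a * D d : ℝ) : ℂ) * Complex.I) := by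
    intro d
    rw [← Complex.exp_add]
    congr 1
    simp only [hD]
    push_cast
    ring
  simp_rw [hfac]
  rw [integral_const_mul, mul_comm (((1 - a ^ 2 * semiσ' ^ 2 / 2 : ℝ) : ℂ)), ← mul_sub, norm_mul,
    Complex.norm_exp_ofReal_mul_I, one_mul]
  have hdiff : ‖∫ d, Complex.exp (((a * D d : ℝ) : ℂ) * Complex.I) ∂muS -
      (1 - ((a ^ 2 / 2 * (semiσ' ^ 2 - semiγ ^ z.natAbs) : ℝ) : ℂ))‖ ≤ 4 * C3 * |a| ^ 3 := by
    rw [← hTe, ← integral_sub hE hT]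
    refine (norm_integral_le_of_norm_le (g := fun d => 4 * |a| ^ 3 * RR d ^ 3)
      (integrable_R3.const_mul _) (Filter.Eventually.of_forall fun d => ?_)).trans ?_
    · refine (exp_bound _).trans ?_
      rw [abs_mul, mul_pow, ← mul_assoc]
      gcongr
      exact abs_delta z d
    · rw [integral_const_mul, ← C3]
      apply le_of_eq; ring
  calc _ = ‖(∫ d, Complex.exp (((a * D d : ℝ) : ℂ) * Complex.I) ∂muS -
      (1 - ((a ^ 2 / 2 * (semiσ' ^ 2 - semiγ ^ z.natAbs) : ℝ) : ℂ))) +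
        ((a ^ 2 / 2 * semiγ ^ z.natAbs : ℝ) : ℂ)‖ := by
        congr 1
        push_cast
        ring
    _ ≤ 4 * C3 * |a| ^ 3 + ‖((a ^ 2 / 2 * semiγ ^ z.natAbs : ℝ) : ℂ)‖ := by
        refine (norm_add_le _ _).trans ?_
        gcongr
    _ ≤ _ := by
        have : 0 ≤ a ^ 2 * semiγ ^ z.natAbs := mul_nonneg (sq_nonneg _) (pow_nonneg sg_pos.le _)
        rw [Complex.norm_real, Real.norm_of_nonneg (by linarith)]
        linarith

/-- characteristic function of `hh (Z_k)` -/
def cc (a : ℝ) (k : ℕ) : ℂ := ∫ z, Complex.exp (((a * hh z : ℝ) : ℂ) * Complex.I) ∂(nuS k)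

lemma cc_step (a : ℝ) (k : ℕ) :
    ‖cc a (k+1) - ((1 - a ^ 2 * semiσ' ^ 2 / 2 : ℝ) : ℂ) * cc a k‖ ≤
      4 * C3 * |a| ^ 3 + a ^ 2 * occ k := by
  have hb : ∀ z : ℤ, ‖Complex.exp (((a * hh z : ℝ) : ℂ) * Complex.I)‖ ≤ 1 :=
    fun z => (Complex.norm_exp_ofReal_mul_I _).le
  unfold cc
  rw [integral_nuS_succ k _ 1 hb, ← integral_const_mul, ← integral_sub]
  · refine (norm_integral_le_of_norm_le (g := fun z : ℤ => 4 * C3 * |a| ^ 3 + a ^ 2 * semiγ ^ z.natAbs)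
      ((integrable_const _).add ((integrable_gpow k).const_mul _))
      (Filter.Eventually.of_forall fun z => char_step a z)).trans ?_
    rw [integral_add (integrable_const _) ((integrable_gpow k).const_mul _), integral_const_mul]
    simp [occ, integral_const_mul]
  · refine Integrable.of_bound (Measurable.aestronglyMeasurable (measurable_of_countable _)) 1 ?_
    refine Filter.Eventually.of_forall fun z => ?_
    refine (norm_integral_le_of_norm_le_const (Filter.Eventually.of_forall fun d => hb _)).trans ?_
    simp
  · refine Integrable.const_mul ?_ _
    refine Integrable.of_bound (Measurable.aestronglyMeasurable (measurable_of_countable _)) 1 ?_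
    exact Filter.Eventually.of_forall hb

lemma cc_bound (a : ℝ) (ha : a ^ 2 * semiσ' ^ 2 ≤ 2) (N : ℕ) :
    ‖cc a N - (((1 - a ^ 2 * semiσ' ^ 2 / 2) ^ N : ℝ) : ℂ)‖ ≤
      ∑ k ∈ Finset.range N, (4 * C3 * |a| ^ 3 + a ^ 2 * occ k) := by
  induction N with
  | zero => simp [cc, nuS, hh]
  | succ N ih =>
    rw [Finset.sum_range_succ]
    set r : ℝ := 1 - a ^ 2 * semiσ' ^ 2 / 2 with hr
    have hr1 : ‖(r:ℂ)‖ ≤ 1 := by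
      rw [Complex.norm_real, Real.norm_eq_abs, abs_le]
      have : 0 ≤ a ^ 2 * semiσ' ^ 2 := by positivity
      constructor <;> linarith
    have : cc a (N+1) - ((r ^ (N+1) : ℝ) : ℂ) =
        (r:ℂ) * (cc a N - ((r ^ N : ℝ) : ℂ)) + (cc a (N+1) - (r:ℂ) * cc a N) := by
      push_cast; ring
    rw [this]
    refine (norm_add_le _ _).trans (add_le_add ?_ (cc_step a N))
    rw [norm_mul]
    refine (mul_le_of_le_one_left (norm_nonneg _) hr1).trans ih

/-! ### Limits -/

/-- scaling factor -/
def bb (n : ℕ) : ℝ := 1 / (semiσ' * Real.sqrt n)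

/-- rescaled law -/
def rho (t : ℝ) (n : ℕ) : Measure ℝ := (nuS ⌊(n:ℝ) * t⌋₊).map (fun z => hh z * bb n)

lemma meas_rho (n : ℕ) : Measurable (fun z : ℤ => hh z * bb n) := measurable_of_countable _

instance (t : ℝ) (n : ℕ) : IsProbabilityMeasure (rho t n) :=
  Measure.isProbabilityMeasure_map (meas_rho n).aemeasurable

lemma charFun_rho (t : ℝ) (n : ℕ) (θ : ℝ) :
    charFun (rho t n) θ = cc (θ * bb n) ⌊(n:ℝ) * t⌋₊ := by
  rw [charFun_apply_real, rho, integral_map (meas_rho n).aemeasurable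
    (by fun_prop), cc]
  congr 1
  funext z
  congr 1
  push_cast
  ring

lemma floor_div (t : ℝ) (ht : 0 < t) :
    Filter.Tendsto (fun n : ℕ => ((⌊(n:ℝ) * t⌋₊ : ℕ) : ℝ) / n) Filter.atTop (nhds t) := by
  have := (tendsto_nat_floor_mul_div_atTop ht.le).comp (tendsto_natCast_atTop_atTop (R := ℝ))
  refine this.congr fun n => ?_
  simp only [Function.comp]
  rw [mul_comm]

lemma pow_limit (t : ℝ) (ht : 0 < t) (c : ℝ) :
    Filter.Tendsto (fun n : ℕ => (1 + c / n) ^ ⌊(n:ℝ) * t⌋₊) Filter.atTop (nhds (Real.exp (t * c))) := by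
  have hn : Filter.Tendsto (fun n : ℕ => (n:ℝ) * (c / n)) Filter.atTop (nhds c) := by
    refine tendsto_const_nhds.congr' ?_
    filter_upwards [Filter.eventually_gt_atTop 0] with n hn
    have : (n:ℝ) ≠ 0 := by positivity
    field_simp
  have h1 := Real.tendsto_nat_mul_log_one_add_of_tendsto hn
  have h2 := Real.continuous_exp.continuousAt.tendsto.comp ((floor_div t ht).mul h1)
  refine h2.congr' ?_
  have h0 : Filter.Tendsto (fun n : ℕ => 1 + c / (n:ℝ)) Filter.atTop (nhds (1 + 0)) :=
    tendsto_const_nhds.add (tendsto_const_div_atTop_nhds_zero_nat c)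
  rw [add_zero] at h0
  filter_upwards [Filter.eventually_gt_atTop 0, h0.eventually (lt_mem_nhds zero_lt_one)] with n hn hpos
  simp only [Function.comp]
  have : (n:ℝ) ≠ 0 := by positivity
  rw [← mul_assoc, div_mul_cancel₀ _ this, Real.exp_nat_mul, Real.exp_log hpos]

lemma bb_sq (n : ℕ) (hn : 0 < n) : bb n ^ 2 * semiσ' ^ 2 = 1 / n := by
  have h := ss_pos
  have hn' : (0:ℝ) < n := by exact_mod_cast hn
  have hs : 0 < Real.sqrt n := Real.sqrt_pos.2 hn'
  have := Real.sq_sqrt hn'.le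
  rw [bb, div_pow, mul_pow, this]
  field_simp

lemma cc_limit (t : ℝ) (ht : 0 < t) (θ : ℝ) :
    Filter.Tendsto (fun n : ℕ => cc (θ * bb n) ⌊(n:ℝ) * t⌋₊) Filter.atTop
      (nhds ((Real.exp (t * (-θ^2/2)) : ℝ) : ℂ)) := by
  have hs := ss_pos
  have hg := sg_pos
  set K : ℝ := (semiσ' ^ 2 + 1) / (2 * semiγ) with hK
  set B : ℝ := 4 * C3 * t * |θ| ^ 3 / semiσ' ^ 3 + θ ^ 2 / semiσ' ^ 2 * K * Real.sqrt t with hB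
  have h1 : Filter.Tendsto (fun n : ℕ => (((1 + (-θ^2/2) / n) ^ ⌊(n:ℝ) * t⌋₊ : ℝ) : ℂ)) Filter.atTop
      (nhds ((Real.exp (t * (-θ^2/2)) : ℝ) : ℂ)) :=
    (Complex.continuous_ofReal.tendsto _).comp (pow_limit t ht _)
  have h2 : Filter.Tendsto (fun n : ℕ => B * (Real.sqrt n)⁻¹) Filter.atTop (nhds 0) := by
    have : Filter.Tendsto (fun n : ℕ => (Real.sqrt n)⁻¹) Filter.atTop (nhds 0) :=
      tendsto_inv_atTop_zero.comp (Real.tendsto_sqrt_atTop.comp tendsto_natCast_atTop_atTop)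
    simpa using this.const_mul B
  have h3 : Filter.Tendsto (fun n : ℕ => cc (θ * bb n) ⌊(n:ℝ) * t⌋₊ -
      (((1 + (-θ^2/2) / n) ^ ⌊(n:ℝ) * t⌋₊ : ℝ) : ℂ)) Filter.atTop (nhds 0) := by
    refine squeeze_zero_norm' ?_ h2
    have hbig : ∀ᶠ n : ℕ in Filter.atTop, θ ^ 2 ≤ (n:ℝ) :=
      tendsto_natCast_atTop_atTop.eventually_ge_atTop _
    filter_upwards [Filter.eventually_gt_atTop 0, hbig] with n hn hbn
    have hn' : (0:ℝ) < n := by exact_mod_cast hn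
    have hsn : 0 < Real.sqrt n := Real.sqrt_pos.2 hn'
    have hsq : Real.sqrt n ^ 2 = n := Real.sq_sqrt hn'.le
    set N := ⌊(n:ℝ) * t⌋₊ with hN
    have hNle : (N:ℝ) ≤ n * t := Nat.floor_le (by positivity)
    have ha : (θ * bb n) ^ 2 * semiσ' ^ 2 = θ ^ 2 / n := by
      rw [mul_pow, mul_assoc, bb_sq n hn]; ring
    have hb := cc_bound (θ * bb n) (by
      rw [ha, div_le_iff₀ hn']; linarith) N
    have e : 1 + (-θ^2/2) / (n:ℝ) = 1 - (θ * bb n) ^ 2 * semiσ' ^ 2 / 2 := by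
      rw [ha]; ring
    rw [e]
    refine hb.trans ?_
    rw [Finset.sum_add_distrib, Finset.sum_const, Finset.card_range, nsmul_eq_mul, ← Finset.mul_sum]
    have hocc : ∑ k ∈ Finset.range N, occ k ≤ K * (Real.sqrt n * Real.sqrt t) := by
      rcases Nat.eq_zero_or_pos N with h0 | h0
      · rw [h0]; simp; positivity
      · have := occ_le N h0
        have h4 : Real.sqrt N ≤ Real.sqrt n * Real.sqrt t := by
          rw [← Real.sqrt_mul hn'.le]; exact Real.sqrt_le_sqrt hNle
        rw [hK, div_mul_eq_mul_div, le_div_iff₀ (by positivity)]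
        calc _ = 2 * semiγ * ∑ k ∈ Finset.range N, occ k := by ring
          _ ≤ _ := this
          _ ≤ _ := by gcongr
    have hC := C3_nonneg
    have hbb : 0 ≤ bb n := by unfold bb; positivity
    calc _ ≤ (n * t) * (4 * C3 * |θ * bb n| ^ 3) + (θ * bb n) ^ 2 * (K * (Real.sqrt n * Real.sqrt t)) := by
          gcongr
      _ = _ := by
          rw [abs_mul, abs_of_nonneg hbb, hB, bb]
          rw [show (n:ℝ) = Real.sqrt n ^ 2 from hsq.symm]
          rw [Real.sqrt_sq hsn.le]
          field_simp
  have := h3.add h1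
  simpa using this

/-- rescaled law, bundled -/
def rhoP (t : ℝ) (n : ℕ) : ProbabilityMeasure ℝ := ⟨rho t n, inferInstance⟩

/-- limiting law, bundled -/
def gaussP (t : ℝ) : ProbabilityMeasure ℝ :=
  ⟨ProbabilityTheory.gaussianReal 0 t.toNNReal, inferInstance⟩

lemma rho_limit (t : ℝ) (ht : 0 < t) :
    Filter.Tendsto (rhoP t) Filter.atTop (nhds (gaussP t)) := by
  apply ProbabilityMeasure.tendsto_of_tendsto_charFun
  intro θ
  simp only [rhoP, gaussP, ProbabilityMeasure.coe_mk, charFun_rho, ProbabilityTheory.charFun_gaussianReal]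
  convert! cc_limit t ht θ using 2
  push_cast
  congr 1
  simp [Real.coe_toNNReal t ht.le]
  ring

lemma indicator_limit {μs : ℕ → ProbabilityMeasure ℝ} {μ : ProbabilityMeasure ℝ}
    (h : Filter.Tendsto μs Filter.atTop (nhds μ)) (φ : ℝ → ℝ) (hc : Continuous φ)
    (C : ℝ) (hC : ∀ x, ‖φ x‖ ≤ C) (S : Set ℝ) (hS : MeasurableSet S) (r : ℝ → ℝ) (hr : Continuous r)
    (h1 : ∀ x ∈ S, r x = x) (h2 : ∀ x ∉ S, r x = 0) (hf : (μ : Measure ℝ) (frontier S) = 0) :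
    Filter.Tendsto (fun n => ∫ x, S.indicator φ x ∂(μs n : Measure ℝ)) Filter.atTop
      (nhds (∫ x, S.indicator φ x ∂(μ : Measure ℝ))) := by
  let F : BoundedContinuousFunction ℝ ℝ := BoundedContinuousFunction.ofNormedAddCommGroup
    (fun x => φ (r x) - φ 0) (by fun_prop) (C + C)
    (fun x => (norm_sub_le _ _).trans (add_le_add (hC _) (hC _)))
  have key : ∀ P : ProbabilityMeasure ℝ, ∫ x, S.indicator φ x ∂(P : Measure ℝ) =
      ∫ x, F x ∂(P : Measure ℝ) + φ 0 * (P : Measure ℝ).real S := by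
    intro P
    have e : S.indicator φ = fun x => F x + S.indicator (fun _ => φ 0) x := by
      funext x
      have : F x = φ (r x) - φ 0 := rfl
      rw [this]
      by_cases hx : x ∈ S
      · rw [Set.indicator_of_mem hx, Set.indicator_of_mem hx, h1 x hx]; ring
      · rw [Set.indicator_of_notMem hx, Set.indicator_of_notMem hx, h2 x hx]; ring
    rw [e, integral_add (F.integrable _) ((integrable_const _).indicator hS),
      integral_indicator_const _ hS, smul_eq_mul, mul_comm (φ 0)]
  simp_rw [key]
  refine ((ProbabilityMeasure.tendsto_iff_forall_integral_tendsto.1 h) F).add (Filter.Tendsto.const_mul _ ?_)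
  have := ProbabilityMeasure.tendsto_measure_of_null_frontier_of_tendsto' h hf
  exact (ENNReal.tendsto_toReal (measure_ne_top _ _)).comp this

lemma gauss_indicator (t : ℝ) (ht : 0 < t) (φ : ℝ → ℝ) (S : Set ℝ) (hS : MeasurableSet S) :
    ∫ x, S.indicator φ x ∂(gaussP t : Measure ℝ) =
      (1/2) * ∫ y in S, φ y * (2 * Real.exp (-(y^2) / (2*t)) / Real.sqrt (2 * Real.pi * t)) := by
  rw [gaussP, ProbabilityMeasure.coe_mk, ProbabilityTheory.integral_gaussianReal_eq_integral_smul
    (Real.toNNReal_pos.2 ht).ne', ← integral_const_mul, ← integral_indicator hS]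
  congr 1
  funext x
  by_cases hx : x ∈ S
  · rw [Set.indicator_of_mem hx, Set.indicator_of_mem hx, ProbabilityTheory.gaussianPDFReal]
    simp only [Real.coe_toNNReal t ht.le, sub_zero, smul_eq_mul]
    ring
  · rw [Set.indicator_of_notMem hx, Set.indicator_of_notMem hx, smul_zero]

lemma bb_pos (n : ℕ) (hn : 0 < n) : 0 < bb n := by
  have := ss_pos
  unfold bb; positivity

lemma Eplus_eq (t : ℝ) (φ : ℝ → ℝ) (hφ0 : ∀ x, 0 ≤ φ x) (hφ : Continuous φ) (n : ℕ) (hn : 0 < n) :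
    EplusSemi t φ n = ∫ x, (Set.Ioi (0:ℝ)).indicator φ x ∂(rho t n) := by
  have := tsum_eq_integral ⌊(n:ℝ) * t⌋₊
    (fun z => if 0 < z then φ ((z:ℝ) / (semiσ' * Real.sqrt n)) else 0)
    (fun z => by split_ifs <;> simp [hφ0])
  rw [EplusSemi, this, rho, integral_map (meas_rho n).aemeasurable
    (hφ.measurable.indicator measurableSet_Ioi).aestronglyMeasurable]
  congr 1
  funext z
  have hb := bb_pos n hn
  have hg := sg_pos
  by_cases hz : 0 < z
  · have hz' : (0:ℝ) < z := by exact_mod_cast hz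
    rw [if_pos hz, hh_pos hz, Set.indicator_of_mem (Set.mem_Ioi.2 (by positivity)), bb, mul_one_div]
  · rw [if_neg hz, Set.indicator_of_notMem]
    have hz' : (z:ℝ) ≤ 0 := by exact_mod_cast (not_lt.1 hz)
    rw [Set.mem_Ioi, not_lt]
    refine mul_nonpos_of_nonpos_of_nonneg ?_ hb.le
    unfold hh
    split_ifs
    · exact hz'
    · exact mul_nonpos_of_nonneg_of_nonpos hg.le hz'

lemma Eminus_eq (t : ℝ) (φ : ℝ → ℝ) (hφ0 : ∀ x, 0 ≤ φ x) (hφ : Continuous φ) (n : ℕ) (hn : 0 < n) :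
    EminusSemi t φ n = ∫ x, (Set.Iio (0:ℝ)).indicator φ x ∂(rho t n) := by
  have := tsum_eq_integral ⌊(n:ℝ) * t⌋₊
    (fun z => if z < 0 then φ ((z:ℝ) / (semiσ * Real.sqrt n)) else 0)
    (fun z => by split_ifs <;> simp [hφ0])
  rw [EminusSemi, this, rho, integral_map (meas_rho n).aemeasurable
    (hφ.measurable.indicator measurableSet_Iio).aestronglyMeasurable]
  congr 1
  funext z
  have hb := bb_pos n hn
  have hg := sg_pos
  by_cases hz : z < 0
  · have hz' : (z:ℝ) < 0 := by exact_mod_cast hz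
    have e : semiγ * z * bb n = (z:ℝ) / (semiσ * Real.sqrt n) := by
      rw [bb, ss_eq, mul_one_div, mul_assoc semiγ semiσ, mul_div_mul_left _ _ hg.ne']
    rw [if_pos hz, hh_neg hz, Set.indicator_of_mem, e]
    exact mul_neg_of_neg_of_pos (mul_neg_of_pos_of_neg hg hz') hb
  · rw [if_neg hz, Set.indicator_of_notMem]
    have hz' : (0:ℝ) ≤ z := by exact_mod_cast (not_lt.1 hz)
    rw [Set.mem_Iio, not_lt, hh, if_pos (not_lt.1 hz)]
    positivity

/-- one-dimensional marginal convergence of the rescaled chain `Z̄`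
towards a standard Brownian motion (a skew Brownian motion of parameter `q = 1/2`). -/
theorem semi_baxter_brownian_marginals
    (t : ℝ) (ht : 0 < t) (φ : ℝ → ℝ) (hφ0 : ∀ x, 0 ≤ φ x)
    (hφlip : ∃ K, LipschitzWith K φ) (hφsupp : HasCompactSupport φ) :
    Filter.Tendsto (fun n : ℕ => EplusSemi t φ n) Filter.atTop
      (nhds ((1/2) * ∫ y in Set.Ioi (0:ℝ),
        φ y * (2 * Real.exp (-(y^2) / (2*t)) / Real.sqrt (2 * Real.pi * t)))) ∧
    Filter.Tendsto (fun n : ℕ => EminusSemi t φ n) Filter.atTop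
      (nhds ((1/2) * ∫ y in Set.Iio (0:ℝ),
        φ y * (2 * Real.exp (-(y^2) / (2*t)) / Real.sqrt (2 * Real.pi * t)))) := by
  have hc : Continuous φ := hφlip.choose_spec.continuous
  obtain ⟨C, hC⟩ := hφsupp.exists_bound_of_continuous hc
  have hlim := rho_limit t ht
  have hna : NullSingletonClass (gaussP t : Measure ℝ) :=
    ProbabilityTheory.nullSingletonClass_gaussianReal (Real.toNNReal_pos.2 ht).ne'
  constructor
  · rw [← gauss_indicator t ht φ _ measurableSet_Ioi]
    have := indicator_limit hlim φ hc C hC (Set.Ioi 0) measurableSet_Ioi (fun x => max x 0)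
      (by fun_prop) (fun x hx => max_eq_left (le_of_lt hx)) (fun x hx => max_eq_right (not_lt.1 hx))
      (by rw [frontier_Ioi]; exact measure_singleton _)
    refine this.congr' ?_
    filter_upwards [Filter.eventually_gt_atTop 0] with n hn
    exact (Eplus_eq t φ hφ0 hc n hn).symm
  · rw [← gauss_indicator t ht φ _ measurableSet_Iio]
    have := indicator_limit hlim φ hc C hC (Set.Iio 0) measurableSet_Iio (fun x => min x 0)
      (by fun_prop) (fun x hx => min_eq_left (le_of_lt hx)) (fun x hx => min_eq_right (not_lt.1 hx))
      (by rw [frontier_Iio]; exact measure_singleton _)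
    refine this.congr' ?_
    filter_upwards [Filter.eventually_gt_atTop 0] with n hn
    exact (Eminus_eq t φ hφ0 hc n hn).symm
end
end

section
/- Let (←W_n(i))_{i≥1} be the random walk with ←W_n(1) distributed as ν^n_Sb and i.i.d. increments of law ←μ_Sb, and let W_n be its reversal, W_n(i) := ←W_n(n+1−i). Then the conditional law of the endpoint W_n(n), given the event {(W_n(i))_{i∈[n]} ∈ W^n_Sb}, is tight, uniformly in n: Σ_{(h,ℓ)∈ℤ²_{≥0}} liminf_{n→∞} P( W_n(n) = (h,ℓ) | (W_n(i))_{i∈[n]} ∈ W^n_Sb ) = 1. -/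
attribute [local instance] Classical.propDecidable

noncomputable section

/-- `θ` as a polynomial in `γ`. -/
def sbθ (γ : ℝ) : ℝ := -7 + 18*γ - 14*γ^2 + 11*γ^3 - 3*γ^4

/-- `α` as a polynomial in `γ`. -/
def sbα (γ : ℝ) : ℝ := 36/11 - (83/11)*γ + (61/11)*γ^2 - 4*γ^3 + (12/11)*γ^4

/-- The increment set `I_Sb = {(-i,0) : i ≥ 1} ∪ {(0,1)} ∪ {(1,-i) : i ≥ 0}`. -/
def ISb : Set (ℤ × ℤ) :=
  {d | (d.1 < 0 ∧ d.2 = 0) ∨ d = (0, 1) ∨ (d.1 = 1 ∧ d.2 ≤ 0)}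

/-- `W^n_Sb`: `n`-point walks in `ℤ²_{≥0}` starting at `(0,0)` with increments in `I_Sb`. -/
def IsWalkSb (n : ℕ) (W : ℕ → ℤ × ℤ) : Prop :=
  W 0 = (0, 0) ∧ (∀ k, k < n → 0 ≤ (W k).1 ∧ 0 ≤ (W k).2) ∧
    ∀ k, k + 1 < n → W (k+1) - W k ∈ ISb

/-- The reversed step distribution `←μ_Sb`:
`(i,0) ↦ αγ^i` for `i ≥ 1`, `(0,-1) ↦ αθ⁻¹` and `(-1,i) ↦ αγ⁻¹θ^i` for `i ≥ 0`. -/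
def revWSb (γ : ℝ) (d : ℤ × ℤ) : ℝ :=
  if 0 < d.1 ∧ d.2 = 0 then sbα γ * γ ^ d.1.toNat
  else if d = (0, -1) then sbα γ * (sbθ γ)⁻¹
  else if d.1 = -1 ∧ 0 ≤ d.2 then sbα γ * γ⁻¹ * (sbθ γ) ^ d.2.toNat
  else 0

/-- The normalizing constant `Z_n = Σ_{(h,ℓ) ∈ L^n_Sb} γ^h θ^ℓ`, where `L^n_Sb` is the
set of endpoints of walks in `W^n_Sb`. -/
def ZSb (γ : ℝ) (n : ℕ) : ℝ :=
  ∑' p : ℤ × ℤ, if ∃ W : ℕ → ℤ × ℤ, IsWalkSb n W ∧ W (n - 1) = p then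
    γ ^ p.1.toNat * (sbθ γ) ^ p.2.toNat else 0

/-- The initial distribution `ν^n_Sb(h,ℓ) = γ^h θ^ℓ / Z_n` on `L^n_Sb`. -/
def νSb (γ : ℝ) (n : ℕ) (p : ℤ × ℤ) : ℝ :=
  (if ∃ W : ℕ → ℤ × ℤ, IsWalkSb n W ∧ W (n - 1) = p then
    γ ^ p.1.toNat * (sbθ γ) ^ p.2.toNat else 0) / ZSb γ n

/-- The walk started at `s` with increments `f`. -/
def pathFrom (s : ℤ × ℤ) (f : ℕ → ℤ × ℤ) : ℕ → ℤ × ℤ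
  | 0 => s
  | k + 1 => pathFrom s f k + f k

/-- Probability of an event determined by the first `n` points of the random walk
`←W_n`, whose first point has law `ν^n_Sb` and whose increments are i.i.d. of law
`←μ_Sb`. -/
def probPathSb (γ : ℝ) (n : ℕ) (E : (ℕ → ℤ × ℤ) → Prop) : ℝ :=
  ∑' s : ℤ × ℤ, ∑' g : Fin (n - 1) → ℤ × ℤ,
    if E (pathFrom s (extFin g)) then νSb γ n s * ∏ i, revWSb γ (g i) else 0

/-- `P(W_n(n) = p | (W_n(i))_{i∈[n]} ∈ W^n_Sb)`, where `W_n(i) := ←W_n(n+1-i)` is the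
reversal of `←W_n`; note that `W_n(n) = ←W_n(1)` is the first point of `←W_n`. -/
def condEndpointProb (γ : ℝ) (n : ℕ) (p : ℤ × ℤ) : ℝ :=
  probPathSb γ n (fun x => IsWalkSb n (fun k => x (n - 1 - k)) ∧ x 0 = p) /
    probPathSb γ n (fun x => IsWalkSb n (fun k => x (n - 1 - k)))

namespace SBx

open Filter Topology

/-- functions on the quadrant -/
abbrev Fn := ℕ × ℕ → ℝ

def dW (f : Fn) : Fn
  | (0, _) => 0
  | (i+1, j) => f (i, j) + f (i, j+1)

def dS (f : Fn) : Fn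
  | (_, 0) => 0
  | (i, j+1) => f (i, j)

/-- The loop-free small step operator. -/
def B0 : Module.End ℝ Fn where
  toFun f := fun p => f (p.1+1, p.2) + f (p.1, p.2+1) + dW f p + dS f p
  map_add' f g := by
    funext p
    obtain ⟨i, j⟩ := p
    cases i <;> cases j <;> simp [dW, dS] <;> ring
  map_smul' c f := by
    funext p
    obtain ⟨i, j⟩ := p
    cases i <;> cases j <;> simp [dW, dS] <;> ring

def B : Module.End ℝ Fn := (2 : ℝ) • 1 + B0

theorem B_apply (f : Fn) (p : ℕ × ℕ) :
    B f p = 2 * f p + (f (p.1+1, p.2) + f (p.1, p.2+1) + dW f p + dS f p) := by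
  simp [B, B0]

theorem dW_mono {f g : Fn} (h : f ≤ g) : dW f ≤ dW g := by
  rintro ⟨i, j⟩
  cases i
  · simp [dW]
  · exact add_le_add (h _) (h _)

theorem dS_mono {f g : Fn} (h : f ≤ g) : dS f ≤ dS g := by
  rintro ⟨i, j⟩
  cases j
  · simp [dS]
  · exact (h _)

theorem B0_mono {f g : Fn} (h : f ≤ g) : B0 f ≤ B0 g := by
  intro p
  exact add_le_add (add_le_add (add_le_add (h _) (h _)) (dW_mono h p)) (dS_mono h p)

theorem B_mono {f g : Fn} (h : f ≤ g) : B f ≤ B g := by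
  intro p
  rw [B_apply, B_apply]
  have h1 := h p
  have h2 : B0 f p ≤ B0 g p := B0_mono h p
  have e1 : B0 f p = (f (p.1+1, p.2) + f (p.1, p.2+1) + dW f p + dS f p) := rfl
  have e2 : B0 g p = (g (p.1+1, p.2) + g (p.1, p.2+1) + dW g p + dS g p) := rfl
  have : f p ≤ g p := h1
  linarith

theorem dW_nonneg {f : Fn} (h : 0 ≤ f) (p) : 0 ≤ dW f p := by
  obtain ⟨i, j⟩ := p
  cases i
  · simp [dW]
  · exact add_nonneg (h _) (h _)

theorem dS_nonneg {f : Fn} (h : 0 ≤ f) (p) : 0 ≤ dS f p := by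
  obtain ⟨i, j⟩ := p
  cases j
  · simp [dS]
  · exact (h _)

theorem B0_nonneg {f : Fn} (h : 0 ≤ f) : 0 ≤ B0 f := by
  have := B0_mono h
  simpa using this

theorem B0_pow_nonneg {f : Fn} (h : 0 ≤ f) (n : ℕ) : 0 ≤ (B0 ^ n) f := by
  induction n with
  | zero => simpa using h
  | succ n ih => rw [pow_succ', Module.End.mul_apply]; exact B0_nonneg ih

theorem B_tendsto {ι : Type*} {l : Filter ι} {f : ι → Fn} {g : Fn}
    (h : ∀ p, Tendsto (fun n => f n p) l (𝓝 (g p))) (p : ℕ × ℕ) :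
    Tendsto (fun n => B (f n) p) l (𝓝 (B g p)) := by
  simp only [B_apply]
  have hW : Tendsto (fun n => dW (f n) p) l (𝓝 (dW g p)) := by
    obtain ⟨i, j⟩ := p
    cases i
    · simp only [dW]; exact tendsto_const_nhds
    · exact (h _).add (h _)
  have hS : Tendsto (fun n => dS (f n) p) l (𝓝 (dS g p)) := by
    obtain ⟨i, j⟩ := p
    cases j
    · simp only [dS]; exact tendsto_const_nhds
    · exact (h _)
  exact ((h p).const_mul 2).add ((((h _).add (h _)).add hW).add hS)

/-- normalised operator -/
def P (R : ℝ) : Module.End ℝ Fn := R⁻¹ • B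

theorem P_apply (R : ℝ) (f : Fn) (p) : P R f p = R⁻¹ * B f p := by
  simp [P]

theorem P_mono {R : ℝ} (hR : 0 < R) {f g : Fn} (h : f ≤ g) : P R f ≤ P R g := by
  intro p
  rw [P_apply, P_apply]
  exact mul_le_mul_of_nonneg_left (B_mono h p) (inv_nonneg.2 hR.le)

theorem Pn_mono {R : ℝ} (hR : 0 < R) {f g : Fn} (h : f ≤ g) (n : ℕ) :
    (P R ^ n) f ≤ (P R ^ n) g := by
  induction n with
  | zero => simpa using h
  | succ n ih => rw [pow_succ', Module.End.mul_apply, Module.End.mul_apply]; exact P_mono hR ih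

theorem Pn_fix {R : ℝ} {f : Fn} (h : P R f = f) (n : ℕ) : (P R ^ n) f = f := by
  induction n with
  | zero => simp
  | succ n ih => rw [pow_succ', Module.End.mul_apply, ih, h]

theorem Pn_nonneg {R : ℝ} (hR : 0 < R) {f : Fn} (h : 0 ≤ f) (n : ℕ) : 0 ≤ (P R ^ n) f := by
  have := Pn_mono hR h n
  simpa using this

theorem limit_harm {R : ℝ} {f g : Fn}
    (h : ∀ p, Tendsto (fun n => (P R ^ n) f p) atTop (𝓝 (g p))) : P R g = g := by
  funext p
  have h1 : Tendsto (fun n => (P R ^ (n+1)) f p) atTop (𝓝 (P R g p)) := by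
    simp only [pow_succ', Module.End.mul_apply, P_apply]
    exact (B_tendsto h p).const_mul _
  exact tendsto_nhds_unique h1 ((h p).comp (tendsto_add_atTop_nat 1))

theorem exists_limit_super {R : ℝ} (hR : 0 < R) {f : Fn} (h0 : 0 ≤ f) (h : P R f ≤ f) :
    ∃ g : Fn, (∀ p, Tendsto (fun n => (P R ^ n) f p) atTop (𝓝 (g p))) ∧ P R g = g ∧
      0 ≤ g ∧ g ≤ f := by
  have anti : ∀ p, Antitone (fun n => (P R ^ n) f p) := fun p =>
    antitone_nat_of_succ_le (fun n => by
      rw [pow_succ, Module.End.mul_apply]; exact Pn_mono hR h n p)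
  have bdd : ∀ p, BddBelow (Set.range (fun n => (P R ^ n) f p)) := fun p =>
    ⟨0, by rintro _ ⟨n, rfl⟩; exact Pn_nonneg hR h0 n p⟩
  refine ⟨fun p => ⨅ n, (P R ^ n) f p, fun p => tendsto_atTop_ciInf (anti p) (bdd p), ?_, ?_, ?_⟩
  · exact limit_harm (f := f) fun p => tendsto_atTop_ciInf (anti p) (bdd p)
  · intro p; exact le_ciInf (fun n => Pn_nonneg hR h0 n p)
  · intro p; exact (ciInf_le (bdd p) 0).trans (by simp)

theorem exists_limit_sub {R : ℝ} (hR : 0 < R) {f V : Fn} (hV : P R V = V) (hfV : f ≤ V)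
    (h : f ≤ P R f) :
    ∃ g : Fn, (∀ p, Tendsto (fun n => (P R ^ n) f p) atTop (𝓝 (g p))) ∧ P R g = g ∧
      f ≤ g ∧ g ≤ V := by
  have mono : ∀ p, Monotone (fun n => (P R ^ n) f p) := fun p =>
    monotone_nat_of_le_succ (fun n => by
      rw [pow_succ, Module.End.mul_apply]; exact Pn_mono hR h n p)
  have up : ∀ n p, (P R ^ n) f p ≤ V p := fun n p => by
    have := Pn_mono hR hfV n p
    rwa [Pn_fix hV] at this
  have bdd : ∀ p, BddAbove (Set.range (fun n => (P R ^ n) f p)) := fun p =>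
    ⟨V p, by rintro _ ⟨n, rfl⟩; exact up n p⟩
  refine ⟨fun p => ⨆ n, (P R ^ n) f p, fun p => tendsto_atTop_ciSup (mono p) (bdd p), ?_, ?_, ?_⟩
  · exact limit_harm (f := f) fun p => tendsto_atTop_ciSup (mono p) (bdd p)
  · intro p; exact le_trans (by simp) (le_ciSup (bdd p) 0)
  · intro p; exact ciSup_le (fun n => up n p)

/-- neighbour inequalities for nonnegative superharmonic functions -/
theorem nbr {R : ℝ} (hR : 0 < R) {f : Fn} (h0 : 0 ≤ f) (h : P R f ≤ f) (i j : ℕ) :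
    f (i+1, j) ≤ R * f (i, j) ∧ f (i, j+1) ≤ R * f (i, j) ∧
    f (i, j) ≤ R * f (i+1, j) ∧ f (i, j) ≤ R * f (i, j+1) := by
  have key : ∀ p, B f p ≤ R * f p := fun p => by
    have := h p
    rw [P_apply, inv_mul_le_iff₀ hR] at this
    exact this
  have n0 : ∀ p, 0 ≤ f p := fun p => h0 p
  have k1 := key (i, j)
  have k2 := key (i+1, j)
  have k3 := key (i, j+1)
  rw [B_apply] at k1 k2 k3
  have a1 := dW_nonneg h0 (i, j)
  have a2 := dS_nonneg h0 (i, j)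
  have a3 := dS_nonneg h0 (i+1, j)
  have a4 := dW_nonneg h0 (i, j+1)
  simp only [dW] at k2
  simp only [dS] at k3
  refine ⟨?_, ?_, ?_, ?_⟩
  · linarith [n0 (i, j), n0 (i, j+1)]
  · linarith [n0 (i, j), n0 (i+1, j)]
  · linarith [n0 (i+1, j), n0 (i+1+1, j), n0 (i+1, j+1), n0 (i, j+1)]
  · have := n0 (i, j+1); have := n0 (i+1, j+1); have := n0 (i, j+1+1)
    simp only at *
    linarith

theorem harm_le {R : ℝ} (hR : 0 < R) {f : Fn} (h0 : 0 ≤ f) (h : P R f = f) (i j : ℕ) :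
    f (i, j) ≤ R ^ (i + j) * f (0, 0) := by
  have col : ∀ j, f (0, j) ≤ R ^ j * f (0, 0) := by
    intro j
    induction j with
    | zero => simp
    | succ j ih =>
      have := (nbr hR h0 h.le 0 j).2.1
      calc f (0, j+1) ≤ R * f (0, j) := this
        _ ≤ R * (R ^ j * f (0, 0)) := mul_le_mul_of_nonneg_left ih hR.le
        _ = _ := by ring
  induction i with
  | zero => simpa using col j
  | succ i ih =>
    calc f (i+1, j) ≤ R * f (i, j) := (nbr hR h0 h.le i j).1
      _ ≤ R * (R ^ (i + j) * f (0, 0)) := mul_le_mul_of_nonneg_left ih hR.le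
      _ = _ := by ring

theorem harm_zero {R : ℝ} (hR : 0 < R) {f : Fn} (h0 : 0 ≤ f) (h : P R f = f)
    (hz : f (0, 0) = 0) : f = 0 := by
  funext p
  obtain ⟨i, j⟩ := p
  have := harm_le hR h0 h i j
  rw [hz, mul_zero] at this
  exact le_antisymm this (h0 _)

theorem harm_pos {R : ℝ} (hR : 0 < R) {f : Fn} (h0 : 0 ≤ f) (h : P R f = f)
    (hz : 0 < f (0, 0)) (p : ℕ × ℕ) : 0 < f p := by
  obtain ⟨i, j⟩ := p
  have col : ∀ j, 0 < f (0, j) := by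
    intro j
    induction j with
    | zero => exact hz
    | succ j ih =>
      have := (nbr hR h0 h.le 0 j).2.2.2
      exact pos_of_mul_pos_right (lt_of_lt_of_le ih this) hR.le
  induction i with
  | zero => exact col j
  | succ i ih =>
    have := (nbr hR h0 h.le i j).2.2.1
    exact pos_of_mul_pos_right (lt_of_lt_of_le ih this) hR.le

end SBx

namespace SBx

open Filter Topology

def sE (f : Fn) : Fn := fun p => f (p.1+1, p.2)
def sN (f : Fn) : Fn := fun p => f (p.1, p.2+1)

def IsMin (R : ℝ) (V : Fn) : Prop :=
  0 ≤ V ∧ V (0, 0) = 1 ∧ P R V = V ∧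
    ∀ g : Fn, 0 ≤ g → g ≤ V → P R g = g → g = g (0, 0) • V

theorem B_sE (f : Fn) (i j : ℕ) :
    B f (i+1, j) = B (sE f) (i, j) + (if i = 0 then f (0, j) + f (0, j+1) else 0) := by
  rw [B_apply, B_apply]
  cases i <;> cases j <;> simp [dW, dS, sE] <;> ring

theorem B_sN (f : Fn) (i j : ℕ) :
    B f (i, j+1) = B (sN f) (i, j) + (if j = 0 then f (i, 0) else 0) := by
  rw [B_apply, B_apply]
  cases i <;> cases j <;> simp [dW, dS, sN] <;> ring

/-- if `W` has nonnegative trace on the `y`-axis and is superharmonic, then its shift is. -/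
theorem sE_super {R : ℝ} (hR : 0 < R) {W : Fn} (h : P R W ≤ W) (ht : ∀ j, 0 ≤ W (0, j)) :
    P R (sE W) ≤ sE W := by
  rintro ⟨i, j⟩
  have h1 := h (i+1, j)
  rw [P_apply, B_sE] at h1
  rw [P_apply]
  refine le_trans ?_ h1
  apply mul_le_mul_of_nonneg_left _ (inv_nonneg.2 hR.le)
  have : 0 ≤ (if i = 0 then W (0, j) + W (0, j+1) else 0) := by
    split_ifs
    · exact add_nonneg (ht _) (ht _)
    · exact le_rfl
  linarith

theorem sN_super {R : ℝ} (hR : 0 < R) {W : Fn} (h : P R W ≤ W) (ht : ∀ j, 0 ≤ W (j, 0)) :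
    P R (sN W) ≤ sN W := by
  rintro ⟨i, j⟩
  have h1 := h (i, j+1)
  rw [P_apply, B_sN] at h1
  rw [P_apply]
  refine le_trans ?_ h1
  apply mul_le_mul_of_nonneg_left _ (inv_nonneg.2 hR.le)
  have : 0 ≤ (if j = 0 then W (i, 0) else 0) := by
    split_ifs
    · exact ht _
    · exact le_rfl
  linarith

def Lim (R : ℝ) (V f : Fn) (x : ℝ) : Prop :=
  ∀ p, Tendsto (fun n => (P R ^ n) f p) atTop (𝓝 (x * V p))

theorem Lim.add {R : ℝ} {V f g : Fn} {x y : ℝ} (hf : Lim R V f x) (hg : Lim R V g y) :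
    Lim R V (f + g) (x + y) := by
  intro p
  simp only [map_add, Pi.add_apply, add_mul]
  exact (hf p).add (hg p)

theorem Lim.smul {R : ℝ} {V f : Fn} {x : ℝ} (c : ℝ) (hf : Lim R V f x) :
    Lim R V (c • f) (c * x) := by
  intro p
  simp only [map_smul, Pi.smul_apply, smul_eq_mul, mul_assoc]
  exact (hf p).const_mul c

theorem Lim.unique {R : ℝ} {V f : Fn} {x y : ℝ} (hV : V (0,0) = 1) (hf : Lim R V f x)
    (hg : Lim R V f y) : x = y := by
  have := tendsto_nhds_unique (hf (0,0)) (hg (0,0))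
  simpa [hV] using this

theorem exists_c {R : ℝ} (hR : 0 < R) {V f : Fn} (hV : IsMin R V) (h0 : 0 ≤ f)
    (h : P R f ≤ f) (hfV : f ≤ R • V) : ∃ x, Lim R V f x := by
  obtain ⟨g, h1, h2, h3, h4⟩ := exists_limit_super hR h0 h
  have hg : R⁻¹ • g = (R⁻¹ • g) (0, 0) • V := by
    refine hV.2.2.2 _ ?_ ?_ ?_
    · intro p; exact mul_nonneg (inv_nonneg.2 hR.le) (h3 p)
    · intro p
      have := (h4 p).trans (hfV p)
      simp only [Pi.smul_apply, smul_eq_mul] at this ⊢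
      rwa [inv_mul_le_iff₀ hR]
    · rw [map_smul, h2]
  refine ⟨g (0, 0), fun p => ?_⟩
  have e : g p = g (0, 0) * V p := by
    have := congrFun hg p
    simp only [Pi.smul_apply, smul_eq_mul] at this
    field_simp at this
    exact this
  rw [← e]; exact h1 p

/-- Composition of shifts. -/
theorem Lim.shift {R : ℝ} (hR : 0 < R) {V f : Fn} {x c : ℝ} (s : Fn → Fn)
    (hsadd : ∀ f g, s (f + g) = s f + s g) (hssmul : ∀ (c : ℝ) f, s (c • f) = c • s f)
    (hspos : ∀ f, 0 ≤ f → 0 ≤ s f)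
    (hsle : ∀ f, 0 ≤ f → P R f ≤ f → s f ≤ R • f)
    (hVh : P R V = V)
    (h : P R f ≤ f) (hf : Lim R V f x)
    (hc : Lim R V (s V) c) : Lim R V (s f) (x * c) := by
  set g : Fn := f + (-x) • V with hg
  have hgl : Lim R V g 0 := by
    have hVl : Lim R V V 1 := fun p => by
      simp only [Pn_fix hVh, one_mul]; exact tendsto_const_nhds
    have := hf.add (hVl.smul (-x))
    rw [hg]
    convert this using 1
    ring
  have hgs : P R g ≤ g := by
    rw [hg, map_add, map_smul, hVh]
    exact add_le_add h le_rfl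
  have hg0 : 0 ≤ g := by
    intro p
    have anti : Antitone (fun n => (P R ^ n) g p) :=
      antitone_nat_of_succ_le (fun n => by
        rw [pow_succ, Module.End.mul_apply]; exact Pn_mono hR hgs n p)
    have := anti.le_of_tendsto (hgl p) 0
    simpa using this
  have hsg : Lim R V (s g) 0 := by
    intro p
    have h1 : Tendsto (fun n => (P R ^ n) (R • g) p) atTop (𝓝 0) := by
      have := (hgl.smul R) p
      simpa using this
    simp only [zero_mul]
    refine tendsto_of_tendsto_of_tendsto_of_le_of_le tendsto_const_nhds h1 ?_ ?_
    · intro n; exact Pn_nonneg hR (hspos g hg0) n p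
    · intro n; exact Pn_mono hR (hsle g hg0 hgs) n p
  have e : s f = s g + x • s V := by
    rw [hg, hsadd, hssmul, neg_smul]; simp
  rw [e]
  have := hsg.add (hc.smul x)
  simpa using this

theorem sE_le {R : ℝ} (hR : 0 < R) (f : Fn) (h0 : 0 ≤ f) (h : P R f ≤ f) : sE f ≤ R • f :=
  fun p => (nbr hR h0 h p.1 p.2).1

theorem sN_le {R : ℝ} (hR : 0 < R) (f : Fn) (h0 : 0 ≤ f) (h : P R f ≤ f) : sN f ≤ R • f :=
  fun p => (nbr hR h0 h p.1 p.2).2.1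

/-- The characteristic exponents of a minimal function. -/
theorem min_exponents {R : ℝ} (hR : 0 < R) {V : Fn} (hV : IsMin R V) :
    ∃ c d : ℝ, 0 < c ∧ 0 < d ∧ Lim R V (sE V) c ∧ Lim R V (sN V) d ∧
      R = 2 + c + d + c⁻¹ + d * c⁻¹ + d⁻¹ := by
  obtain ⟨hV0, hV1, hVh, hVm⟩ := hV
  have pE : ∀ f : Fn, 0 ≤ f → 0 ≤ sE f := fun f hf p => hf (p.1+1, p.2)
  have pN : ∀ f : Fn, 0 ≤ f → 0 ≤ sN f := fun f hf p => hf (p.1, p.2+1)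
  have SE : ∀ f : Fn, 0 ≤ f → P R f ≤ f → P R (sE f) ≤ sE f :=
    fun f h0 h => sE_super hR h (fun j => h0 _)
  have SN : ∀ f : Fn, 0 ≤ f → P R f ≤ f → P R (sN f) ≤ sN f :=
    fun f h0 h => sN_super hR h (fun j => h0 _)
  have V_s : P R V ≤ V := hVh.le
  obtain ⟨c, hc⟩ := exists_c hR ⟨hV0, hV1, hVh, hVm⟩ (pE V hV0) (SE V hV0 V_s)
    (sE_le hR V hV0 V_s)
  obtain ⟨d, hd⟩ := exists_c hR ⟨hV0, hV1, hVh, hVm⟩ (pN V hV0) (SN V hV0 V_s)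
    (sN_le hR V hV0 V_s)
  have low : ∀ (f : Fn) x, (R⁻¹ • V ≤ f) → Lim R V f x → 0 < x := by
    intro f x hle hl
    have : R⁻¹ ≤ x := by
      have h1 := hl (0, 0)
      rw [hV1, mul_one] at h1
      refine ge_of_tendsto' h1 (fun n => ?_)
      have := Pn_mono hR hle n (0,0)
      rw [map_smul, Pn_fix hVh] at this
      simpa [hV1] using this
    exact lt_of_lt_of_le (inv_pos.2 hR) this
  have hc0 : 0 < c := low _ _ (fun p => by
    have := (nbr hR hV0 V_s p.1 p.2).2.2.1
    simp only [Pi.smul_apply, smul_eq_mul, sE]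
    rwa [inv_mul_le_iff₀ hR]) hc
  have hd0 : 0 < d := low _ _ (fun p => by
    have := (nbr hR hV0 V_s p.1 p.2).2.2.2
    simp only [Pi.smul_apply, smul_eq_mul, sN]
    rwa [inv_mul_le_iff₀ hR]) hd
  have cE : ∀ f x, P R f ≤ f → Lim R V f x → Lim R V (sE f) (x * c) :=
    fun f x h hf => Lim.shift hR sE (fun _ _ => rfl) (fun _ _ => rfl) pE (sE_le hR) hVh h hf hc
  have cN : ∀ f x, P R f ≤ f → Lim R V f x → Lim R V (sN f) (x * d) :=
    fun f x h hf => Lim.shift hR sN (fun _ _ => rfl) (fun _ _ => rfl) pN (sN_le hR) hVh h hf hd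
  have l11 := cE _ _ (SN V hV0 V_s) hd
  have l21 := cE _ _ (SE _ (pN _ hV0) (SN V hV0 V_s)) l11
  have l12 := cN _ _ (SE _ (pN _ hV0) (SN V hV0 V_s)) l11
  have l02 := cN _ _ (SN V hV0 V_s) hd
  have id : R • sE (sN V) = (2 : ℝ) • sE (sN V) + sE (sE (sN V)) + sN (sE (sN V))
      + sN V + sN (sN V) + sE V := by
    funext p
    have := congrFun hVh (p.1+1, p.2+1)
    rw [P_apply, inv_mul_eq_iff_eq_mul₀ hR.ne', B_apply] at this
    simp only [dW, dS] at this
    simp only [Pi.add_apply, Pi.smul_apply, smul_eq_mul, sE, sN]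
    linarith
  have h1 := l11.smul R
  have h2 := ((((((l11.smul 2).add l21).add l12).add hd).add l02).add hc)
  rw [← id] at h2
  have h3 := h1.unique hV1 h2
  refine ⟨c, d, hc0, hd0, hc, hd, ?_⟩
  field_simp
  linarith

theorem exponents_unique {R c d c' d' : ℝ} (hc : 0 < c) (hd : 0 < d) (hc' : 0 < c') (hd' : 0 < d')
    (hmin : ∀ x y : ℝ, 0 < x → 0 < y → R ≤ 2 + x + y + x⁻¹ + y * x⁻¹ + y⁻¹)
    (h : R = 2 + c + d + c⁻¹ + d * c⁻¹ + d⁻¹)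
    (h' : R = 2 + c' + d' + c'⁻¹ + d' * c'⁻¹ + d'⁻¹) : c = c' := by
  set x := √c; set x' := √c'; set y := √d; set y' := √d'
  have hx : 0 < x := Real.sqrt_pos.2 hc
  have hx' : 0 < x' := Real.sqrt_pos.2 hc'
  have hy : 0 < y := Real.sqrt_pos.2 hd
  have hy' : 0 < y' := Real.sqrt_pos.2 hd'
  have ex : c = x^2 := (Real.sq_sqrt hc.le).symm
  have ex' : c' = x'^2 := (Real.sq_sqrt hc'.le).symm
  have ey : d = y^2 := (Real.sq_sqrt hd.le).symm
  have ey' : d' = y'^2 := (Real.sq_sqrt hd'.le).symm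
  have hm := hmin (x*x') (y*y') (by positivity) (by positivity)
  rw [ex, ey] at h
  rw [ex', ey'] at h'
  have key : (x - x')^2 + (y-y')^2 + (x⁻¹ - x'⁻¹)^2 + (y*x⁻¹ - y'*x'⁻¹)^2 + (y⁻¹-y'⁻¹)^2 ≤ 0 := by
    simp only [mul_inv] at *
    have e : ∀ a b : ℝ, (a-b)^2 = a^2+b^2-2*(a*b) := fun a b => by ring
    simp only [e, mul_pow, inv_pow]
    nlinarith
  have : x - x' = 0 := by
    have : (x-x')^2 ≤ 0 := by
      nlinarith [sq_nonneg (y-y'), sq_nonneg (x⁻¹ - x'⁻¹), sq_nonneg (y*x⁻¹ - y'*x'⁻¹),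
        sq_nonneg (y⁻¹-y'⁻¹)]
    exact pow_eq_zero_iff (two_ne_zero) |>.1 (le_antisymm this (sq_nonneg _))
  rw [ex, ex', sub_eq_zero.1 this]

/-- Nonnegativity on the `y`-axis propagates. -/
theorem trace_nonneg {R : ℝ} (hR : 0 < R) {V1 V2 : Fn} {c k : ℝ} (hc : 0 < c)
    (h1 : P R V1 = V1) (h2 : P R V2 = V2)
    (l1 : Lim R V1 (sE V1) c) (l2 : Lim R V2 (sE V2) c)
    (ht : ∀ j, k * V2 (0, j) ≤ V1 (0, j)) : k • V2 ≤ V1 := by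
  set W : Fn := V1 + (-k) • V2 with hW
  have hWh : P R W = W := by rw [hW, map_add, map_smul, h1, h2]
  have htW : ∀ j, 0 ≤ W (0, j) := fun j => by
    have := ht j
    simp [hW]; linarith
  have hs : P R (sE W) ≤ sE W := sE_super hR hWh.le htW
  have step : ∀ p, c * W p ≤ sE W p := by
    intro p
    have anti : Antitone (fun n => (P R ^ n) (sE W) p) :=
      antitone_nat_of_succ_le (fun n => by
        rw [pow_succ, Module.End.mul_apply]; exact Pn_mono hR hs n p)
    have lim : Tendsto (fun n => (P R ^ n) (sE W) p) atTop (𝓝 (c * W p)) := by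
      have e : sE W = sE V1 + (-k) • sE V2 := rfl
      simp only [e, map_add, map_smul, Pi.add_apply, Pi.smul_apply, smul_eq_mul]
      have := (l1 p).add ((l2 p).const_mul (-k))
      convert this using 2
      simp [hW]; ring
    have := anti.le_of_tendsto lim 0
    simpa using this
  have pos : ∀ i j, 0 ≤ W (i, j) := by
    intro i j
    induction i with
    | zero => exact htW j
    | succ i ih => exact (mul_nonneg hc.le ih).trans (step (i, j))
  intro p
  have := pos p.1 p.2
  simp [hW] at this
  simp only [Pi.smul_apply, smul_eq_mul]
  exact this

end SBx

namespace SBx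

open Filter Topology

def Adj (p q : ℕ × ℕ) : Prop :=
  (q.1 = p.1 + 1 ∧ q.2 = p.2) ∨ (p.1 = q.1 + 1 ∧ p.2 = q.2) ∨
  (q.1 = p.1 ∧ q.2 = p.2 + 1) ∨ (p.1 = q.1 ∧ p.2 = q.2 + 1) ∨
  (q.1 = p.1 + 1 ∧ p.2 = q.2 + 1) ∨ (p.1 = q.1 + 1 ∧ q.2 = p.2 + 1)

theorem Adj.symm {p q : ℕ × ℕ} (h : Adj p q) : Adj q p := by
  unfold Adj at *; omega

def eCnt (b c u : ℕ × ℕ) : ℕ :=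
  if (b.2 = u.2 ∧ c.2 = u.2 + 1 ∧ b.1 < u.1) ∨ (c.2 = u.2 ∧ b.2 = u.2 + 1 ∧ c.1 < u.1)
  then 1 else 0

def phi (u v z : ℕ × ℕ) : ℕ :=
  if (v.2 = u.2 + 1 ∧ z.2 = v.2 ∧ z.1 < v.1) ∨ (u.2 = v.2 + 1 ∧ z.2 = u.2 ∧ z.1 < u.1)
  then 1 else 0

def Adj' (p q : ℕ × ℕ) : Prop :=
  (q.1 = p.1 + 1 ∧ q.2 = p.2) ∨ (q.1 = p.1 ∧ q.2 = p.2 + 1) ∨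
  (p.1 = q.1 + 1 ∧ q.2 = p.2 + 1)

theorem Adj.or {p q : ℕ × ℕ} (h : Adj p q) : Adj' p q ∨ Adj' q p := by
  unfold Adj Adj' at *; omega

theorem eCnt_comm (b c u : ℕ × ℕ) : eCnt b c u = eCnt c b u := by
  simp only [eCnt, or_comm]

theorem phi_comm (u v z : ℕ × ℕ) : phi u v z = phi v u z := by
  simp only [phi, or_comm]

theorem edge_parity_aux (b c u v : ℕ × ℕ) (hbc : Adj' b c) (huv : Adj' u v)
    (h1 : b ≠ u) (h2 : b ≠ v) (h3 : c ≠ u) (h4 : c ≠ v) :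
    (eCnt b c u + eCnt b c v + phi u v b + phi u v c) % 2 = 0 := by
  obtain ⟨b1, b2⟩ := b
  obtain ⟨c1, c2⟩ := c
  obtain ⟨u1, u2⟩ := u
  obtain ⟨v1, v2⟩ := v
  simp only [ne_eq, Prod.mk.injEq, Adj', eCnt, phi] at *
  rcases huv with huv | huv | huv <;>
  obtain ⟨rfl, rfl⟩ := huv <;>
  rcases hbc with hbc | hbc | hbc <;>
  obtain ⟨rfl, rfl⟩ := hbc <;>
  simp <;> split_ifs <;> omega

theorem edge_parity (b c u v : ℕ × ℕ) (hbc : Adj b c) (huv : Adj u v)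
    (h1 : b ≠ u) (h2 : b ≠ v) (h3 : c ≠ u) (h4 : c ≠ v) :
    (eCnt b c u + eCnt b c v + phi u v b + phi u v c) % 2 = 0 := by
  rcases hbc.or with hb | hb <;> rcases huv.or with hu | hu
  · exact edge_parity_aux b c u v hb hu h1 h2 h3 h4
  · have := edge_parity_aux b c v u hb hu h2 h1 h4 h3
    rw [phi_comm u v, phi_comm u v]; omega
  · have := edge_parity_aux c b u v hb hu h3 h4 h1 h2
    rw [eCnt_comm b c, eCnt_comm b c]; omega
  · have := edge_parity_aux c b v u hb hu h4 h3 h2 h1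
    rw [eCnt_comm b c, eCnt_comm b c, phi_comm u v, phi_comm u v]; omega

theorem path_count (X : Set (ℕ × ℕ)) (a b : ℕ × ℕ) (ha : a ∈ X)
    (h : Relation.ReflTransGen (fun p q => Adj p q ∧ q ∈ X) a b) :
    b ∈ X ∧ ∃ N : ℕ × ℕ → ℕ, (∀ j, N (0, j) = 0) ∧
      ∀ u v, u ∉ X → v ∉ X → Adj u v → (N u + N v + phi u v a + phi u v b) % 2 = 0 := by
  induction h with
  | refl => exact ⟨ha, fun _ => 0, fun _ => rfl, fun u v _ _ _ => by simp only; omega⟩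
  | @tail b c _ hbc ih =>
    obtain ⟨hb, N, hN0, hN⟩ := ih
    refine ⟨hbc.2, fun u => N u + eCnt b c u, fun j => by simp [hN0, eCnt], ?_⟩
    intro u v hu hv huv
    have h1 := hN u v hu hv huv
    have h2 := edge_parity b c u v hbc.1 huv (fun h => hu (h ▸ hb)) (fun h => hv (h ▸ hb))
      (fun h => hu (h ▸ hbc.2)) (fun h => hv (h ▸ hbc.2))
    simp only
    omega

theorem no_cross (X Y : Set (ℕ × ℕ)) (hXY : ∀ p, p ∈ X → p ∈ Y → False)
    (y1 y2 y3 y4 : ℕ) (h12 : y1 < y2) (h23 : y2 < y3) (h34 : y3 < y4)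
    (m1 : (0, y1) ∈ X) (m2 : (0, y2) ∈ Y)
    (hX : Relation.ReflTransGen (fun p q => Adj p q ∧ q ∈ X) (0, y1) (0, y3))
    (hY : Relation.ReflTransGen (fun p q => Adj p q ∧ q ∈ Y) (0, y2) (0, y4)) : False := by
  obtain ⟨m3, N, hN0, hN⟩ := path_count X _ _ m1 hX
  have key : ∀ v, Relation.ReflTransGen (fun p q => Adj p q ∧ q ∈ Y) (0, y2) v →
      v ∈ Y ∧ (N v + (if y1 ≤ v.2 then 1 else 0) + (if y3 ≤ v.2 then 1 else 0)) % 2 = 1 := by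
    intro v hv
    induction hv with
    | refl =>
      refine ⟨m2, ?_⟩
      rw [hN0, if_pos h12.le, if_neg (by simpa using h23)]
    | @tail u v _ huv ih =>
      obtain ⟨hu, ih⟩ := ih
      refine ⟨huv.2, ?_⟩
      have hu' : u ∉ X := fun h => hXY _ h hu
      have hv' : v ∉ X := fun h => hXY _ h huv.2
      have h1 := hN u v hu' hv' huv.1
      have n1 : u ≠ (0, y1) := fun h => hu' (h ▸ m1)
      have n2 : v ≠ (0, y1) := fun h => hv' (h ▸ m1)
      have n3 : u ≠ (0, y3) := fun h => hu' (h ▸ m3)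
      have n4 : v ≠ (0, y3) := fun h => hv' (h ▸ m3)
      have hadj := huv.1
      obtain ⟨u1, u2⟩ := u
      obtain ⟨v1, v2⟩ := v
      have aux : ∀ y, ¬ (u1 = 0 ∧ u2 = y) → ¬ (v1 = 0 ∧ v2 = y) →
          ((if y ≤ u2 then 1 else 0) + (if y ≤ v2 then 1 else 0) +
            phi (u1, u2) (v1, v2) (0, y)) % 2 = 0 := by
        intro y k1 k2
        simp only [phi, Adj] at *
        split_ifs <;> omega
      have a1 := aux y1 (by simpa using n1) (by simpa using n2)
      have a3 := aux y3 (by simpa using n3) (by simpa using n4)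
      simp only at ih ⊢
      omega
  have := (key _ hY).2
  rw [hN0] at this
  simp only at this
  rw [if_pos (by omega), if_pos (by omega)] at this
  omega

theorem B_le_of_nbr {D f : Fn} (p : ℕ × ℕ) (h0 : D p ≤ f p) (h : ∀ q, Adj p q → D q ≤ f q) :
    B D p ≤ B f p := by
  rw [B_apply, B_apply]
  obtain ⟨i, j⟩ := p
  have hW : dW D (i, j) ≤ dW f (i, j) := by
    cases i
    · simp [dW]
    · exact add_le_add (h _ (by simp [Adj])) (h _ (by simp [Adj]))
  have hS : dS D (i, j) ≤ dS f (i, j) := by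
    cases j
    · simp [dS]
    · exact h _ (by simp [Adj])
  have h1 := h (i+1, j) (by simp [Adj])
  have h2 := h (i, j+1) (by simp [Adj])
  simp only
  linarith

def cut (U : Set (ℕ × ℕ)) (D : Fn) : Fn := fun p => if p ∈ U then D p else 0

theorem cut_sub {R : ℝ} (hR : 0 < R) {D : Fn} (hD : P R D = D) (U : Set (ℕ × ℕ))
    (hU : ∀ p ∈ U, 0 < D p) (hcl : ∀ p ∈ U, ∀ q, Adj p q → 0 < D q → q ∈ U) :
    cut U D ≤ P R (cut U D) := by
  have h0 : 0 ≤ cut U D := by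
    intro p
    simp only [cut]
    split_ifs with hp
    · exact (hU p hp).le
    · exact le_rfl
  intro p
  by_cases hp : p ∈ U
  · have e : cut U D p = P R D p := by rw [hD]; simp [cut, hp]
    rw [e, P_apply, P_apply]
    apply mul_le_mul_of_nonneg_left _ (inv_nonneg.2 hR.le)
    apply B_le_of_nbr
    · simp [cut, hp]
    · intro q hq
      simp only [cut]
      split_ifs with hqU
      · exact le_rfl
      · by_contra hlt
        exact hqU (hcl p hp q hq (not_le.1 hlt))
  · have e : cut U D p = 0 := by simp [cut, hp]
    rw [e]
    have := Pn_nonneg hR h0 1 p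
    simpa using this

/-- For a minimal `V1`, the set `{V1 > V2}` is connected. -/
theorem connected {R : ℝ} (hR : 0 < R) {V1 V2 : Fn} (h1 : IsMin R V1) (h2 : P R V2 = V2)
    (h20 : 0 ≤ V2) (a b : ℕ × ℕ) (ha : V2 a < V1 a) (hb : V2 b < V1 b) :
    Relation.ReflTransGen (fun p q => Adj p q ∧ q ∈ {p | V2 p < V1 p}) a b := by
  by_contra hab
  obtain ⟨hV0, hV1, hVh, hVm⟩ := h1
  set D : Fn := V1 + (-1 : ℝ) • V2 with hDdef
  have hD : P R D = D := by rw [hDdef, map_add, map_smul, hVh, h2]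
  have Dpos : ∀ p, 0 < D p ↔ V2 p < V1 p := fun p => by simp [hDdef]
  have DV : ∀ p, D p ≤ V1 p := fun p => by
    have : 0 ≤ V2 p := h20 p
    simp [hDdef]; exact this
  set U : Set (ℕ × ℕ) := {q | Relation.ReflTransGen (fun p q => Adj p q ∧ q ∈ {p | V2 p < V1 p}) a q}
    with hUdef
  set U' : Set (ℕ × ℕ) := {q | 0 < D q ∧ q ∉ U} with hU'def
  have hU : ∀ p ∈ U, 0 < D p := by
    intro p hp
    rw [Dpos]
    rcases Relation.ReflTransGen.cases_tail hp with h | ⟨c, _, h⟩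
    · rw [h]; exact ha
    · exact h.2
  have hUc : ∀ p ∈ U, ∀ q, Adj p q → 0 < D q → q ∈ U := fun p hp q hpq hq =>
    Relation.ReflTransGen.tail hp ⟨hpq, (Dpos q).1 hq⟩
  have hU' : ∀ p ∈ U', 0 < D p := fun p hp => hp.1
  have hU'c : ∀ p ∈ U', ∀ q, Adj p q → 0 < D q → q ∈ U' := fun p hp q hpq hq =>
    ⟨hq, fun hqU => hp.2 (hUc q hqU p hpq.symm hp.1)⟩
  have cV : ∀ W : Set (ℕ × ℕ), cut W D ≤ V1 := fun W p => by
    simp only [cut]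
    split_ifs
    · exact DV p
    · exact hV0 p
  have main : ∀ W : Set (ℕ × ℕ), (∀ p ∈ W, 0 < D p) →
      (∀ p ∈ W, ∀ q, Adj p q → 0 < D q → q ∈ W) → W.Nonempty →
      ∃ t, 0 < t ∧ cut W D ≤ t • V1 ∧ Lim R V1 (cut W D) t := by
    intro W hW hWc ⟨w, hw⟩
    obtain ⟨g, g1, g2, g3, g4⟩ := exists_limit_sub hR hVh (cV W) (cut_sub hR hD W hW hWc)
    have c0 : 0 ≤ cut W D := fun p => by
      simp only [cut]
      split_ifs with hp
      · exact (hW p hp).le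
      · exact le_rfl
    have gm := hVm g (c0.trans g3) g4 g2
    have gmp : ∀ p, g p = g (0, 0) * V1 p := fun p => congrFun gm p
    refine ⟨g (0, 0), ?_, ?_, ?_⟩
    · have h1 : 0 < g w := lt_of_lt_of_le (by simpa [cut, hw] using hW w hw) (g3 w)
      rw [gmp] at h1
      exact pos_of_mul_pos_left h1 (hV0 w)
    · rw [← gm]; exact g3
    · intro p; rw [← gmp]; exact g1 p
  obtain ⟨t, t0, tl, tL⟩ := main U hU hUc ⟨a, Relation.ReflTransGen.refl⟩
  obtain ⟨s, s0, sl, sL⟩ := main U' hU' hU'c ⟨b, (Dpos b).2 hb, hab⟩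
  have comb : s • cut U D + t • cut U' D ≤ (s * t) • V1 := by
    intro p
    have a1 := tl p
    have a2 := sl p
    have a3 : 0 ≤ V1 p := hV0 p
    simp only [Pi.add_apply, Pi.smul_apply, smul_eq_mul] at *
    by_cases hp : p ∈ U
    · have : cut U' D p = 0 := by
        have : p ∉ U' := fun h => h.2 hp
        simp [cut, this]
      rw [this]
      nlinarith
    · have : cut U D p = 0 := by simp [cut, hp]
      rw [this]
      nlinarith
  have L := (tL.smul s).add (sL.smul t)
  have le : s * t + t * s ≤ s * t := by
    have h1 := L (0, 0)
    rw [hV1, mul_one] at h1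
    refine le_of_tendsto' h1 (fun n => ?_)
    have := Pn_mono hR comb n (0, 0)
    rw [map_smul, Pn_fix hVh] at this
    simpa [hV1] using this
  nlinarith [mul_pos s0 t0]

/-- Ratios on the `y`-axis of distinct minimal functions. -/
theorem axis_small {R : ℝ} (hR : 0 < R) {V1 V2 : Fn} {c : ℝ} (hc : 0 < c)
    (h1 : IsMin R V1) (h2 : IsMin R V2)
    (l1 : Lim R V1 (sE V1) c) (l2 : Lim R V2 (sE V2) c) (hne : V1 ≠ V2) (Y : ℕ) :
    ∃ y, Y < y ∧ V1 (0, y) < V2 (0, y) := by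
  by_contra hcon
  push Not at hcon
  have p1 : ∀ p, 0 < V1 p := harm_pos hR h1.1 h1.2.2.1 (by rw [h1.2.1]; exact one_pos)
  have p2 : ∀ p, 0 < V2 p := harm_pos hR h2.1 h2.2.2.1 (by rw [h2.2.1]; exact one_pos)
  obtain ⟨k, k0, k1, hk⟩ : ∃ k : ℝ, 0 < k ∧ k ≤ 1 ∧ ∀ y ≤ Y, k * V2 (0, y) ≤ V1 (0, y) := by
    clear hcon
    induction Y with
    | zero =>
      refine ⟨1, one_pos, le_rfl, fun y hy => ?_⟩
      obtain rfl : y = 0 := by omega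
      rw [h1.2.1, h2.2.1, mul_one]
    | succ Y ih =>
      obtain ⟨k, k0, k1, hk⟩ := ih
      refine ⟨min k (V1 (0, Y+1) / V2 (0, Y+1)), lt_min k0 (div_pos (p1 _) (p2 _)),
        (min_le_left _ _).trans k1, fun y hy => ?_⟩
      rcases Nat.lt_or_ge Y y with h | h
      · obtain rfl : y = Y + 1 := by omega
        rw [← le_div_iff₀ (p2 _)]
        exact min_le_right _ _
      · exact (mul_le_mul_of_nonneg_right (min_le_left _ _) (p2 _).le).trans (hk y h)
  have all : ∀ y, k * V2 (0, y) ≤ V1 (0, y) := by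
    intro y
    rcases Nat.lt_or_ge Y y with h | h
    · exact (mul_le_of_le_one_left (p2 _).le k1).trans (hcon y h)
    · exact hk y h
  have le := trace_nonneg hR hc h1.2.2.1 h2.2.2.1 l1 l2 all
  have := h1.2.2.2 (k • V2) (fun p => mul_nonneg k0.le (p2 p).le) le
    (by rw [map_smul, h2.2.2.1])
  apply hne
  funext p
  have e := congrFun this p
  simp only [Pi.smul_apply, smul_eq_mul, h2.2.1, mul_one] at e
  exact (mul_left_cancel₀ k0.ne' e).symm

theorem min_unique {R : ℝ} (hR : 0 < R)
    (hmin : ∀ x y : ℝ, 0 < x → 0 < y → R ≤ 2 + x + y + x⁻¹ + y * x⁻¹ + y⁻¹)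
    {V1 V2 : Fn} (h1 : IsMin R V1) (h2 : IsMin R V2) : V1 = V2 := by
  by_contra hne
  obtain ⟨c, d, c0, d0, l1, -, e1⟩ := min_exponents hR h1
  obtain ⟨c', d', c0', d0', l2, -, e2⟩ := min_exponents hR h2
  obtain rfl := exponents_unique c0 d0 c0' d0' hmin e1 e2
  obtain ⟨y1, -, hy1⟩ := axis_small hR c0 h1 h2 l1 l2 hne 0
  obtain ⟨y2, h12, hy2⟩ := axis_small hR c0 h2 h1 l2 l1 (Ne.symm hne) y1
  obtain ⟨y3, h23, hy3⟩ := axis_small hR c0 h1 h2 l1 l2 hne y2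
  obtain ⟨y4, h34, hy4⟩ := axis_small hR c0 h2 h1 l2 l1 (Ne.symm hne) y3
  refine no_cross {p | V1 p < V2 p} {p | V2 p < V1 p} (fun p (hp : V1 p < V2 p) (hq : V2 p < V1 p) => lt_asymm hp hq)
    y1 y2 y3 y4 h12 h23 h34 hy1 hy2 ?_ ?_
  · exact connected hR h2 h1.2.2.1 h1.1 _ _ hy1 hy3
  · exact connected hR h1 h2.2.2.1 h2.1 _ _ hy2 hy4

def KSet (R : ℝ) : Set Fn := {f | 0 ≤ f ∧ f (0, 0) = 1 ∧ P R f = f}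

theorem K_unique {R : ℝ} (hR : 0 < R)
    (hmin : ∀ x y : ℝ, 0 < x → 0 < y → R ≤ 2 + x + y + x⁻¹ + y * x⁻¹ + y⁻¹)
    {V1 V2 : Fn} (h1 : V1 ∈ KSet R) (h2 : V2 ∈ KSet R) : V1 = V2 := by
  have hconv : Convex ℝ (KSet R) := by
    intro f hf g hg a b ha hb hab
    refine ⟨?_, ?_, ?_⟩
    · exact add_nonneg (smul_nonneg ha hf.1) (smul_nonneg hb hg.1)
    · simp [hf.2.1, hg.2.1, hab]
    · rw [map_add, map_smul, map_smul, hf.2.2, hg.2.2]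
  have hclosed : IsClosed (KSet R) := by
    have c1 : IsClosed {f : Fn | 0 ≤ f} := isClosed_le continuous_const continuous_id
    have c2 : IsClosed {f : Fn | f (0, 0) = 1} :=
      isClosed_eq (continuous_apply _) continuous_const
    have c3 : IsClosed {f : Fn | P R f = f} := by
      refine isClosed_eq ?_ continuous_id
      refine continuous_pi (fun p => ?_)
      simp only [P_apply]
      refine continuous_const.mul (continuous_iff_continuousAt.2 (fun f => ?_))
      exact B_tendsto (fun q => (continuous_apply q).tendsto f) p
    exact c1.inter (c2.inter c3)
  have hcomp : IsCompact (KSet R) := by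
    refine IsCompact.of_isClosed_subset
      (isCompact_univ_pi (fun p : ℕ × ℕ => isCompact_Icc (a := (0:ℝ)) (b := R ^ (p.1 + p.2))))
      hclosed ?_
    intro f hf p _
    refine ⟨hf.1 p, ?_⟩
    have := harm_le hR hf.1 hf.2.2 p.1 p.2
    rwa [hf.2.1, mul_one] at this
  have hext : ∀ V ∈ (KSet R).extremePoints ℝ, IsMin R V := by
    intro V hV
    obtain ⟨hVK, hVe⟩ := mem_extremePoints.1 hV
    refine ⟨hVK.1, hVK.2.1, hVK.2.2, ?_⟩
    intro g g0 gV gh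
    have hd0 : 0 ≤ V + (-1 : ℝ) • g := fun p => by
      have := gV p
      simp; exact this
    have hdh : P R (V + (-1 : ℝ) • g) = V + (-1 : ℝ) • g := by
      rw [map_add, map_smul, hVK.2.2, gh]
    set s := g (0, 0) with hs
    have s0 : 0 ≤ s := g0 _
    have s1 : s ≤ 1 := by rw [← hVK.2.1]; exact gV _
    rcases s0.eq_or_lt with hz | hz
    · rw [harm_zero hR g0 gh hz.symm, ← hz]; simp
    rcases s1.eq_or_lt with ho | ho
    · have := harm_zero hR hd0 hdh (by simp [hVK.2.1, ← hs, ho])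
      rw [ho, one_smul]
      funext p
      have := congrFun this p
      simp at this
      linarith
    · have hs1 : 0 < 1 - s := by linarith
      have k1 : s⁻¹ • g ∈ KSet R := by
        refine ⟨smul_nonneg (inv_nonneg.2 s0) g0, ?_, ?_⟩
        · simp [← hs, hz.ne']
        · rw [map_smul, gh]
      have k2 : (1 - s)⁻¹ • (V + (-1 : ℝ) • g) ∈ KSet R := by
        refine ⟨smul_nonneg (inv_nonneg.2 hs1.le) hd0, ?_, ?_⟩
        · simp [← hs, hVK.2.1]
          field_simp
          ring
        · rw [map_smul, hdh]
      have := (hVe _ k1 _ k2 ?_).1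
      · rw [← this, smul_smul, mul_inv_cancel₀ hz.ne', one_smul]
      · refine ⟨s, 1 - s, hz, hs1, by ring, ?_⟩
        rw [smul_smul, smul_smul, mul_inv_cancel₀ hz.ne', mul_inv_cancel₀ hs1.ne']
        simp
  have hKM := closure_convexHull_extremePoints hcomp hconv
  obtain ⟨V, hV⟩ := hcomp.extremePoints_nonempty (E := Fn) ⟨V1, h1⟩
  have hsing : (KSet R).extremePoints ℝ = {V} := by
    ext W
    constructor
    · intro hW; exact min_unique hR hmin (hext W hW) (hext V hV)
    · rintro rfl; exact hV
  rw [hsing, convexHull_singleton, closure_singleton] at hKM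
  rw [← hKM] at h1 h2
  rw [Set.mem_singleton_iff.1 h1, Set.mem_singleton_iff.1 h2]

end SBx

namespace SBx

open Filter Topology

theorem cs_ineq (c : ℕ → ℝ) (hc : ∀ k, 0 ≤ c k) (u : ℕ → ℝ)
    (hu : ∀ n, u n = ∑ k ∈ Finset.range (n+1), (n.choose k : ℝ) * 2 ^ (n-k) * c k) (n : ℕ) :
    2 * ((n:ℝ)+2) * u (n+1) ^ 2 ≤ u (n+2) * (2 * ((n:ℝ)+1) * u n + u (n+1)) := by
  set w : ℕ → ℝ := fun k => ((n+2).choose k : ℝ) * 2 ^ (n+2-k) * c k with hw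
  have hw0 : ∀ k, 0 ≤ w k := fun k => mul_nonneg (by positivity) (hc k)
  have e2 : u (n+2) = ∑ k ∈ Finset.range (n+3), w k := hu (n+2)
  have e1 : 2 * ((n:ℝ)+2) * u (n+1) = ∑ k ∈ Finset.range (n+3), w k * ((n:ℝ)+2-k) := by
    rw [hu, Finset.sum_range_succ _ (n+2), Finset.mul_sum]
    simp only [Nat.cast_add, Nat.cast_ofNat, sub_self, mul_zero, add_zero]
    apply Finset.sum_congr rfl
    intro k hk
    have hk' : k ≤ n + 1 := by simpa [Nat.lt_succ_iff] using hk
    have h1 := Nat.choose_mul_succ_eq (n+1) k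
    have h2 : (((n+1).choose k : ℝ)) * ((n:ℝ)+2) = ((n+2).choose k : ℝ) * ((n:ℝ)+2-k) := by
      have := congrArg (Nat.cast : ℕ → ℝ) h1
      rw [Nat.cast_mul, Nat.cast_mul, Nat.cast_sub (by omega)] at this
      push_cast at this
      convert this using 2 <;> ring
    have h3 : n + 2 - k = (n + 1 - k) + 1 := by omega
    simp only [hw]
    rw [h3, pow_succ]
    linear_combination 2 * 2 ^ (n+1-k) * c k * h2
  have e0 : 4 * ((n:ℝ)+2) * ((n:ℝ)+1) * u n
      = ∑ k ∈ Finset.range (n+3), w k * (((n:ℝ)+2-k) * ((n:ℝ)+1-k)) := by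
    rw [hu, Finset.sum_range_succ _ (n+2), Finset.sum_range_succ _ (n+1), Finset.mul_sum]
    simp only [Nat.cast_add, Nat.cast_ofNat, Nat.cast_one, sub_self, mul_zero, zero_mul, add_zero]
    apply Finset.sum_congr rfl
    intro k hk
    have hk' : k ≤ n := by simpa [Nat.lt_succ_iff] using hk
    have h1 := Nat.choose_mul_succ_eq (n+1) k
    have h2 : (((n+1).choose k : ℝ)) * ((n:ℝ)+2) = ((n+2).choose k : ℝ) * ((n:ℝ)+2-k) := by
      have := congrArg (Nat.cast : ℕ → ℝ) h1
      rw [Nat.cast_mul, Nat.cast_mul, Nat.cast_sub (by omega)] at this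
      push_cast at this
      convert this using 2 <;> ring
    have h1' := Nat.choose_mul_succ_eq n k
    have h2' : ((n.choose k : ℝ)) * ((n:ℝ)+1) = ((n+1).choose k : ℝ) * ((n:ℝ)+1-k) := by
      have := congrArg (Nat.cast : ℕ → ℝ) h1'
      rw [Nat.cast_mul, Nat.cast_mul, Nat.cast_sub (by omega)] at this
      push_cast at this
      exact this
    have h3 : n + 2 - k = (n - k) + 2 := by omega
    simp only [hw]
    rw [h3, pow_add]
    linear_combination 4 * 2 ^ (n-k) * c k * ((n:ℝ)+1-k) * h2 + 4 * 2 ^ (n-k) * c k * ((n:ℝ)+2) * h2'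
  have cs := Finset.sum_mul_sq_le_sq_mul_sq (Finset.range (n+3)) (fun k => Real.sqrt (w k))
    (fun k => Real.sqrt (w k) * ((n:ℝ)+2-k))
  have s1 : ∀ k, Real.sqrt (w k) * (Real.sqrt (w k) * ((n:ℝ)+2-k)) = w k * ((n:ℝ)+2-k) := by
    intro k
    rw [← mul_assoc, Real.mul_self_sqrt (hw0 k)]
  have s2 : ∀ k, Real.sqrt (w k) ^ 2 = w k := fun k => Real.sq_sqrt (hw0 k)
  have s3 : ∀ k, (Real.sqrt (w k) * ((n:ℝ)+2-k)) ^ 2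
      = w k * (((n:ℝ)+2-k) * ((n:ℝ)+1-k)) + w k * ((n:ℝ)+2-k) := by
    intro k
    rw [mul_pow, s2]; ring
  simp only [s1, s2, s3] at cs
  rw [Finset.sum_add_distrib, ← e2, ← e1, ← e0] at cs
  have hn : (0:ℝ) < 2 * ((n:ℝ)+2) := by positivity
  refine le_of_mul_le_mul_left ?_ hn
  nlinarith [cs]

theorem drift {s : ℕ → ℝ} (hs : Tendsto (fun n : ℕ => s n / n) atTop (𝓝 0)) {η δ : ℝ}
    (hη : 0 < η) (hδ : 0 < δ) :
    ∃ N : ℕ, ∀ n ≥ N, ∀ k : ℕ, δ * n ≤ k → 0 < k → |s (n+k) - s n| < η * k := by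
  set e : ℝ := η / (2 * (2 / δ + 1)) with he
  have he0 : 0 < e := by positivity
  obtain ⟨N, hN⟩ := Metric.tendsto_atTop.1 hs e he0
  have bd : ∀ m ≥ N + 1, |s m| ≤ e * m := by
    intro m hm
    have h := hN m (by omega)
    rw [Real.dist_eq, sub_zero, abs_div, Nat.abs_cast, div_lt_iff₀ (by
      have : 0 < m := by omega
      exact_mod_cast this)] at h
    exact h.le
  refine ⟨N + 1, fun n hn k hk k0 => ?_⟩
  have h1 := bd n hn
  have h2 := bd (n+k) (by omega)
  have hk0 : (0:ℝ) < k := by exact_mod_cast k0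
  have h3 : |s (n+k) - s n| ≤ |s (n+k)| + |s n| := abs_sub _ _
  have h4 : (n:ℝ) ≤ k / δ := by rw [le_div_iff₀ hδ]; linarith
  push_cast at h2
  have h5 : |s (n+k) - s n| ≤ e * ((2 / δ + 1) * k) := by
    have : e * n ≤ e * (k / δ) := mul_le_mul_of_nonneg_left h4 he0.le
    have e1 : e * ((2 / δ + 1) * k) = e * (k/δ) + e * (k / δ) + e * k := by ring
    rw [e1]; linarith
  have h6 : e * ((2 / δ + 1) * k) = η * k / 2 := by
    rw [he]; field_simp
  rw [h6] at h5
  have : 0 < η * k := by positivity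
  linarith

theorem ratio_limit {u : ℕ → ℝ} {N0 : ℕ} (hpos : ∀ n ≥ N0, 0 < u n)
    (hu : ∀ n : ℕ, 2 * ((n:ℝ)+2) * u (n+1) ^ 2 ≤ u (n+2) * (2 * ((n:ℝ)+1) * u n + u (n+1)))
    {L : ℝ} (hL : Tendsto (fun n : ℕ => Real.log (u n) / n) atTop (𝓝 L)) :
    Tendsto (fun n => u n / u (n+1)) atTop (𝓝 (Real.exp (-L))) := by
  set x : ℕ → ℝ := fun n => u n / u (n+1) with hx
  have xpos : ∀ n ≥ N0, 0 < x n := fun n hn => div_pos (hpos n hn) (hpos _ (by omega))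
  have xstep : ∀ n ≥ N0, x (n+1) ≤ x n + 1 / ((n:ℝ)+1) := by
    intro n hn
    have p0 := hpos n hn
    have p1 := hpos (n+1) (by omega)
    have p2 := hpos (n+2) (by omega)
    have h := hu n
    have e0 : u n = x n * u (n+1) := by simp only [hx]; field_simp
    have e1 : u (n+1) = x (n+1) * u (n+2) := by simp only [hx]; field_simp
    have hn0 : (0:ℝ) ≤ n := Nat.cast_nonneg n
    have h' : 2 * ((n:ℝ)+2) * x (n+1) ≤ 2 * ((n:ℝ)+1) * x n + 1 := by
      have hq : 0 < u (n+1) * u (n+2) := mul_pos p1 p2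
      refine le_of_mul_le_mul_right ?_ hq
      have a1 : 2 * ((n:ℝ)+2) * x (n+1) * (u (n+1) * u (n+2)) = 2 * ((n:ℝ)+2) * u (n+1) ^ 2 := by
        linear_combination (-2) * ((n:ℝ)+2) * u (n+1) * e1
      have a2 : (2 * ((n:ℝ)+1) * x n + 1) * (u (n+1) * u (n+2))
          = u (n+2) * (2 * ((n:ℝ)+1) * u n + u (n+1)) := by
        linear_combination (-2) * ((n:ℝ)+1) * u (n+2) * e0
      rw [a1, a2]; exact h
    have y0 := xpos n hn
    have y1 := xpos (n+1) (by omega)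
    have : x (n+1) * ((n:ℝ)+1) ≤ (x n + 1 / ((n:ℝ)+1)) * ((n:ℝ)+1) := by
      rw [add_mul, one_div, inv_mul_cancel₀ (by positivity)]
      nlinarith
    exact le_of_mul_le_mul_right this (by positivity)
  have xk : ∀ n ≥ N0, ∀ k : ℕ, x (n+k) ≤ x n + k / ((n:ℝ)+1) := by
    intro n hn k
    induction k with
    | zero => simp
    | succ k ih =>
      have h1 := xstep (n+k) (by omega)
      have h2 : 1 / (((n+k:ℕ):ℝ)+1) ≤ 1 / ((n:ℝ)+1) := by
        apply one_div_le_one_div_of_le (by positivity)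
        push_cast
        have : (0:ℝ) ≤ k := Nat.cast_nonneg k
        linarith
      have h3 : ((k+1:ℕ):ℝ) / ((n:ℝ)+1) = k / ((n:ℝ)+1) + 1 / ((n:ℝ)+1) := by
        push_cast; ring
      rw [h3]
      rw [← add_assoc n k 1]
      linarith
  have prodA : ∀ (c : ℝ) (n k : ℕ), n ≥ N0 → 0 ≤ c → (∀ i < k, x (n+i) ≤ c) →
      u n ≤ c ^ k * u (n+k) := by
    intro c n k hn hc
    induction k with
    | zero => intro _; simp
    | succ k ih =>
      intro h
      have h1 := ih (fun i hi => h i (by omega))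
      have h2 := h k (by omega)
      have p1 := hpos (n+k+1) (by omega)
      simp only [hx] at h2
      rw [div_le_iff₀ p1] at h2
      calc u n ≤ c ^ k * u (n+k) := h1
        _ ≤ c ^ k * (c * u (n+k+1)) := mul_le_mul_of_nonneg_left h2 (by positivity)
        _ = c ^ (k+1) * u (n + (k+1)) := by rw [← add_assoc]; ring
  have prodB : ∀ (c : ℝ) (n k : ℕ), n ≥ N0 → 0 ≤ c → (∀ i < k, c ≤ x (n+i)) →
      c ^ k * u (n+k) ≤ u n := by
    intro c n k hn hc
    induction k with
    | zero => intro _; simp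
    | succ k ih =>
      intro h
      have h1 := ih (fun i hi => h i (by omega))
      have h2 := h k (by omega)
      have p1 := hpos (n+k+1) (by omega)
      simp only [hx] at h2
      rw [le_div_iff₀ p1] at h2
      calc c ^ (k+1) * u (n + (k+1)) = c ^ k * (c * u (n+k+1)) := by rw [← add_assoc]; ring
        _ ≤ c ^ k * u (n+k) := mul_le_mul_of_nonneg_left h2 (by positivity)
        _ ≤ u n := h1
  set r := Real.exp (-L) with hr
  have hr0 : 0 < r := Real.exp_pos _
  have hs : Tendsto (fun n : ℕ => (Real.log (u n) - L * n) / n) atTop (𝓝 0) := by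
    have := hL.sub_const L
    rw [sub_self] at this
    refine this.congr' ?_
    filter_upwards [eventually_gt_atTop 0] with n hn
    have : (n:ℝ) ≠ 0 := by exact_mod_cast hn.ne'
    field_simp
  rw [Metric.tendsto_atTop]
  intro ε hε
  set δ : ℝ := min (1/4) (ε / 8) with hδ
  have δ0 : 0 < δ := by rw [hδ]; positivity
  have δ1 : δ ≤ 1/4 := min_le_left _ _
  have δ2 : δ ≤ ε/8 := min_le_right _ _
  -- upper drift constant
  set ηB := Real.log (r + ε/2) + L with hηB
  have logr : Real.log r = -L := Real.log_exp _
  have ηB0 : 0 < ηB := by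
    have := Real.log_lt_log hr0 (show r < r + ε/2 by linarith)
    rw [logr] at this; linarith
  obtain ⟨NB, hNB⟩ := drift hs ηB0 δ0
  -- lower drift constant
  obtain ⟨NA, hNA⟩ : ∃ NA : ℕ, 0 < r - ε/2 → ∀ n ≥ NA, ∀ k : ℕ, δ * n ≤ k → 0 < k →
      |(Real.log (u (n+k)) - L * (n+k:ℕ)) - (Real.log (u n) - L * n)|
        < (-L - Real.log (r - ε/2)) * k := by
    by_cases h : 0 < r - ε/2
    · have : 0 < -L - Real.log (r - ε/2) := by
        have := Real.log_lt_log h (show r - ε/2 < r by linarith)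
        rw [logr] at this; linarith
      obtain ⟨N, hN⟩ := drift hs this δ0
      exact ⟨N, fun _ => hN⟩
    · exact ⟨0, fun h' => absurd h' h⟩
  obtain ⟨N1, hN1⟩ := exists_nat_gt (1/δ)
  refine ⟨2 * (N0 + NA + NB) + N1 + 1, fun n hn => ?_⟩
  have nN1 : 1 / δ < n := hN1.trans_le (by exact_mod_cast (by omega : N1 ≤ n))
  have nδ : 1 < δ * n := by rwa [div_lt_iff₀' δ0] at nN1
  have n0 : (0:ℝ) < n := by exact_mod_cast (by omega : 0 < n)
  set k := ⌈δ * n⌉₊ with hk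
  have k1 : δ * n ≤ k := Nat.le_ceil _
  have k2 : (k:ℝ) ≤ 2 * (δ * n) := by
    have := Nat.ceil_lt_add_one (show 0 ≤ δ * n by positivity)
    rw [← hk] at this; linarith
  have k0 : 0 < k := by
    have : (0:ℝ) < k := by linarith
    exact_mod_cast this
  have k3 : 2 * k ≤ n := by
    have : (2:ℝ) * k ≤ n := by nlinarith
    exact_mod_cast this
  have kr0 : (0:ℝ) < k := by exact_mod_cast k0
  rw [Real.dist_eq, abs_lt]
  constructor
  · by_contra hcon
    have hxn : x n ≤ r - ε := by linarith
    have xp := xpos n (by omega)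
    have hc : 0 < r - ε/2 := by linarith
    have hd := hNA hc n (by omega) k k1 k0
    have hA := prodA (r - ε/2) n k (by omega) hc.le (fun i hi => by
      have h1 := xk n (by omega) i
      have h2 : (i:ℝ) / ((n:ℝ)+1) ≤ 2 * δ := by
        rw [div_le_iff₀ (by positivity)]
        have : (i:ℝ) ≤ k := by exact_mod_cast hi.le
        nlinarith
      linarith)
    have p1 := hpos n (by omega)
    have p2 := hpos (n+k) (by omega)
    have hlog := Real.log_le_log p1 hA
    rw [Real.log_mul (by positivity) p2.ne', Real.log_pow] at hlog
    have := (abs_lt.1 hd).2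
    push_cast at this
    nlinarith
  · by_contra hcon
    have hxn : r + ε ≤ x n := by linarith
    obtain ⟨m, hm⟩ : ∃ m, n = m + k := ⟨n - k, by omega⟩
    have hmn : (n:ℝ) = m + k := by exact_mod_cast hm
    have hd := hNB m (by omega) k (by nlinarith) k0
    have hA := prodB (r + ε/2) m k (by omega) (by positivity) (fun i hi => by
      have h1 := xk (m+i) (by omega) (k-i)
      have e1 : m + i + (k - i) = n := by omega
      rw [e1] at h1
      have h2 : ((k-i:ℕ):ℝ) / (((m+i:ℕ):ℝ)+1) ≤ 4 * δ := by
        rw [div_le_iff₀ (by positivity)]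
        have a1 : ((k-i:ℕ):ℝ) ≤ k := by exact_mod_cast Nat.sub_le _ _
        have a2 : (m:ℝ) ≤ ((m+i:ℕ):ℝ) := by exact_mod_cast Nat.le_add_right _ _
        have a3 : (n:ℝ) ≤ 2 * m := by exact_mod_cast (by omega : n ≤ 2 * m)
        nlinarith
      linarith)
    have p1 := hpos m (by omega)
    have p2 := hpos (m+k) (by omega)
    have hlog := Real.log_le_log (by positivity) hA
    rw [Real.log_mul (by positivity) p2.ne', Real.log_pow] at hlog
    have := (abs_lt.1 hd).1
    push_cast at this
    nlinarith

end SBx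

namespace SBx

open Filter Topology

def δ0 : Fn := fun p => if p = (0, 0) then 1 else 0

/-- binomial moments of the walk counts -/
def qq (n : ℕ) : Fn := (B ^ n) δ0

theorem qq_zero : qq 0 = δ0 := by simp [qq]

theorem qq_succ (n : ℕ) : qq (n+1) = B (qq n) := by
  simp only [qq, pow_succ', Module.End.mul_apply]

theorem Bn_mono {f g : Fn} (h : f ≤ g) (n : ℕ) : (B ^ n) f ≤ (B ^ n) g := by
  induction n with
  | zero => simpa using h
  | succ n ih => rw [pow_succ', Module.End.mul_apply, Module.End.mul_apply]; exact B_mono ih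

theorem δ0_nonneg : (0 : Fn) ≤ δ0 := fun p => by
  simp only [δ0, Pi.zero_apply]; split_ifs <;> norm_num

theorem qq_nonneg (n : ℕ) : 0 ≤ qq n := by
  have := Bn_mono δ0_nonneg n
  simpa [qq] using this

theorem qq_expand (p : ℕ × ℕ) (n : ℕ) :
    qq n p = ∑ k ∈ Finset.range (n+1), (n.choose k : ℝ) * 2 ^ (n-k) * (B0 ^ k) δ0 p := by
  have hcomm : Commute B0 ((2:ℝ) • (1 : Module.End ℝ Fn)) :=
    (Commute.one_right B0).smul_right 2
  have h : B ^ n = ∑ k ∈ Finset.range (n+1), B0 ^ k * ((2:ℝ) • (1 : Module.End ℝ Fn)) ^ (n-k)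
      * (n.choose k : Module.End ℝ Fn) := by
    rw [← hcomm.add_pow, add_comm]; rfl
  rw [qq, h, LinearMap.sum_apply, Finset.sum_apply]
  apply Finset.sum_congr rfl
  intro k _
  rw [smul_pow, one_pow, ← Nat.smul_one_eq_cast, mul_smul_comm, mul_smul_comm, mul_one, mul_one]
  simp only [LinearMap.smul_apply, nsmul_eq_mul]
  simp
  ring

theorem le_BE {f : Fn} (h : 0 ≤ f) (i j : ℕ) : f (i+1, j) ≤ B f (i, j) := by
  rw [B_apply]
  have h1 : 0 ≤ f (i, j) := h _
  have h2 : 0 ≤ f (i, j+1) := h _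
  have h3 := dW_nonneg h (i, j)
  have h4 := dS_nonneg h (i, j)
  simp only; linarith

theorem le_BN {f : Fn} (h : 0 ≤ f) (i j : ℕ) : f (i, j+1) ≤ B f (i, j) := by
  rw [B_apply]
  have h1 : 0 ≤ f (i, j) := h _
  have h2 : 0 ≤ f (i+1, j) := h _
  have h3 := dW_nonneg h (i, j)
  have h4 := dS_nonneg h (i, j)
  simp only; linarith

theorem le_B2 {f : Fn} (h : 0 ≤ f) (p : ℕ × ℕ) : 2 * f p ≤ B f p := by
  rw [B_apply]
  obtain ⟨i, j⟩ := p
  have h1 : 0 ≤ f (i, j+1) := h _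
  have h2 : 0 ≤ f (i+1, j) := h _
  have h3 := dW_nonneg h (i, j)
  have h4 := dS_nonneg h (i, j)
  simp only; linarith

theorem le_BW {f : Fn} (h : 0 ≤ f) (i j : ℕ) : f (i, j) ≤ B f (i+1, j) := by
  rw [B_apply]
  have h1 : 0 ≤ f (i+1, j) := h _
  have h2 : 0 ≤ f (i+1, j+1) := h _
  have h3 : 0 ≤ f (i+1+1, j) := h _
  have h5 : 0 ≤ f (i, j+1) := h _
  have h4 := dS_nonneg h (i+1, j)
  simp only [dW]; linarith

theorem le_BS {f : Fn} (h : 0 ≤ f) (i j : ℕ) : f (i, j) ≤ B f (i, j+1) := by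
  rw [B_apply]
  have h1 : 0 ≤ f (i, j+1) := h _
  have h2 : 0 ≤ f (i, j+1+1) := h _
  have h3 : 0 ≤ f (i+1, j+1) := h _
  have h4 := dW_nonneg h (i, j+1)
  simp only [dS]; linarith

theorem qq_le_zero (n i j : ℕ) : qq n (i, j) ≤ qq (n + (i + j)) (0, 0) := by
  induction i generalizing n with
  | zero =>
    induction j generalizing n with
    | zero => simp
    | succ j ih =>
      have h1 : qq n (0, j+1) ≤ qq (n+1) (0, j) := by rw [qq_succ]; exact le_BN (qq_nonneg n) 0 j
      have h2 := ih (n+1)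
      rw [show n + (0 + (j+1)) = n + 1 + (0 + j) by omega]
      exact h1.trans h2
  | succ i ih =>
    have h1 : qq n (i+1, j) ≤ qq (n+1) (i, j) := by rw [qq_succ]; exact le_BE (qq_nonneg n) i j
    have h2 := ih (n+1)
    rw [show n + (i + 1 + j) = n + 1 + (i + j) by omega]
    exact h1.trans h2

theorem zero_le_qq (n i j : ℕ) : qq n (0, 0) ≤ qq (n + (i + j)) (i, j) := by
  induction i with
  | zero =>
    induction j with
    | zero => simp
    | succ j ih =>
      refine ih.trans ?_
      rw [show n + (0 + (j+1)) = (n + (0 + j)) + 1 by omega, qq_succ]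
      exact le_BS (qq_nonneg _) 0 j
  | succ i ih =>
    refine ih.trans ?_
    rw [show n + (i + 1 + j) = (n + (i + j)) + 1 by omega, qq_succ]
    exact le_BW (qq_nonneg _) i j

theorem qq_pow2 (n : ℕ) : (2:ℝ) ^ n ≤ qq n (0, 0) := by
  induction n with
  | zero => simp [qq_zero, δ0]
  | succ n ih =>
    rw [qq_succ, pow_succ]
    have := le_B2 (qq_nonneg n) (0, 0)
    linarith

theorem qq_one_le (n : ℕ) : 1 ≤ qq n (0, 0) := (one_le_pow₀ (by norm_num)).trans (qq_pow2 n)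

theorem qq_pos (n : ℕ) : 0 < qq n (0, 0) := one_pos.trans_le (qq_one_le n)

theorem qq_pos' (p : ℕ × ℕ) (n : ℕ) (hn : n ≥ p.1 + p.2) : 0 < qq n p := by
  have := zero_le_qq (n - (p.1 + p.2)) p.1 p.2
  rw [show n - (p.1 + p.2) + (p.1 + p.2) = n by omega] at this
  exact (qq_pos _).trans_le this

theorem qq_supermul (m n : ℕ) : qq m (0, 0) * qq n (0, 0) ≤ qq (m + n) (0, 0) := by
  have h : qq n (0, 0) • δ0 ≤ qq n := by
    intro p
    simp only [Pi.smul_apply, δ0, smul_eq_mul]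
    split_ifs with hp
    · rw [hp, mul_one]
    · rw [mul_zero]; exact qq_nonneg n p
  have := Bn_mono h m (0, 0)
  rw [map_smul] at this
  have e : qq (m + n) = (B ^ m) (qq n) := by
    simp only [qq, pow_add, Module.End.mul_apply]
  rw [e]
  simpa [qq, mul_comm] using this

theorem qq_le_S {x y : ℝ} (hx : 0 < x) (hy : 0 < y) (n : ℕ) :
    qq n (0, 0) ≤ (2 + x + y + x⁻¹ + y * x⁻¹ + y⁻¹) ^ n := by
  set S := 2 + x + y + x⁻¹ + y * x⁻¹ + y⁻¹ with hS
  have S0 : 0 < S := by positivity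
  set e : Fn := fun p => x ^ p.1 * y ^ p.2 with he
  have hB : B e ≤ S • e := by
    intro p
    obtain ⟨i, j⟩ := p
    rw [B_apply]
    have hW : dW e (i, j) ≤ (x⁻¹ + y * x⁻¹) * e (i, j) := by
      cases i with
      | zero => simp only [dW, he]; positivity
      | succ i =>
        simp only [dW, he]
        apply le_of_eq
        field_simp
        ring
    have hSS : dS e (i, j) ≤ y⁻¹ * e (i, j) := by
      cases j with
      | zero => simp only [dS, he]; positivity
      | succ j =>
        simp only [dS, he]
        apply le_of_eq
        field_simp
        ring
    have h1 : e (i+1, j) = x * e (i, j) := by simp only [he]; ring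
    have h2 : e (i, j+1) = y * e (i, j) := by simp only [he]; ring
    simp only [Pi.smul_apply, smul_eq_mul]
    rw [h1, h2, hS]
    nlinarith
  have key : ∀ n, qq n ≤ S ^ n • e := by
    intro n
    induction n with
    | zero =>
      intro p
      rw [qq_zero]
      simp only [δ0, pow_zero, one_smul, he]
      split_ifs with hp
      · rw [hp]; simp
      · positivity
    | succ n ih =>
      rw [qq_succ]
      refine (B_mono ih).trans ?_
      rw [map_smul, pow_succ, mul_smul]
      exact smul_le_smul_of_nonneg_left hB (by positivity)
  have := key n (0, 0)
  simpa [he] using this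

theorem qq_cs (p : ℕ × ℕ) (n : ℕ) :
    2 * ((n:ℝ)+2) * qq (n+1) p ^ 2 ≤ qq (n+2) p * (2 * ((n:ℝ)+1) * qq n p + qq (n+1) p) :=
  cs_ineq (fun k => (B0 ^ k) δ0 p) (fun k => B0_pow_nonneg δ0_nonneg k p) (fun n => qq n p)
    (fun n => qq_expand p n) n

theorem exists_L : ∃ L : ℝ, Tendsto (fun n : ℕ => Real.log (qq n (0, 0)) / n) atTop (𝓝 L) := by
  have hsub : Subadditive (fun n => -Real.log (qq n (0, 0))) := by
    intro m n
    have h := Real.log_le_log (mul_pos (qq_pos m) (qq_pos n)) (qq_supermul m n)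
    rw [Real.log_mul (qq_pos m).ne' (qq_pos n).ne'] at h
    linarith
  have hb : BddBelow (Set.range (fun n : ℕ => -Real.log (qq n (0, 0)) / n)) := by
    refine ⟨-Real.log 7, ?_⟩
    rintro _ ⟨n, rfl⟩
    have h := Real.log_le_log (qq_pos n) (qq_le_S one_pos one_pos n)
    rw [Real.log_pow] at h
    norm_num at h
    rcases Nat.eq_zero_or_pos n with h0 | h0
    · subst h0; simp; exact Real.log_nonneg (by norm_num)
    · have : (0:ℝ) < n := by exact_mod_cast h0
      simp only
      rw [le_div_iff₀ this]
      linarith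
  have := (hsub.tendsto_lim hb).neg
  refine ⟨_, this.congr (fun n => ?_)⟩
  rw [neg_div, neg_neg]

/-- All ratio limits. -/
theorem exists_R : ∃ R M : ℝ, 0 < R ∧ 1 ≤ M ∧
    (∀ n, qq (n+1) (0, 0) ≤ M * qq n (0, 0)) ∧
    (∀ x y : ℝ, 0 < x → 0 < y → R ≤ 2 + x + y + x⁻¹ + y * x⁻¹ + y⁻¹) ∧
    ∀ p, Tendsto (fun n => qq (n+1) p / qq n p) atTop (𝓝 R) := by
  obtain ⟨L, hL⟩ := exists_L
  have inv : ∀ p : ℕ × ℕ, Tendsto (fun n : ℕ => Real.log (qq n p) / n) atTop (𝓝 L) →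
      Tendsto (fun n => qq (n+1) p / qq n p) atTop (𝓝 (Real.exp L)) := by
    intro p hp
    have h := ratio_limit (u := fun n => qq n p) (N0 := p.1 + p.2) (fun n hn => qq_pos' p n hn)
      (qq_cs p) hp
    have h2 := h.inv₀ (Real.exp_pos _).ne'
    rw [Real.exp_neg, inv_inv] at h2
    refine h2.congr (fun n => ?_)
    rw [inv_div]
  have h0 := inv (0, 0) hL
  obtain ⟨M, hM⟩ := h0.bddAbove_range
  have hM1 : ∀ n, qq (n+1) (0, 0) ≤ max M 1 * qq n (0, 0) := by
    intro n
    rw [← div_le_iff₀ (qq_pos n)]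
    exact (hM ⟨n, rfl⟩).trans (le_max_left _ _)
  refine ⟨Real.exp L, max M 1, Real.exp_pos _, le_max_right _ _, hM1, ?_, ?_⟩
  · intro x y hx hy
    have S0 : 0 < 2 + x + y + x⁻¹ + y * x⁻¹ + y⁻¹ := by positivity
    rw [← Real.le_log_iff_exp_le S0]
    refine le_of_tendsto hL ?_
    filter_upwards [eventually_gt_atTop 0] with n hn
    have h := Real.log_le_log (qq_pos n) (qq_le_S hx hy n)
    rw [Real.log_pow] at h
    have : (0:ℝ) < n := by exact_mod_cast hn
    rw [div_le_iff₀ this]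
    linarith
  · rintro ⟨i, j⟩
    apply inv
    set K := max M 1 with hK
    have K1 : 1 ≤ K := le_max_right _ _
    have K0 : 0 < K := one_pos.trans_le K1
    have up : ∀ k n, qq (n+k) (0, 0) ≤ K ^ k * qq n (0, 0) := by
      intro k n
      induction k with
      | zero => simp
      | succ k ih =>
        calc qq (n + (k+1)) (0, 0) ≤ K * qq (n+k) (0, 0) := hM1 (n+k)
          _ ≤ K * (K ^ k * qq n (0, 0)) := mul_le_mul_of_nonneg_left ih K0.le
          _ = _ := by ring
    have hz : Tendsto (fun n : ℕ => ((i+j:ℕ):ℝ) * Real.log K / n) atTop (𝓝 0) :=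
      tendsto_const_div_atTop_nhds_zero_nat _
    have lo : Tendsto (fun n : ℕ => Real.log (qq n (0, 0)) / n - ((i+j:ℕ):ℝ) * Real.log K / n)
        atTop (𝓝 L) := by simpa using hL.sub hz
    have hi : Tendsto (fun n : ℕ => Real.log (qq n (0, 0)) / n + ((i+j:ℕ):ℝ) * Real.log K / n)
        atTop (𝓝 L) := by simpa using hL.add hz
    refine tendsto_of_tendsto_of_tendsto_of_le_of_le' lo hi ?_ ?_
    · filter_upwards [eventually_ge_atTop (i+j)] with n hn
      rw [← sub_div]
      apply div_le_div_of_nonneg_right _ (Nat.cast_nonneg n)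
      obtain ⟨m, rfl⟩ : ∃ m, n = m + (i + j) := ⟨n - (i+j), by omega⟩
      have h1 := (up (i+j) m).trans (mul_le_mul_of_nonneg_left (zero_le_qq m i j) (by positivity))
      have h2 := Real.log_le_log (qq_pos _) h1
      rw [Real.log_mul (by positivity) (qq_pos' (i, j) _ (by simp)).ne', Real.log_pow] at h2
      linarith
    · filter_upwards [eventually_ge_atTop (i+j)] with n hn
      rw [← add_div]
      apply div_le_div_of_nonneg_right _ (Nat.cast_nonneg n)
      have h1 := (qq_le_zero n i j).trans (up (i+j) n)
      have h2 := Real.log_le_log (qq_pos' (i, j) n hn) h1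
      rw [Real.log_mul (by positivity) (qq_pos _).ne', Real.log_pow] at h2
      linarith

/-- The normalised binomial moments converge. -/
theorem exists_V : ∃ (M : ℝ) (V : Fn), 1 ≤ M ∧
    (∀ n i j, qq n (i, j) / qq n (0, 0) ≤ M ^ (i + j)) ∧
    ∀ p, Tendsto (fun n => qq n p / qq n (0, 0)) atTop (𝓝 (V p)) := by
  obtain ⟨R, M, hR, M1, hM, hmin, hrat⟩ := exists_R
  have M0 : 0 < M := one_pos.trans_le M1
  have up : ∀ k n, qq (n+k) (0, 0) ≤ M ^ k * qq n (0, 0) := by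
    intro k n
    induction k with
    | zero => simp
    | succ k ih =>
      calc qq (n + (k+1)) (0, 0) ≤ M * qq (n+k) (0, 0) := hM (n+k)
        _ ≤ M * (M ^ k * qq n (0, 0)) := mul_le_mul_of_nonneg_left ih M0.le
        _ = _ := by ring
  have bd : ∀ n i j, qq n (i, j) / qq n (0, 0) ≤ M ^ (i + j) := by
    intro n i j
    rw [div_le_iff₀ (qq_pos n)]
    exact (qq_le_zero n i j).trans (up _ _)
  set h : ℕ → Fn := fun n p => qq n p / qq n (0, 0) with hh
  have hK : ∀ n, h n ∈ Set.univ.pi (fun p : ℕ × ℕ => Set.Icc (0:ℝ) (M ^ (p.1 + p.2))) := by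
    intro n p _
    exact ⟨div_nonneg (qq_nonneg n p) (qq_pos n).le, bd n p.1 p.2⟩
  have hcomp : IsCompact (Set.univ.pi (fun p : ℕ × ℕ => Set.Icc (0:ℝ) (M ^ (p.1 + p.2)))) :=
    isCompact_univ_pi (fun p => isCompact_Icc)
  have key : ∀ U : Ultrafilter ℕ, (U : Filter ℕ) ≤ atTop → ∃ g ∈ KSet R, Tendsto h U (𝓝 g) := by
    intro U hU
    obtain ⟨g, hg, hUg⟩ := hcomp.ultrafilter_le_nhds (U.map h) (by
      rw [le_principal_iff, Ultrafilter.coe_map, Filter.mem_map]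
      exact Filter.univ_mem' (fun n => hK n))
    have hUg' : Tendsto h U (𝓝 g) := hUg
    have hp : ∀ p, Tendsto (fun n => h n p) U (𝓝 (g p)) := tendsto_pi_nhds.1 hUg'
    refine ⟨g, ⟨fun p => (hg p trivial).1, ?_, ?_⟩, hUg'⟩
    · refine tendsto_nhds_unique (hp (0, 0)) ?_
      have : (fun n => h n (0, 0)) = fun _ => 1 := by
        funext n; exact div_self (qq_pos n).ne'
      rw [this]; exact tendsto_const_nhds
    · funext p
      rw [P_apply]
      have t1 := B_tendsto hp p
      have t2 : Tendsto (fun n => qq (n+1) p / qq n p * h n p) U (𝓝 (R * g p)) :=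
        ((hrat p).mono_left hU).mul (hp p)
      have e : (fun n => B (h n) p) =ᶠ[U] fun n => qq (n+1) p / qq n p * h n p := by
        have : ∀ᶠ n in atTop, B (h n) p = qq (n+1) p / qq n p * h n p := by
          filter_upwards [eventually_ge_atTop (p.1 + p.2)] with n hn
          have hq := qq_pos' p n hn
          have : h n = (qq n (0, 0))⁻¹ • qq n := by
            funext p; simp only [hh, Pi.smul_apply, smul_eq_mul]; ring
          rw [this, map_smul, ← qq_succ]
          simp only [Pi.smul_apply, smul_eq_mul]
          field_simp
        exact hU this
      have := tendsto_nhds_unique (t1.congr' e) t2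
      rw [this, inv_mul_cancel_left₀ hR.ne']
  obtain ⟨V, hVK, -⟩ := key (Ultrafilter.of atTop) (Ultrafilter.of_le _)
  refine ⟨M, V, M1, bd, ?_⟩
  have : Tendsto h atTop (𝓝 V) := by
    rw [tendsto_iff_ultrafilter]
    intro U hU
    obtain ⟨g, hg, hgt⟩ := key U hU
    rw [K_unique hR hmin hVK hg]
    exact hgt
  exact tendsto_pi_nhds.1 this

end SBx

namespace SBx

open Filter Topology

theorem summable_choose_geom {r : ℝ} (hr0 : 0 < r) (hr : r < 1) (i : ℕ) :
    Summable (fun h : ℕ => r ^ h * (h.choose i : ℝ)) := by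
  have hs := summable_pow_mul_geometric_of_norm_lt_one (R := ℝ) i
    (r := r) (by rw [Real.norm_of_nonneg hr0.le]; exact hr)
  refine Summable.of_nonneg_of_le (fun h => by positivity) (fun h => ?_) hs
  rw [mul_comm]
  apply mul_le_mul_of_nonneg_right _ (by positivity)
  exact_mod_cast Nat.choose_le_pow h i

theorem moment_inj {μ : ℕ → ℝ} {C r : ℝ} (hr0 : 0 < r) (hr : r < 1)
    (hμ : ∀ h, |μ h| ≤ C * r ^ h) (hm : ∀ i, ∑' h, μ h * (h.choose i : ℝ) = 0) : μ = 0 := by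
  have hC : 0 ≤ C := by have := (abs_nonneg _).trans (hμ 0); simpa using this
  set p := FormalMultilinearSeries.ofScalars ℝ μ with hp
  set ρ : NNReal := ⟨r⁻¹, (inv_pos.2 hr0).le⟩ with hρ
  have hρv : (ρ : ℝ) = r⁻¹ := rfl
  have hrad : (ρ : ENNReal) ≤ p.radius := by
    apply p.le_radius_of_bound C
    intro n
    rw [hp, FormalMultilinearSeries.ofScalars_norm, Real.norm_eq_abs, hρv]
    calc |μ n| * r⁻¹ ^ n ≤ C * r ^ n * r⁻¹ ^ n :=
          mul_le_mul_of_nonneg_right (hμ n) (by positivity)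
      _ = C := by rw [mul_assoc, ← mul_pow, mul_inv_cancel₀ hr0.ne', one_pow, mul_one]
  have hρ0 : (0 : ENNReal) < ρ := by
    rw [ENNReal.coe_pos, ← NNReal.coe_pos, hρv]; exact inv_pos.2 hr0
  have hps := p.hasFPowerSeriesOnBall (hρ0.trans_le hrad)
  have hball : ∀ x ∈ Metric.ball (0:ℝ) r⁻¹, x ∈ Metric.eball (0:ℝ) p.radius := by
    intro x hx
    rw [Metric.mem_eball]
    refine lt_of_lt_of_le ?_ hrad
    rw [edist_lt_coe, ← NNReal.coe_lt_coe, hρv, coe_nndist]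
    exact hx
  have han : AnalyticOnNhd ℝ p.sum (Metric.ball (0:ℝ) r⁻¹) := fun x hx =>
    hps.analyticOnNhd x (hball x hx)
  have h1r : 1 < r⁻¹ := (one_lt_inv₀ hr0).2 hr
  have hev : p.sum =ᶠ[𝓝 1] 0 := by
    rw [Filter.EventuallyEq, Metric.eventually_nhds_iff]
    refine ⟨r⁻¹ - 1, by linarith, fun y hy => ?_⟩
    set z := y - 1 with hz
    have hz1 : |z| < r⁻¹ - 1 := by rw [Real.dist_eq] at hy; exact hy
    have hyz : y = z + 1 := by rw [hz]; ring
    have hsum : p.sum y = ∑' h, μ h * y ^ h := by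
      have := congrFun (FormalMultilinearSeries.ofScalarsSum_eq_tsum (𝕜 := ℝ) (E := ℝ) (c := μ)) y
      simpa [FormalMultilinearSeries.ofScalarsSum, hp] using this
    have S : Summable (fun x : ℕ × ℕ => μ x.1 * ((x.1.choose x.2 : ℝ) * z ^ x.2)) := by
      rw [← summable_norm_iff]
      rw [summable_prod_of_nonneg (fun _ => norm_nonneg _)]
      have fin : ∀ h : ℕ, HasSum (fun i : ℕ => ‖μ h * ((h.choose i : ℝ) * z ^ i)‖)
          (|μ h| * (|z| + 1) ^ h) := by
        intro h
        have e : |μ h| * (|z| + 1) ^ h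
            = ∑ i ∈ Finset.range (h+1), ‖μ h * ((h.choose i : ℝ) * z ^ i)‖ := by
          rw [add_pow, Finset.mul_sum]
          apply Finset.sum_congr rfl
          intro i _
          simp [abs_mul, mul_comm]
        rw [e]
        apply hasSum_sum_of_ne_finset_zero
        intro i hi
        have : h < i := by simpa using hi
        simp [Nat.choose_eq_zero_of_lt this]
      refine ⟨fun h => (fin h).summable, ?_⟩
      simp only [(fin _).tsum_eq]
      have hq : r * (|z| + 1) < 1 := by
        have : |z| + 1 < r⁻¹ := by linarith
        calc r * (|z| + 1) < r * r⁻¹ := mul_lt_mul_of_pos_left this hr0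
          _ = 1 := mul_inv_cancel₀ hr0.ne'
      have hg := (summable_geometric_of_lt_one (by positivity) hq).mul_left C
      refine Summable.of_nonneg_of_le (fun h => by positivity) (fun h => ?_) hg
      rw [mul_pow, ← mul_assoc]
      exact mul_le_mul_of_nonneg_right (hμ h) (by positivity)
    have e1 : ∀ h : ℕ, μ h * y ^ h = ∑' i : ℕ, μ h * ((h.choose i : ℝ) * z ^ i) := by
      intro h
      rw [tsum_eq_sum (s := Finset.range (h+1))]
      · rw [hyz, add_pow, Finset.mul_sum]
        apply Finset.sum_congr rfl
        intro i _
        simp [mul_comm]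
      · intro i hi
        have : h < i := by simpa using hi
        simp [Nat.choose_eq_zero_of_lt this]
    rw [hsum]
    simp only [e1]
    rw [← Summable.tsum_comm (f := fun h i => μ h * ((h.choose i : ℝ) * z ^ i)) S]
    simp only [← mul_assoc]
    simp only [tsum_mul_right, hm]
    simp
  have hzero := han.eqOn_zero_of_preconnected_of_eventuallyEq_zero
    (convex_ball (0:ℝ) r⁻¹).isPreconnected (z₀ := 1) (by simpa using h1r) hev
  have hev0 : p.sum =ᶠ[𝓝 0] 0 := by
    filter_upwards [Metric.ball_mem_nhds (0:ℝ) (inv_pos.2 hr0)] with x hx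
    exact hzero hx
  have := hps.hasFPowerSeriesAt.eq_zero_of_eventually hev0
  exact (FormalMultilinearSeries.ofScalars_series_eq_zero ℝ).1 this

theorem summable_phi {r : ℝ} (hr0 : 0 < r) (hr : r < 1) (C : ℝ) (i j : ℕ) :
    Summable (fun p : ℕ × ℕ => C * r ^ (p.1 + p.2) * ((p.1.choose i : ℝ) * (p.2.choose j : ℝ))) := by
  have := (Summable.mul_of_nonneg (summable_choose_geom hr0 hr i) (summable_choose_geom hr0 hr j)
    (fun h => by positivity) (fun h => by positivity)).mul_left C
  refine this.congr (fun p => ?_)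
  rw [pow_add]; ring

theorem moment_inj2 {μ : ℕ × ℕ → ℝ} {C r : ℝ} (hr0 : 0 < r) (hr : r < 1)
    (hμ : ∀ p, |μ p| ≤ C * r ^ (p.1 + p.2))
    (hm : ∀ i j, ∑' p : ℕ × ℕ, μ p * ((p.1.choose i : ℝ) * (p.2.choose j : ℝ)) = 0) : μ = 0 := by
  have S : ∀ i j : ℕ, Summable (fun p : ℕ × ℕ => μ p * ((p.1.choose i : ℝ) * (p.2.choose j : ℝ))) := by
    intro i j
    refine Summable.of_norm_bounded (summable_phi hr0 hr C i j) (fun p => ?_)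
    rw [norm_mul, Real.norm_eq_abs, Real.norm_of_nonneg (by positivity)]
    exact mul_le_mul_of_nonneg_right (hμ p) (by positivity)
  have inner : ∀ j h, ∑' l : ℕ, μ (h, l) * (l.choose j : ℝ) = 0 := by
    intro j
    set σ : ℕ → ℝ := fun h => ∑' l : ℕ, μ (h, l) * (l.choose j : ℝ) with hσ
    have hb := (summable_choose_geom hr0 hr j).mul_left C
    have : σ = 0 := by
      refine moment_inj (C := ∑' l : ℕ, C * (r ^ l * (l.choose j : ℝ))) hr0 hr (fun h => ?_)
        (fun i => ?_)
      · rw [← Real.norm_eq_abs]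
        have hb' := hb.mul_right (r ^ h)
        have := tsum_of_norm_bounded (f := fun l : ℕ => μ (h, l) * (l.choose j : ℝ)) hb'.hasSum
          (fun l => by
            rw [norm_mul, Real.norm_eq_abs, Real.norm_of_nonneg (by positivity)]
            have := mul_le_mul_of_nonneg_right (hμ (h, l)) (show (0:ℝ) ≤ l.choose j by positivity)
            refine this.trans (le_of_eq ?_)
            simp only [pow_add]; ring)
        rw [tsum_mul_right] at this
        exact this
      · have h1 := hm i j
        rw [(S i j).tsum_prod] at h1
        rw [← h1]
        apply tsum_congr
        intro h
        simp only [hσ]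
        rw [← tsum_mul_right]
        apply tsum_congr
        intro l
        ring
    intro h
    exact congrFun this h
  funext p
  obtain ⟨h, l⟩ := p
  have : (fun l => μ (h, l)) = 0 := by
    refine moment_inj (C := C * r ^ h) hr0 hr (fun l => ?_) (fun j => inner j h)
    have := hμ (h, l)
    simp only [pow_add] at this
    linarith
  exact congrFun this l

/-- one step of the walk, as a vector of children -/
def col (c : ℕ × ℕ) : (ℕ × ℕ) →₀ ℝ :=
  (∑ h ∈ Finset.range c.1, Finsupp.single (h, c.2) 1) + Finsupp.single (c.1, c.2 + 1) 1
    + ∑ l ∈ Finset.range (c.2 + 1), Finsupp.single (c.1 + 1, l) 1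

def Step (c p : ℕ × ℕ) : Prop :=
  (p.1 < c.1 ∧ p.2 = c.2) ∨ (p.1 = c.1 ∧ p.2 = c.2 + 1) ∨ (p.1 = c.1 + 1 ∧ p.2 ≤ c.2)

theorem col_apply (c p : ℕ × ℕ) : col c p = if Step c p then 1 else 0 := by
  obtain ⟨h, l⟩ := c
  obtain ⟨a, b⟩ := p
  simp only [col, Finsupp.add_apply, Finsupp.finsetSum_apply, Finsupp.single_apply, Prod.mk.injEq]
  have e1 : ∑ x ∈ Finset.range h, (if x = a ∧ l = b then (1:ℝ) else 0)
      = if a < h ∧ b = l then 1 else 0 := by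
    by_cases hb : l = b
    · subst hb
      simp [Finset.sum_ite_eq']
    · have : b ≠ l := fun h => hb h.symm
      simp [hb, this]
  have e2 : ∑ x ∈ Finset.range (l+1), (if h + 1 = a ∧ x = b then (1:ℝ) else 0)
      = if a = h + 1 ∧ b ≤ l then 1 else 0 := by
    by_cases hb : h + 1 = a
    · subst hb
      simp [Finset.sum_ite_eq', Nat.lt_succ_iff]
    · have : a ≠ h + 1 := fun h => hb h.symm
      simp [hb, this]
  rw [e1, e2]
  by_cases hS : Step (h, l) (a, b)
  · rw [if_pos hS]
    simp only [Step] at hS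
    split_ifs <;> first | omega | norm_num
  · rw [if_neg hS]
    simp only [Step] at hS
    split_ifs <;> first | omega | norm_num

/-- the number of `m`-step walks from the origin -/
def cnt : ℕ → ((ℕ × ℕ) →₀ ℝ)
  | 0 => Finsupp.single (0, 0) 1
  | m + 1 => Finsupp.linearCombination ℝ col (cnt m)

def Phi (p : ℕ × ℕ) : Fn := fun q => (p.1.choose q.1 : ℝ) * (p.2.choose q.2 : ℝ)

theorem sum_choose (i n : ℕ) : ∑ h ∈ Finset.range n, (h.choose i : ℝ) = n.choose (i+1) := by
  induction n with
  | zero => simp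
  | succ n ih => rw [Finset.sum_range_succ, ih, Nat.choose_succ_succ]; push_cast; ring

theorem Phi_col (c : ℕ × ℕ) : Finsupp.linearCombination ℝ Phi (col c) = B (Phi c) := by
  obtain ⟨h, l⟩ := c
  simp only [col, map_add, map_sum, Finsupp.linearCombination_single, one_smul]
  funext q
  obtain ⟨i, j⟩ := q
  rw [B_apply]
  simp only [Pi.add_apply, Finset.sum_apply, Phi]
  rw [← Finset.sum_mul, ← Finset.mul_sum, sum_choose, sum_choose]
  cases i <;> cases j <;> simp only [dW, dS, Phi, Nat.choose_succ_succ, Nat.choose_zero_right] <;>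
    push_cast <;> ring

theorem cnt_moment (m : ℕ) : Finsupp.linearCombination ℝ Phi (cnt m) = qq m := by
  induction m with
  | zero =>
    rw [qq_zero]
    simp only [cnt, Finsupp.linearCombination_single, one_smul]
    funext q
    obtain ⟨i, j⟩ := q
    cases i <;> cases j <;> simp [Phi, δ0]
  | succ m ih =>
    rw [qq_succ, ← ih]
    simp only [cnt]
    generalize cnt m = f
    induction f using Finsupp.induction_linear with
    | zero => simp
    | add f g hf hg => simp only [map_add, hf, hg]
    | single c x =>
      simp only [Finsupp.linearCombination_single, map_smul, Phi_col]

theorem cnt_succ_apply (m : ℕ) (p : ℕ × ℕ) :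
    cnt (m+1) p = ∑ c ∈ (cnt m).support, if Step c p then cnt m c else 0 := by
  simp only [cnt, Finsupp.linearCombination_apply, Finsupp.sum, Finsupp.finsetSum_apply,
    Finsupp.smul_apply, smul_eq_mul, col_apply]
  apply Finset.sum_congr rfl
  intro c _
  split_ifs <;> simp

theorem cnt_nonneg (m : ℕ) (p : ℕ × ℕ) : 0 ≤ cnt m p := by
  induction m generalizing p with
  | zero => simp only [cnt, Finsupp.single_apply]; split_ifs <;> norm_num
  | succ m ih =>
    rw [cnt_succ_apply]
    apply Finset.sum_nonneg
    intro c _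
    split_ifs
    · exact ih c
    · exact le_rfl

theorem cnt_tsum (m : ℕ) (q : ℕ × ℕ) : ∑' p, cnt m p * Phi p q = qq m q := by
  rw [← cnt_moment, Finsupp.linearCombination_apply, Finsupp.sum, Finset.sum_apply,
    tsum_eq_sum (s := (cnt m).support)]
  · rfl
  · intro p hp
    rw [Finsupp.notMem_support_iff.1 hp, zero_mul]

theorem cnt_le (m : ℕ) (p q : ℕ × ℕ) : cnt m p * Phi p q ≤ qq m q := by
  rw [← cnt_tsum]
  have hs : Summable (fun p => cnt m p * Phi p q) := by
    apply summable_of_ne_finset_zero (s := (cnt m).support)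
    intro p hp
    rw [Finsupp.notMem_support_iff.1 hp, zero_mul]
  exact hs.le_tsum p (fun p _ => mul_nonneg (cnt_nonneg m p) (by simp only [Phi]; positivity))

theorem geom_half (s M : ℝ) (h : s * M = 1/2) (n : ℕ) :
    ∑ i ∈ Finset.range n, s ^ i * M ^ i ≤ 2 := by
  simp only [← mul_pow, h]
  have := (summable_geometric_two).sum_le_tsum (Finset.range n) (fun i _ => by positivity)
  rwa [tsum_geometric_two] at this

/-- Convergence of the endpoint law to a probability measure. -/
theorem endpoint_limit : ∃ π : ℕ × ℕ → ℝ,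
    (∀ p, Tendsto (fun n => cnt n p / qq n (0, 0)) atTop (𝓝 (π p))) ∧ ∑' p, π p = 1 := by
  obtain ⟨M, V, M1, bd, hV⟩ := exists_V
  have M0 : 0 < M := one_pos.trans_le M1
  set s : ℝ := 1 / (2 * M) with hs
  have s0 : 0 < s := by positivity
  have sM : s * M = 1/2 := by rw [hs]; field_simp
  set r : ℝ := (1 + s)⁻¹ with hr
  have r0 : 0 < r := by positivity
  have r1 : r < 1 := inv_lt_one_of_one_lt₀ (by linarith)
  set Q : ℕ → ℕ × ℕ → ℝ := fun n p => cnt n p / qq n (0, 0) with hQ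
  have Q0 : ∀ n p, 0 ≤ Q n p := fun n p => div_nonneg (cnt_nonneg n p) (qq_pos n).le
  have Qle : ∀ n p, Q n p ≤ 4 * r ^ (p.1 + p.2) := by
    rintro n ⟨h, l⟩
    have h1 : ∀ i j, Q n (h, l) * ((h.choose i : ℝ) * (l.choose j : ℝ)) ≤ M ^ (i + j) := by
      intro i j
      refine le_trans ?_ (bd n i j)
      have := div_le_div_of_nonneg_right (cnt_le n (h, l) (i, j)) (qq_pos n).le
      refine le_trans (le_of_eq ?_) this
      simp only [hQ, Phi]; ring
    have e : Q n (h, l) * (1 + s) ^ (h + l) = ∑ i ∈ Finset.range (h+1), ∑ j ∈ Finset.range (l+1),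
        s ^ i * s ^ j * (Q n (h, l) * ((h.choose i : ℝ) * (l.choose j : ℝ))) := by
      rw [pow_add, add_comm 1 s, add_pow, add_pow, Finset.sum_mul_sum, Finset.mul_sum]
      apply Finset.sum_congr rfl
      intro i _
      rw [Finset.mul_sum]
      apply Finset.sum_congr rfl
      intro j _
      simp only [one_pow, mul_one]
      ring
    have le : Q n (h, l) * (1 + s) ^ (h + l) ≤ 4 := by
      rw [e]
      calc _ ≤ ∑ i ∈ Finset.range (h+1), ∑ j ∈ Finset.range (l+1),
            (s ^ i * M ^ i) * (s ^ j * M ^ j) := by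
            apply Finset.sum_le_sum
            intro i _
            apply Finset.sum_le_sum
            intro j _
            have := mul_le_mul_of_nonneg_left (h1 i j) (show 0 ≤ s ^ i * s ^ j by positivity)
            refine this.trans (le_of_eq ?_)
            rw [pow_add]; ring
        _ = (∑ i ∈ Finset.range (h+1), s ^ i * M ^ i) * (∑ j ∈ Finset.range (l+1), s ^ j * M ^ j) := by
            rw [Finset.sum_mul_sum]
        _ ≤ 2 * 2 := mul_le_mul (geom_half s M sM _) (geom_half s M sM _)
            (Finset.sum_nonneg (fun i _ => by positivity)) (by norm_num)
        _ = 4 := by norm_num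
    rw [hr, inv_pow, ← div_eq_mul_inv, le_div_iff₀ (by positivity)]
    exact le
  have Qm : ∀ n i j, ∑' p : ℕ × ℕ, Q n p * ((p.1.choose i : ℝ) * (p.2.choose j : ℝ))
      = qq n (i, j) / qq n (0, 0) := by
    intro n i j
    rw [← cnt_tsum n (i, j), ← tsum_div_const]
    apply tsum_congr
    intro p
    simp only [hQ, Phi]; ring
  have hcomp : IsCompact (Set.univ.pi (fun p : ℕ × ℕ => Set.Icc (0:ℝ) (4 * r ^ (p.1 + p.2)))) :=
    isCompact_univ_pi (fun p => isCompact_Icc)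
  have key : ∀ U : Ultrafilter ℕ, (U : Filter ℕ) ≤ atTop → ∃ g : ℕ × ℕ → ℝ,
      (∀ p, 0 ≤ g p ∧ g p ≤ 4 * r ^ (p.1 + p.2)) ∧
      (∀ i j, ∑' p : ℕ × ℕ, g p * ((p.1.choose i : ℝ) * (p.2.choose j : ℝ)) = V (i, j)) ∧
      Tendsto Q U (𝓝 g) := by
    intro U hU
    obtain ⟨g, hg, hUg⟩ := hcomp.ultrafilter_le_nhds (U.map Q) (by
      rw [le_principal_iff, Ultrafilter.coe_map, Filter.mem_map]
      exact Filter.univ_mem' (fun n p _ => ⟨Q0 n p, Qle n p⟩))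
    have hUg' : Tendsto Q U (𝓝 g) := hUg
    have hp : ∀ p, Tendsto (fun n => Q n p) U (𝓝 (g p)) := tendsto_pi_nhds.1 hUg'
    refine ⟨g, fun p => hg p trivial, fun i j => ?_, hUg'⟩
    have t1 := tendsto_tsum_of_dominated_convergence (𝓕 := (U : Filter ℕ))
      (f := fun n p => Q n p * ((p.1.choose i : ℝ) * (p.2.choose j : ℝ)))
      (summable_phi r0 r1 4 i j) (fun p => (hp p).mul_const _)
      (Filter.Eventually.of_forall (fun n p => by
        rw [Real.norm_of_nonneg (mul_nonneg (Q0 n p) (by positivity))]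
        exact mul_le_mul_of_nonneg_right (Qle n p) (by positivity)))
    simp only [Qm] at t1
    exact tendsto_nhds_unique t1 ((hV (i, j)).mono_left hU)
  obtain ⟨π, hπ0, hπm, -⟩ := key (Ultrafilter.of atTop) (Ultrafilter.of_le _)
  have hSum : ∀ g : ℕ × ℕ → ℝ, (∀ p, 0 ≤ g p ∧ g p ≤ 4 * r ^ (p.1 + p.2)) → ∀ i j,
      Summable (fun p : ℕ × ℕ => g p * ((p.1.choose i : ℝ) * (p.2.choose j : ℝ))) := by
    intro g hg i j
    refine Summable.of_nonneg_of_le (fun p => mul_nonneg (hg p).1 (by positivity)) (fun p => ?_)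
      (summable_phi r0 r1 4 i j)
    exact mul_le_mul_of_nonneg_right (hg p).2 (by positivity)
  refine ⟨π, ?_, ?_⟩
  · have : Tendsto Q atTop (𝓝 π) := by
      rw [tendsto_iff_ultrafilter]
      intro U hU
      obtain ⟨g, hg0, hgm, hgt⟩ := key U hU
      have : (fun p => π p - g p) = 0 := by
        refine moment_inj2 (C := 4) r0 r1 (fun p => ?_) (fun i j => ?_)
        · rw [abs_le]
          have := hg0 p
          have := hπ0 p
          constructor <;> linarith
        · simp only [sub_mul]
          rw [(hSum π hπ0 i j).tsum_sub (hSum g hg0 i j), hπm, hgm, sub_self]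
      have e : π = g := by
        funext p
        have := congrFun this p
        simp only [Pi.zero_apply] at this
        linarith
      rw [e]; exact hgt
    exact tendsto_pi_nhds.1 this
  · have h1 := hπm 0 0
    simp only [Nat.choose_zero_right, Nat.cast_one, mul_one] at h1
    rw [h1]
    refine tendsto_nhds_unique (hV (0, 0)) ?_
    have : (fun n => qq n (0, 0) / qq n (0, 0)) = fun _ => (1:ℝ) := by
      funext n; exact div_self (qq_pos n).ne'
    rw [this]; exact tendsto_const_nhds

end SBx

namespace SBx

open Filter Topology

def castP (p : ℕ × ℕ) : ℤ × ℤ := ((p.1 : ℤ), (p.2 : ℤ))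

theorem castP_inj : Function.Injective castP := by
  rintro ⟨a, b⟩ ⟨c, d⟩ h
  simp only [castP, Prod.mk.injEq, Nat.cast_inj] at h
  rw [h.1, h.2]

theorem root_facts {γ : ℝ} (hγ : γ^3 - γ^2 + 2*γ - 1 = 0) : 0 < γ ∧ 0 < sbθ γ ∧ 0 < sbα γ := by
  have g0 : 0 < γ := by
    by_contra h
    push Not at h
    nlinarith [sq_nonneg γ, mul_nonneg (sq_nonneg γ) (neg_nonneg.2 h)]
  have g1 : γ < 1 := by
    by_contra h
    push Not at h
    nlinarith [mul_nonneg (sq_nonneg γ) (sub_nonneg.2 h)]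
  have e1 : sbθ γ = 1 - γ := by
    unfold sbθ
    linear_combination (8 - 3 * γ) * hγ
  have e2 : sbα γ = (4 - 7*γ + 5*γ^2)/11 := by
    unfold sbα
    linear_combination (-32/11 + 12/11 * γ) * hγ
  refine ⟨g0, by rw [e1]; linarith, ?_⟩
  rw [e2]
  nlinarith [sq_nonneg (γ - 7/10)]

theorem pathFrom_succ (s : ℤ × ℤ) (f : ℕ → ℤ × ℤ) (k : ℕ) :
    pathFrom s f (k+1) = pathFrom (s + f 0) (fun i => f (i+1)) k := by
  induction k with
  | zero => rfl
  | succ k ih =>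
    rw [pathFrom, ih]; rfl

theorem extFin_cons_succ {m : ℕ} (d : ℤ × ℤ) (g : Fin m → ℤ × ℤ) :
    (fun i => extFin (Fin.cons d g : Fin (m+1) → ℤ × ℤ) (i+1)) = extFin g := by
  funext i
  simp only [extFin]
  by_cases h : i < m
  · rw [dif_pos h, dif_pos (by omega)]
    exact Fin.cons_succ (α := fun _ => ℤ × ℤ) d g ⟨i, h⟩
  · rw [dif_neg h, dif_neg (by omega)]

theorem extFin_cons_zero {m : ℕ} (d : ℤ × ℤ) (g : Fin m → ℤ × ℤ) :
    extFin (Fin.cons d g : Fin (m+1) → ℤ × ℤ) 0 = d := by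
  simp only [extFin]
  rw [dif_pos (by omega)]
  rfl

def EV (m : ℕ) (s : ℤ × ℤ) (g : Fin m → ℤ × ℤ) : Prop :=
  IsWalkSb (m+1) (fun k => pathFrom s (extFin g) (m - k))

theorem isWalk_congr {n : ℕ} {W W2 : ℕ → ℤ × ℤ} (h0 : 0 < n) (h : ∀ k < n, W k = W2 k) :
    IsWalkSb n W ↔ IsWalkSb n W2 := by
  unfold IsWalkSb
  rw [h 0 h0]
  constructor
  · rintro ⟨a, b, c⟩
    refine ⟨a, fun k hk => h k hk ▸ b k hk, fun k hk => ?_⟩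
    rw [← h k (by omega), ← h (k+1) hk]; exact c k hk
  · rintro ⟨a, b, c⟩
    refine ⟨a, fun k hk => (h k hk).symm ▸ b k hk, fun k hk => ?_⟩
    rw [h k (by omega), h (k+1) hk]; exact c k hk

theorem isWalk_succ (m : ℕ) (W : ℕ → ℤ × ℤ) :
    IsWalkSb (m+2) W ↔ IsWalkSb (m+1) W ∧ (0 ≤ (W (m+1)).1 ∧ 0 ≤ (W (m+1)).2) ∧
      W (m+1) - W m ∈ ISb := by
  unfold IsWalkSb
  constructor
  · rintro ⟨a, b, c⟩
    exact ⟨⟨a, fun k hk => b k (by omega), fun k hk => c k (by omega)⟩, b _ (by omega),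
      c m (by omega)⟩
  · rintro ⟨⟨a, b, c⟩, d, e⟩
    refine ⟨a, fun k hk => ?_, fun k hk => ?_⟩
    · rcases Nat.lt_or_ge k (m+1) with h | h
      · exact b k h
      · obtain rfl : k = m + 1 := by omega
        exact d
    · rcases Nat.lt_or_ge (k+1) (m+1) with h | h
      · exact c k h
      · obtain rfl : k = m := by omega
        exact e

theorem EV_succ (m : ℕ) (s d : ℤ × ℤ) (g : Fin m → ℤ × ℤ) :
    EV (m+1) s (Fin.cons d g) ↔ (0 ≤ s.1 ∧ 0 ≤ s.2) ∧ -d ∈ ISb ∧ EV m (s + d) g := by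
  unfold EV
  rw [isWalk_succ]
  have e : ∀ k, pathFrom s (extFin (Fin.cons d g : Fin (m+1) → ℤ × ℤ)) (k+1)
      = pathFrom (s + d) (extFin g) k := by
    intro k
    rw [pathFrom_succ, extFin_cons_succ, extFin_cons_zero]
  have h1 : IsWalkSb (m+1)
      (fun k => pathFrom s (extFin (Fin.cons d g : Fin (m+1) → ℤ × ℤ)) (m + 1 - k)) ↔
      IsWalkSb (m+1) (fun k => pathFrom (s + d) (extFin g) (m - k)) := by
    apply isWalk_congr (by omega)
    intro k hk
    rw [show m + 1 - k = (m - k) + 1 by omega, e]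
  have h2 : pathFrom s (extFin (Fin.cons d g : Fin (m+1) → ℤ × ℤ)) (m + 1 - (m + 1)) = s := by
    rw [Nat.sub_self]; rfl
  have h3 : pathFrom s (extFin (Fin.cons d g : Fin (m+1) → ℤ × ℤ)) (m + 1 - m) = s + d := by
    rw [show m + 1 - m = 0 + 1 by omega, e]; rfl
  rw [h1]
  simp only [h2, h3]
  rw [show s - (s + d) = -d by abel]
  tauto

theorem EV_zero (s : ℤ × ℤ) (g : Fin 0 → ℤ × ℤ) : EV 0 s g ↔ s = (0, 0) := by
  unfold EV IsWalkSb
  constructor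
  · rintro ⟨h, -, -⟩; exact h
  · rintro rfl
    refine ⟨rfl, fun k hk => ?_, fun k hk => by omega⟩
    have hk0 : k = 0 := by omega
    subst hk0
    exact ⟨le_rfl, le_rfl⟩

/-- walk counts on the full lattice -/
def aZ (m : ℕ) (s : ℤ × ℤ) : ℝ :=
  if 0 ≤ s.1 ∧ 0 ≤ s.2 then cnt m (s.1.toNat, s.2.toNat) else 0

theorem aZ_castP (m : ℕ) (p : ℕ × ℕ) : aZ m (castP p) = cnt m p := by
  simp [aZ, castP]

theorem aZ_nonneg (m : ℕ) (s : ℤ × ℤ) : 0 ≤ aZ m s := by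
  simp only [aZ]
  split_ifs
  · exact cnt_nonneg _ _
  · exact le_rfl

theorem aZ_of_notMem (m : ℕ) (s : ℤ × ℤ) (h : s ∉ Set.range castP) : aZ m s = 0 := by
  simp only [aZ]
  rw [if_neg]
  rintro ⟨h1, h2⟩
  exact h ⟨(s.1.toNat, s.2.toNat), by
    simp only [castP, Int.toNat_of_nonneg h1, Int.toNat_of_nonneg h2]⟩

theorem step_iff (c p : ℕ × ℕ) : castP p - castP c ∈ ISb ↔ Step c p := by
  obtain ⟨a, b⟩ := c
  obtain ⟨x, y⟩ := p
  simp only [ISb, Step, castP, Set.mem_ofPred_eq, Prod.mk_sub_mk, Prod.mk.injEq]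
  omega

theorem count_eq (m : ℕ) (s : ℤ × ℤ) :
    ∑' g : Fin m → ℤ × ℤ, (if EV m s g then (1 : ENNReal) else 0) = ENNReal.ofReal (aZ m s) := by
  induction m generalizing s with
  | zero =>
    rw [tsum_eq_single (fun i : Fin 0 => i.elim0) (fun g hg => absurd (Subsingleton.elim _ _) hg)]
    by_cases hs : s = (0, 0)
    · rw [if_pos ((EV_zero _ _).2 hs), hs]
      simp [aZ, cnt]
    · rw [if_neg (fun h => hs ((EV_zero _ _).1 h))]
      simp only [aZ]
      split_ifs with h
      · simp only [cnt, Finsupp.single_apply]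
        rw [if_neg]
        · simp
        · intro h'
          simp only [Prod.mk.injEq] at h'
          apply hs
          ext <;> simp <;> omega
      · simp
  | succ m ih =>
    rw [← (Fin.consEquiv (fun _ : Fin (m+1) => ℤ × ℤ)).tsum_eq, ENNReal.tsum_prod']
    have e1 : ∀ d : ℤ × ℤ, ∑' g : Fin m → ℤ × ℤ,
        (if EV (m+1) s ((Fin.consEquiv (fun _ : Fin (m+1) => ℤ × ℤ)) (d, g)) then (1 : ENNReal) else 0)
        = if (0 ≤ s.1 ∧ 0 ≤ s.2) ∧ -d ∈ ISb then ENNReal.ofReal (aZ m (s + d)) else 0 := by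
      intro d
      by_cases h : (0 ≤ s.1 ∧ 0 ≤ s.2) ∧ -d ∈ ISb
      · rw [if_pos h, ← ih]
        apply tsum_congr
        intro g
        have : EV (m+1) s ((Fin.consEquiv (fun _ : Fin (m+1) => ℤ × ℤ)) (d, g)) ↔ EV m (s+d) g := by
          have := EV_succ m s d g
          exact this.trans ⟨fun h => h.2.2, fun h' => ⟨h.1, h.2, h'⟩⟩
        simp only [this]
      · rw [if_neg h]
        rw [ENNReal.tsum_eq_zero]
        intro g
        rw [if_neg]
        intro h'
        have := (EV_succ m s d g).1 h'
        exact h ⟨this.1, this.2.1⟩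
    simp only [e1]
    rw [← (Equiv.subRight s).tsum_eq]
    simp only [Equiv.subRight_apply, neg_sub, add_sub_cancel]
    by_cases hs : 0 ≤ s.1 ∧ 0 ≤ s.2
    · obtain ⟨p, rfl⟩ : ∃ p, s = castP p := ⟨(s.1.toNat, s.2.toNat), by
        simp only [castP, Int.toNat_of_nonneg hs.1, Int.toNat_of_nonneg hs.2]⟩
      simp only [hs, true_and, and_self]
      rw [← castP_inj.tsum_eq]
      · simp only [step_iff, aZ_castP]
        rw [tsum_eq_sum (s := (cnt m).support), cnt_succ_apply, ENNReal.ofReal_sum_of_nonneg]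
        · apply Finset.sum_congr rfl
          intro c _
          split_ifs <;> simp
        · intro c _
          split_ifs
          · exact cnt_nonneg _ _
          · exact le_rfl
        · intro c hc
          rw [Finsupp.notMem_support_iff.1 hc]
          simp
      · intro c hc
        by_contra hcon
        apply hc
        simp only [aZ_of_notMem m c hcon]
        simp
    · simp [hs, aZ]

theorem count_real (m : ℕ) (s : ℤ × ℤ) :
    ∑' g : Fin m → ℤ × ℤ, (if EV m s g then (1 : ℝ) else 0) = aZ m s := by
  have h := congrArg ENNReal.toReal (count_eq m s)
  rw [ENNReal.toReal_ofReal (aZ_nonneg m s), ENNReal.tsum_toReal_eq] at h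
  · rw [← h]
    apply tsum_congr
    intro g
    split_ifs <;> simp
  · intro g
    split_ifs <;> simp

theorem tsum_aZ (m : ℕ) : ∑' s, aZ m s = qq m (0, 0) := by
  rw [← castP_inj.tsum_eq]
  · rw [← cnt_tsum]
    apply tsum_congr
    intro p
    rw [aZ_castP]
    simp [Phi]
  · intro c hc
    by_contra hcon
    exact hc (aZ_of_notMem m c hcon)

theorem revW_eq {γ : ℝ} (h1 : 0 < γ) (h2 : 0 < sbθ γ) (d : ℤ × ℤ) (hd : -d ∈ ISb) :
    revWSb γ d = sbα γ * (γ ^ d.1 * sbθ γ ^ d.2) := by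
  obtain ⟨a, b⟩ := d
  simp only [ISb, Set.mem_ofPred_eq, Prod.neg_mk, Prod.mk.injEq] at hd
  simp only [revWSb, Prod.mk.injEq]
  rcases hd with hd | hd | hd
  · rw [if_pos (by omega)]
    obtain ⟨n, rfl⟩ := Int.eq_ofNat_of_zero_le (show 0 ≤ a by omega)
    obtain rfl : b = 0 := by omega
    simp
  · rw [if_neg (by omega), if_pos (by omega)]
    obtain rfl : a = 0 := by omega
    obtain rfl : b = -1 := by omega
    simp
  · rw [if_neg (by omega), if_neg (by omega), if_pos (by omega)]
    obtain rfl : a = -1 := by omega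
    obtain ⟨n, rfl⟩ := Int.eq_ofNat_of_zero_le (show 0 ≤ b by omega)
    simp [mul_assoc]

theorem weight_eq {γ : ℝ} (h1 : 0 < γ) (h2 : 0 < sbθ γ) (m : ℕ) (s : ℤ × ℤ)
    (g : Fin m → ℤ × ℤ) (h : EV m s g) :
    (γ ^ s.1 * sbθ γ ^ s.2) * ∏ i, revWSb γ (g i) = sbα γ ^ m := by
  induction m generalizing s with
  | zero =>
    rw [(EV_zero _ _).1 h]; simp
  | succ m ih =>
    obtain ⟨d, g', rfl⟩ : ∃ d g', g = Fin.cons d g' := ⟨g 0, Fin.tail g, (Fin.cons_self_tail g).symm⟩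
    rw [EV_succ] at h
    have := ih _ _ h.2.2
    rw [Fin.prod_univ_succ]
    simp only [Fin.cons_zero, Fin.cons_succ]
    rw [revW_eq h1 h2 d h.2.1, pow_succ, ← this, Prod.fst_add, Prod.snd_add,
      zpow_add₀ h1.ne', zpow_add₀ h2.ne']
    ring

theorem walk_bound {n : ℕ} {W : ℕ → ℤ × ℤ} (h : IsWalkSb n W) (k : ℕ) (hk : k < n) :
    (W k).1 ≤ k ∧ (W k).2 ≤ k := by
  induction k with
  | zero => rw [h.1]; simp
  | succ k ih =>
    have h1 := ih (by omega)
    have h2 := h.2.2 k hk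
    simp only [ISb, Set.mem_ofPred_eq, Prod.fst_sub, Prod.snd_sub, Prod.ext_iff] at h2
    push_cast
    omega

theorem Z_pos {γ : ℝ} (h1 : 0 < γ) (h2 : 0 < sbθ γ) (m : ℕ) : 0 < ZSb γ (m+1) := by
  unfold ZSb
  have nn : ∀ p : ℤ × ℤ, 0 ≤ (if ∃ W : ℕ → ℤ × ℤ, IsWalkSb (m+1) W ∧ W (m + 1 - 1) = p then
    γ ^ p.1.toNat * (sbθ γ) ^ p.2.toNat else 0) := by
    intro p
    split_ifs
    · positivity
    · exact le_rfl
  have hs : Summable (fun p : ℤ × ℤ => if ∃ W : ℕ → ℤ × ℤ, IsWalkSb (m+1) W ∧ W (m + 1 - 1) = p then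
    γ ^ p.1.toNat * (sbθ γ) ^ p.2.toNat else 0) := by
    apply summable_of_ne_finset_zero (s := Finset.Icc (0:ℤ) m ×ˢ Finset.Icc (0:ℤ) m)
    intro p hp
    rw [if_neg]
    rintro ⟨W, hW, rfl⟩
    apply hp
    have b1 := walk_bound hW m (by omega)
    have b2 := hW.2.1 m (by omega)
    simp only [Nat.add_sub_cancel, Finset.mem_product, Finset.mem_Icc]
    exact ⟨⟨b2.1, b1.1⟩, ⟨b2.2, b1.2⟩⟩
  refine hs.tsum_pos nn (0, (m:ℤ)) ?_
  rw [if_pos]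
  · positivity
  · refine ⟨fun k => (0, (k:ℤ)), ⟨rfl, fun k _ => ⟨le_rfl, Int.natCast_nonneg k⟩, fun k _ => ?_⟩, ?_⟩
    · simp [ISb]
    · simp

theorem term_eq {γ : ℝ} (h1 : 0 < γ) (h2 : 0 < sbθ γ) (m : ℕ) (s : ℤ × ℤ)
    (g : Fin m → ℤ × ℤ) (h : EV m s g) :
    νSb γ (m+1) s * ∏ i, revWSb γ (g i) = sbα γ ^ m / ZSb γ (m+1) := by
  have hex : ∃ W : ℕ → ℤ × ℤ, IsWalkSb (m+1) W ∧ W (m + 1 - 1) = s :=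
    ⟨_, h, by simp [pathFrom]⟩
  have hs : 0 ≤ s.1 ∧ 0 ≤ s.2 := by
    have := h.2.1 m (by omega)
    simpa [pathFrom] using this
  rw [← weight_eq h1 h2 m s g h]
  simp only [νSb]
  rw [if_pos hex]
  have e1 : γ ^ s.1.toNat = γ ^ s.1 := by
    rw [← zpow_natCast, Int.toNat_of_nonneg hs.1]
  have e2 : sbθ γ ^ s.2.toNat = sbθ γ ^ s.2 := by
    rw [← zpow_natCast, Int.toNat_of_nonneg hs.2]
  rw [e1, e2]
  ring

theorem inner_eq {γ : ℝ} (h1 : 0 < γ) (h2 : 0 < sbθ γ) (m : ℕ) (s : ℤ × ℤ) :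
    ∑' g : Fin m → ℤ × ℤ, (if EV m s g then νSb γ (m+1) s * ∏ i, revWSb γ (g i) else 0)
      = sbα γ ^ m / ZSb γ (m+1) * aZ m s := by
  rw [← count_real, ← tsum_mul_left]
  apply tsum_congr
  intro g
  by_cases h : EV m s g
  · rw [if_pos h, if_pos h, term_eq h1 h2 m s g h, mul_one]
  · rw [if_neg h, if_neg h, mul_zero]

theorem cond_eq {γ : ℝ} (hγ : γ^3 - γ^2 + 2*γ - 1 = 0) (m : ℕ) (p : ℕ × ℕ) :
    condEndpointProb γ (m+1) ((p.1 : ℤ), (p.2 : ℤ)) = cnt m p / qq m (0, 0) := by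
  obtain ⟨h1, h2, h3⟩ := root_facts hγ
  have hκ : sbα γ ^ m / ZSb γ (m+1) ≠ 0 := (div_pos (pow_pos h3 m) (Z_pos h1 h2 m)).ne'
  have hden : probPathSb γ (m+1) (fun x => IsWalkSb (m+1) (fun k => x (m + 1 - 1 - k)))
      = sbα γ ^ m / ZSb γ (m+1) * qq m (0, 0) := by
    rw [← tsum_aZ, ← tsum_mul_left]
    simp only [← inner_eq h1 h2]
    rfl
  have hnum : probPathSb γ (m+1)
      (fun x => IsWalkSb (m+1) (fun k => x (m + 1 - 1 - k)) ∧ x 0 = ((p.1 : ℤ), (p.2 : ℤ)))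
      = sbα γ ^ m / ZSb γ (m+1) * cnt m p := by
    rw [← aZ_castP, ← inner_eq h1 h2]
    unfold probPathSb
    rw [tsum_eq_single (castP p)]
    · apply tsum_congr
      intro g
      by_cases h : EV m (castP p) g
      · rw [if_pos h]
        exact if_pos ⟨h, rfl⟩
      · rw [if_neg h]
        exact if_neg (fun h2 => h h2.1)
    · intro s hs
      refine (tsum_congr (fun g => ?_)).trans tsum_zero
      exact if_neg (fun h => hs h.2)
  unfold condEndpointProb
  rw [hnum, hden, mul_div_mul_left _ _ hκ]

end SBx

theorem strong_baxter_endpoint_tightness (γ : ℝ) (hγ : γ^3 - γ^2 + 2*γ - 1 = 0) :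
    ∑' p : ℕ × ℕ,
      Filter.liminf (fun n : ℕ => condEndpointProb γ n ((p.1 : ℤ), (p.2 : ℤ)))
        Filter.atTop = 1 := by
  obtain ⟨π, hπ, hsum⟩ := SBx.endpoint_limit
  rw [← hsum]
  apply tsum_congr
  intro p
  apply Filter.Tendsto.liminf_eq
  rw [← Filter.tendsto_add_atTop_iff_nat 1]
  simp only [SBx.cond_eq hγ]
  exact hπ p
end
end
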